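/- Any two finite groups G and H, each of order 2^4 · 3 · 5 · 7 · 31^2 · 61^3 · 523 and each having prime graph degrees deg(2) = 4, deg(3) = 3, deg(5) = 3, deg(7) = 1, deg(31) = 4, deg(61) = 2, deg(523) = 1, are isomorphic. -/

import Mathlib

/-- The degree of the prime `p` in the prime graph (Gruenberg–Kegel graph) `GK(G)` of the
group `G`: the number of primes `q ≠ p` such that `G` contains an element of order `p * q`
(two distinct primes being adjacent in `GK(G)` iff `G` has an element of order their
product). -/
noncomputable def gkDegree (G : Type*) [Group G] (p : ℕ) : ℕ :=
  Nat.card {q : ℕ // p ≠ q ∧ p.Prime ∧ q.Prime ∧ ∃ g : G, orderOf g = p * q}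

open Subgroup
open scoped Pointwise

local notation "𝐍(" S ")" => Subgroup.normalizer (SetLike.coe S)
local notation "𝐂(" S ")" => Subgroup.centralizer (SetLike.coe S)

section Conj
variable {G : Type*} [Group G] {S A B : Subgroup G} {g x : G}

lemma mem_conj_smul : x ∈ MulAut.conj g • S ↔ g⁻¹ * x * g ∈ S := by
  rw [mem_pointwise_smul_iff_inv_smul_mem, ← map_inv]
  simp [MulAut.smul_def]

lemma conj_smul_eq_iff : MulAut.conj g • S = S ↔ g ∈ 𝐍(S) := by
  rw [mem_normalizer_iff']
  constructor
  · intro h x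
    conv_rhs => rw [← h, mem_conj_smul]
    simp
  · intro h
    ext x
    rw [mem_conj_smul, h]
    simp

lemma card_conj_smul : Nat.card (MulAut.conj g • S : Subgroup G) = Nat.card S :=
  Nat.card_congr (equivSMul (MulAut.conj g) S).toEquiv.symm

lemma conj_smul_mul (g h : G) : MulAut.conj (g * h) • S = MulAut.conj g • MulAut.conj h • S := by
  rw [map_mul, mul_smul]

lemma conj_smul_eq_comm (h : MulAut.conj g • A = B) : MulAut.conj g⁻¹ • B = A := by
  rw [map_inv, ← h, inv_smul_smul]

lemma normalizer_conj_smul : 𝐍(MulAut.conj g • S) = MulAut.conj g • 𝐍(S) := by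
  ext x
  rw [mem_conj_smul, ← conj_smul_eq_iff, ← conj_smul_eq_iff]
  constructor
  · intro h
    rw [conj_smul_mul, conj_smul_mul, h, map_inv, inv_smul_smul]
  · intro h
    rw [conj_smul_mul, conj_smul_mul, map_inv, inv_smul_eq_iff] at h
    exact h

lemma mem_centralizer_conj_smul :
    x ∈ 𝐂(MulAut.conj g • S) ↔ g⁻¹ * x * g ∈ 𝐂(S) := by
  simp only [mem_centralizer_iff, SetLike.mem_coe, mem_conj_smul]
  constructor
  · intro h y hy
    have := h (g * y * g⁻¹) (by simpa [mul_assoc] using hy)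
    calc y * (g⁻¹ * x * g) = g⁻¹ * (g * y * g⁻¹ * x) * g := by group
      _ = _ := by rw [this]; group
  · intro h y hy
    have := h _ hy
    calc y * x = g * (g⁻¹ * y * g * (g⁻¹ * x * g)) * g⁻¹ := by group
      _ = _ := by rw [this]; group

lemma centralizer_conj_smul : 𝐂(MulAut.conj g • S) = MulAut.conj g • 𝐂(S) := by
  ext x
  rw [mem_conj_smul, mem_centralizer_conj_smul]

lemma conj_smul_mono (h : A ≤ B) : MulAut.conj g • A ≤ MulAut.conj g • B := by
  intro x hx
  rw [mem_conj_smul] at *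
  exact h hx

lemma conj_smul_of_centralizer (h : g ∈ 𝐂(S)) : MulAut.conj g • S = S :=
  conj_smul_eq_iff.2 (centralizer_le_normalizer _ h)

lemma commute_of_mem_centralizer {y : G} (h : x ∈ 𝐂(S)) (hy : y ∈ S) : Commute x y :=
  (mem_centralizer_iff.1 h y hy).symm

end Conj

/-- `S` is a Sylow `p`-subgroup of `H`, both being subgroups of an ambient group. -/
def IsSylowIn {G : Type*} [Group G] (p : ℕ) (S H : Subgroup G) : Prop :=
  S ≤ H ∧ Nat.card S = p ^ (Nat.card H).factorization p

section Sylow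
variable {G : Type*} [Group G] [Finite G] {p : ℕ} {S S' H H' A Q : Subgroup G}

lemma factorization_of_eq {n k r : ℕ} (hp : p.Prime) (h : n = p ^ k * r) (hr : ¬ p ∣ r) :
    n.factorization p = k := by
  have hr0 : r ≠ 0 := by rintro rfl; simp at hr
  rw [h, Nat.factorization_mul (pow_ne_zero _ hp.ne_zero) hr0]
  simp [hp.factorization, Nat.factorization_eq_zero_of_not_dvd hr]

lemma isSylowIn_of_card (hp : p.Prime) {k r : ℕ} (hSH : S ≤ H) (hS : Nat.card S = p ^ k)
    (hH : Nat.card H = p ^ k * r) (hr : ¬ p ∣ r) : IsSylowIn p S H :=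
  ⟨hSH, by rw [hS, factorization_of_eq hp hH hr]⟩

lemma IsSylowIn.card_eq (hp : p.Prime) {k r : ℕ} (hS : IsSylowIn p S H)
    (hH : Nat.card H = p ^ k * r) (hr : ¬ p ∣ r) : Nat.card S = p ^ k := by
  rw [hS.2, factorization_of_eq hp hH hr]

lemma card_subgroupOf_of_le (h : S ≤ H) : Nat.card (S.subgroupOf H) = Nat.card S :=
  Nat.card_congr (subgroupOfEquivOfLe h).toEquiv

lemma IsSylowIn.exists_sylow (hp : p.Prime) (hS : IsSylowIn p S H) :
    ∃ T : Sylow p H, (T : Subgroup H) = S.subgroupOf H := by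
  have := Fact.mk hp
  exact ⟨Sylow.ofCard _ ((card_subgroupOf_of_le hS.1).trans hS.2), rfl⟩

lemma isSylowIn_map (hp : p.Prime) (T : Sylow p H) :
    IsSylowIn p ((T : Subgroup H).map H.subtype) H := by
  have := Fact.mk hp
  refine ⟨map_subtype_le _, ?_⟩
  rw [card_map_of_injective H.subtype_injective, T.card_eq_multiplicity]

lemma exists_isSylowIn_ge (hp : p.Prime) (hQH : Q ≤ H) (hQ : IsPGroup p Q) :
    ∃ S, IsSylowIn p S H ∧ Q ≤ S := by
  have := Fact.mk hp
  obtain ⟨T, hT⟩ := (hQ.comap_subtype (K := H)).exists_le_sylow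
  refine ⟨_, isSylowIn_map hp T, fun x hx => ?_⟩
  exact ⟨⟨x, hQH hx⟩, hT (by simpa [mem_subgroupOf] using hx), rfl⟩

lemma exists_isSylowIn (hp : p.Prime) (H : Subgroup G) : ∃ S, IsSylowIn p S H := by
  obtain ⟨S, hS, -⟩ := exists_isSylowIn_ge hp (bot_le : ⊥ ≤ H) IsPGroup.of_bot
  exact ⟨S, hS⟩

lemma IsSylowIn.isPGroup (hS : IsSylowIn p S H) : IsPGroup p S := IsPGroup.of_card hS.2

lemma IsSylowIn.exists_conj (hp : p.Prime) (hS : IsSylowIn p S H) (hS' : IsSylowIn p S' H) :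
    ∃ h ∈ H, MulAut.conj h • S = S' := by
  have := Fact.mk hp
  obtain ⟨T, hT⟩ := hS.exists_sylow hp
  obtain ⟨T', hT'⟩ := hS'.exists_sylow hp
  obtain ⟨h, hh⟩ := MulAction.exists_smul_eq H T T'
  refine ⟨h, h.2, ?_⟩
  have h1 : ((h • T : Sylow p H) : Subgroup H) = T' := by rw [hh]
  rw [Sylow.coe_subgroup_smul, hT, hT', conj_smul_subgroupOf hS.1] at h1
  have h2 := congrArg (Subgroup.map H.subtype) h1
  rwa [map_subgroupOf_eq_of_le hS'.1, map_subgroupOf_eq_of_le (conj_smul_le_of_le hS.1 h)] at h2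

/-- Sylow's counting theorem, inside a subgroup. -/
lemma IsSylowIn.count (hp : p.Prime) (hS : IsSylowIn p S H) :
    ∃ m, m ≡ 1 [MOD p] ∧ Nat.card H = m * Nat.card (H ⊓ 𝐍(S) : Subgroup G) := by
  have := Fact.mk hp
  obtain ⟨T, hT⟩ := hS.exists_sylow hp
  refine ⟨_, card_sylow_modEq_one p H, ?_⟩
  have h1 := T.card_eq_index_normalizer
  have h2 : 𝐍((T : Subgroup H)) = (𝐍(S)).subgroupOf H := by
    rw [hT, subgroupOf_normalizer_eq hS.1]
  have h3 := card_mul_index ((𝐍(S)).subgroupOf H)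
  rw [Sylow.coe_coe] at h2
  rw [h1, ← h3, ← h2, mul_comm]
  congr 1
  rw [h2, ← inf_subgroupOf_left, card_subgroupOf_of_le inf_le_left]

lemma IsSylowIn.of_le (hp : p.Prime) (hS : IsSylowIn p S H) (h1 : S ≤ H') (h2 : H' ≤ H) :
    IsSylowIn p S H' := by
  refine ⟨h1, ?_⟩
  have hd := card_dvd_of_le h1
  have hd' := card_dvd_of_le h2
  rw [hS.2] at hd ⊢
  congr 1
  apply le_antisymm
  · exact (hp.pow_dvd_iff_le_factorization Nat.card_pos.ne').1 hd
  · exact (Nat.factorization_le_iff_dvd Nat.card_pos.ne' Nat.card_pos.ne').2 hd' p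

lemma IsSylowIn.conj (hS : IsSylowIn p S H) (g : G) :
    IsSylowIn p (MulAut.conj g • S) (MulAut.conj g • H) :=
  ⟨conj_smul_mono hS.1, by rw [card_conj_smul, card_conj_smul, hS.2]⟩

lemma conj_smul_eq_self_of_mem' {g : G} (hg : g ∈ H) : MulAut.conj g • H = H :=
  conj_smul_eq_iff.2 (le_normalizer hg)

lemma IsSylowIn.conj_mem (hS : IsSylowIn p S H) {g : G} (hg : g ∈ H) :
    IsSylowIn p (MulAut.conj g • S) H := by
  simpa [conj_smul_eq_self_of_mem' hg] using hS.conj g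

lemma IsSylowIn.conj_normalizer (hS : IsSylowIn p S H) {g : G} (hg : g ∈ 𝐍(H)) :
    IsSylowIn p (MulAut.conj g • S) H := by
  simpa [conj_smul_eq_iff.2 hg] using hS.conj g

lemma IsSylowIn.eq_of_normal (hp : p.Prime) (hS : IsSylowIn p S H) (hn : H ≤ 𝐍(S))
    (hS' : IsSylowIn p S' H) : S' = S := by
  obtain ⟨h, hh, he⟩ := hS.exists_conj hp hS'
  rw [← he, conj_smul_eq_iff.2 (hn hh)]

/-- A normal Sylow subgroup of `A` is normalized by everything normalizing `A`. -/
lemma IsSylowIn.normalizer_le_of_normal (hp : p.Prime) (hS : IsSylowIn p S A) (hn : A ≤ 𝐍(S)) :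
    𝐍(A) ≤ 𝐍(S) := by
  intro g hg
  rw [← conj_smul_eq_iff]
  exact hS.eq_of_normal hp hn (hS.conj_normalizer hg)

/-- The Frattini argument. -/
lemma IsSylowIn.frattini (hp : p.Prime) (hS : IsSylowIn p S A) {g : G} (hg : g ∈ 𝐍(A)) :
    ∃ a ∈ A, a * g ∈ 𝐍(S) := by
  obtain ⟨a, ha, h⟩ := (hS.conj_normalizer hg).exists_conj hp hS
  refine ⟨a, ha, ?_⟩
  rw [← conj_smul_eq_iff, conj_smul_mul, h]

lemma IsSylowIn.le_of_normal (hp : p.Prime) (hS : IsSylowIn p S H) (hn : H ≤ 𝐍(S))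
    (hQ : IsPGroup p Q) (hQH : Q ≤ H) : Q ≤ S := by
  obtain ⟨T, hT, hQT⟩ := exists_isSylowIn_ge hp hQH hQ
  rwa [hS.eq_of_normal hp hn hT] at hQT

/-- Fixed point counting for a `p`-group acting on a subgroup by conjugation. -/
lemma card_inf_centralizer_modEq (hp : p.Prime) (hQ : IsPGroup p Q) (hQS : Q ≤ 𝐍(S)) :
    Nat.card S ≡ Nat.card (S ⊓ 𝐂(Q) : Subgroup G) [MOD p] := by
  have := Fact.mk hp
  let : MulAction Q S := MulAction.compHom S
    ((S.normalizerMonoidHom).comp (inclusion hQS))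
  have hsm : ∀ (q : Q) (s : S), ((q • s : S) : G) = q * s * (q : G)⁻¹ := fun q s => rfl
  refine (hQ.card_modEq_card_fixedPoints S).trans (?_ : _ = _ % p)
  congr 1
  refine Nat.card_congr ⟨fun s => ⟨s.1, s.1.2, ?_⟩, fun s => ⟨⟨s.1, s.2.1⟩, ?_⟩, ?_, ?_⟩
  · intro q hq
    have := congrArg Subtype.val (s.2 ⟨q, hq⟩)
    rw [hsm] at this
    exact mul_inv_eq_iff_eq_mul.1 this
  · intro q
    apply Subtype.ext
    rw [hsm]
    exact mul_inv_eq_iff_eq_mul.2 (s.2.2 q q.2)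
  · intro s; rfl
  · intro s; rfl

lemma exists_mem_orderOf (hp : p.Prime) (h : p ∣ Nat.card H) : ∃ x ∈ H, orderOf x = p := by
  have := Fact.mk hp
  obtain ⟨x, hx⟩ := exists_prime_orderOf_dvd_card' p h
  exact ⟨x, x.2, by rwa [orderOf_coe]⟩

lemma card_eq_card_inf_centralizer_mul (hA : (Nat.card A).Prime) (hH : H ≤ 𝐍(A)) :
    ∃ e, e ∣ Nat.card A - 1 ∧ Nat.card H = Nat.card (H ⊓ 𝐂(A) : Subgroup G) * e := by
  have := Fact.mk hA
  have : IsCyclic A := isCyclic_of_prime_card rfl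
  let f : H →* MulAut A := (A.normalizerMonoidHom).comp (inclusion hH)
  refine ⟨Nat.card f.range, ?_, ?_⟩
  · have := card_subgroup_dvd_card f.range
    rwa [IsCyclic.card_mulAut, Nat.totient_prime hA] at this
  · have hk : f.ker = (H ⊓ 𝐂(A)).subgroupOf H := by
      rw [inf_subgroupOf_left, ← MonoidHom.comap_ker, normalizerMonoidHom_ker]
      ext x
      simp [mem_subgroupOf]
    rw [← card_subgroupOf_of_le (inf_le_left : H ⊓ 𝐂(A) ≤ H), ← hk, ← card_mul_index f.ker,
      index_ker]

end Sylow

lemma le_centralizer_of_card_prime {G : Type*} [Group G] {A : Subgroup G}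
    (hA : (Nat.card A).Prime) : A ≤ 𝐂(A) := by
  have := Fact.mk hA
  have : IsCyclic A := isCyclic_of_prime_card rfl
  rw [le_centralizer_iff_isMulCommutative]
  infer_instance

/-- The arithmetic data of `U_3(61)` used in the sequel: the order together with some edges and
non-edges of the prime graph. -/
structure U361Data (G : Type*) [Group G] : Prop where
  card : Nat.card G = 2^4 * 3 * 5 * 7 * 31^2 * 61^3 * 523
  adj_two_five : ∃ g : G, orderOf g = 2 * 5
  adj_three_five : ∃ g : G, orderOf g = 3 * 5
  adj_five_31 : ∃ g : G, orderOf g = 31 * 5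
  not_adj_seven : ∀ q ∈ [2, 3, 5, 31, 61], ∀ g : G, orderOf g ≠ 7 * q
  not_adj_523 : ∀ q ∈ [2, 3, 5, 31, 61], ∀ g : G, orderOf g ≠ 523 * q
  not_adj_61 : ∀ q ∈ [3, 5], ∀ g : G, orderOf g ≠ 61 * q

section Graph
variable {G : Type*} [Group G] [Finite G]

lemma mem_primes_of_dvd {p : ℕ} (hp : p.Prime)
    (h : p ∣ 2^4 * 3 * 5 * 7 * 31^2 * 61^3 * 523) : p ∈ [2, 3, 5, 7, 31, 61, 523] := by
  have hq : ∀ q : ℕ, q.Prime → p ∣ q → p = q := fun q hq => (Nat.prime_dvd_prime_iff_eq hp hq).1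
  simp only [hp.dvd_mul] at h
  have key : ∀ q k : ℕ, q.Prime → p ∣ q ^ k → p = q := fun q k h1 h2 =>
    hq q h1 (hp.dvd_of_dvd_pow h2)
  simp only [List.mem_cons, List.not_mem_nil, or_false]
  rcases h with (((((h | h) | h) | h) | h) | h) | h
  · exact .inl (key 2 4 (by norm_num) h)
  · exact .inr (.inl (hq 3 (by norm_num) h))
  · exact .inr (.inr (.inl (hq 5 (by norm_num) h)))
  · exact .inr (.inr (.inr (.inl (hq 7 (by norm_num) h))))
  · exact .inr (.inr (.inr (.inr (.inl (key 31 2 (by norm_num) h)))))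
  · exact .inr (.inr (.inr (.inr (.inr (.inl (key 61 3 (by norm_num) h))))))
  · exact .inr (.inr (.inr (.inr (.inr (.inr (hq 523 (by norm_num) h))))))

lemma orderOf_mul_of_commute {p q : ℕ} {x y : G} (hp : p.Prime) (hq : q.Prime) (hpq : p ≠ q)
    (hx : orderOf x = p) (hy : orderOf y = q) (h : Commute x y) : orderOf (x * y) = p * q := by
  rw [h.orderOf_mul_eq_mul_orderOf_of_coprime, hx, hy]
  rw [hx, hy]
  exact (Nat.coprime_primes hp hq).2 hpq

open Classical in
/-- The neighbours of `p` in the prime graph, among the prime divisors of the order. -/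
noncomputable def gkNeighbors (G : Type*) [Group G] (p : ℕ) : Finset ℕ :=
  ({2, 3, 5, 7, 31, 61, 523} : Finset ℕ).filter fun q => p ≠ q ∧ ∃ g : G, orderOf g = p * q

lemma mem_gkNeighbors (hG : Nat.card G = 2^4 * 3 * 5 * 7 * 31^2 * 61^3 * 523) {p q : ℕ} :
    q ∈ gkNeighbors G p ↔ p ≠ q ∧ q.Prime ∧ ∃ g : G, orderOf g = p * q := by
  simp only [gkNeighbors, Finset.mem_filter]
  constructor
  · rintro ⟨h, h1, h2⟩
    refine ⟨h1, ?_, h2⟩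
    simp only [Finset.mem_insert, Finset.mem_singleton] at h
    rcases h with rfl | rfl | rfl | rfl | rfl | rfl | rfl <;> norm_num
  · rintro ⟨h1, h2, g, hg⟩
    refine ⟨?_, h1, g, hg⟩
    have := mem_primes_of_dvd h2 (hG ▸ (Dvd.intro_left p hg.symm).trans (orderOf_dvd_natCard g))
    simpa using this

lemma card_gkNeighbors (hG : Nat.card G = 2^4 * 3 * 5 * 7 * 31^2 * 61^3 * 523) {p : ℕ}
    (hp : p.Prime) : (gkNeighbors G p).card = gkDegree G p := by
  rw [gkDegree, ← Nat.card_eq_finsetCard]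
  exact Nat.card_congr (Equiv.subtypeEquivRight fun q => by
    rw [mem_gkNeighbors hG]; simp [hp])

lemma gkNeighbors_symm (hG : Nat.card G = 2^4 * 3 * 5 * 7 * 31^2 * 61^3 * 523) {p q : ℕ}
    (hp : p.Prime) (h : q ∈ gkNeighbors G p) : p ∈ gkNeighbors G q := by
  rw [mem_gkNeighbors hG] at *
  obtain ⟨h1, h2, g, hg⟩ := h
  exact ⟨h1.symm, hp, g, by rw [hg, mul_comm]⟩

lemma eq_pow_of_dvd_of_prime_dvd {c r : ℕ} (hr : r ∈ [2, 3, 5, 7, 31, 61])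
    (hc : c ∣ 2^4 * 3 * 5 * 7 * 31^2 * 61^3) (h : ∀ q : ℕ, q.Prime → q ∣ c → q = r) :
    c ∈ [1, 2, 4, 8, 16, 3, 5, 7, 31, 961, 61, 3721, 226981] := by
  have hc0 : c ≠ 0 := by rintro rfl; norm_num at hc
  have h1 : c = r ^ c.primeFactorsList.length :=
    Nat.eq_prime_pow_of_unique_prime_dvd hc0 fun {q} hq hqc => h q hq hqc
  generalize c.primeFactorsList.length = b at h1
  subst h1
  have hle : ∀ k, ¬ r ^ k ∣ 2^4 * 3 * 5 * 7 * 31^2 * 61^3 → b < k := by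
    intro k hk
    by_contra! hb
    exact hk ((pow_dvd_pow r hb).trans hc)
  simp only [List.mem_cons, List.not_mem_nil, or_false] at hr
  rcases hr with rfl | rfl | rfl | rfl | rfl | rfl
  · have := hle 5 (by norm_num); interval_cases b <;> simp
  · have := hle 2 (by norm_num); interval_cases b <;> simp
  · have := hle 2 (by norm_num); interval_cases b <;> simp
  · have := hle 2 (by norm_num); interval_cases b <;> simp
  · have := hle 3 (by norm_num); interval_cases b <;> simp
  · have := hle 4 (by norm_num); interval_cases b <;> simp

lemma seven_of_count : ∀ e ∈ Finset.range 523, e ∣ 522 →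
    ∀ c ∈ [1, 2, 4, 8, 16, 3, 5, 7, 31, 961, 61, 3721, 226981], e * c % 523 = 21 → c = 7 := by
  decide +kernel

lemma exists_orderOf_523_mul_seven (hG : Nat.card G = 2^4 * 3 * 5 * 7 * 31^2 * 61^3 * 523)
    (h : gkDegree G 523 = 1) : gkNeighbors G 523 = {7} := by
  have hp : Nat.Prime 523 := by norm_num
  have hN := card_gkNeighbors hG hp
  rw [h, Finset.card_eq_one] at hN
  obtain ⟨r, hr⟩ := hN
  obtain ⟨A, hA⟩ := exists_isSylowIn hp (⊤ : Subgroup G)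
  have hn : Nat.card (⊤ : Subgroup G) = 523 ^ 1 * (2^4 * 3 * 5 * 7 * 31^2 * 61^3) := by
    rw [card_top, hG]; norm_num
  have hA1 := hA.card_eq hp hn (by norm_num)
  rw [pow_one] at hA1
  obtain ⟨m, hm, hcard⟩ := hA.count hp
  obtain ⟨e, he, hce⟩ := card_eq_card_inf_centralizer_mul (A := A) (by rw [hA1]; exact hp) le_rfl
  rw [inf_eq_right.2 (centralizer_le_normalizer _)] at hce
  have hAC : A ≤ 𝐂(A) := le_centralizer_of_card_prime (hA1 ▸ hp)
  obtain ⟨c, hc⟩ := card_dvd_of_le hAC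
  rw [hA1] at hc
  rw [top_inf_eq, hn, hce, hc] at hcard
  have hcard' : 2^4 * 3 * 5 * 7 * 31^2 * 61^3 = m * (c * e) := by
    have : (523 : ℕ) * (2^4 * 3 * 5 * 7 * 31^2 * 61^3) = 523 * (m * (c * e)) := by
      rw [pow_one] at hcard; rw [hcard]; ring
    exact Nat.eq_of_mul_eq_mul_left (by norm_num) this
  have hcd : c ∣ 2^4 * 3 * 5 * 7 * 31^2 * 61^3 := ⟨m * e, by rw [hcard']; ring⟩
  obtain ⟨x, hxA, hx⟩ := exists_mem_orderOf hp (H := A) (by rw [hA1])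
  have hcr : ∀ q : ℕ, q.Prime → q ∣ c → q ∈ gkNeighbors G 523 := by
    intro q hq hqc
    obtain ⟨y, hyC, hy⟩ := exists_mem_orderOf hq (H := 𝐂(A)) (by rw [hc]; exact hqc.mul_left _)
    have hne : 523 ≠ q := by
      rintro rfl
      have := hqc.trans hcd
      norm_num at this
    rw [mem_gkNeighbors hG]
    exact ⟨hne, hq, _, orderOf_mul_of_commute hp hq hne hx hy
      (commute_of_mem_centralizer hyC hxA).symm⟩
  have hr' : r ∈ [2, 3, 5, 7, 31, 61] := by
    have : r ∈ gkNeighbors G 523 := by rw [hr]; simp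
    simp only [gkNeighbors, Finset.mem_filter, Finset.mem_insert, Finset.mem_singleton] at this
    simp only [List.mem_cons, List.not_mem_nil, or_false]
    have h1 := this.1
    have h2 := this.2.1
    clear * - h1 h2
    omega
  have hlist := eq_pow_of_dvd_of_prime_dvd hr' hcd fun q hq hqc => by
    simpa [hr] using hcr q hq hqc
  have hmod : e * c % 523 = 21 := by
    have h1 := hm.mul_right (c * e)
    rw [← hcard', one_mul, mul_comm c e] at h1
    exact h1.symm
  rw [hA1] at he
  have hc7 := seven_of_count e
    (Finset.mem_range.2 (Nat.lt_succ_of_le (Nat.le_of_dvd (by norm_num) he))) he c hlist hmod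
  have := hcr 7 (by norm_num) (by rw [hc7])
  rw [hr, Finset.mem_singleton] at this
  rw [hr, this]

theorem U361Data.of_gkDegree (hG : Nat.card G = 2^4 * 3 * 5 * 7 * 31^2 * 61^3 * 523)
    (h2 : gkDegree G 2 = 4) (h3 : gkDegree G 3 = 3) (h5 : gkDegree G 5 = 3)
    (h7 : gkDegree G 7 = 1) (h31 : gkDegree G 31 = 4) (h61 : gkDegree G 61 = 2)
    (h523 : gkDegree G 523 = 1) : U361Data G := by
  have e523 := exists_orderOf_523_mul_seven hG h523
  have p2 : Nat.Prime 2 := by norm_num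
  have p3 : Nat.Prime 3 := by norm_num
  have p5 : Nat.Prime 5 := by norm_num
  have p7 : Nat.Prime 7 := by norm_num
  have p31 : Nat.Prime 31 := by norm_num
  have p61 : Nat.Prime 61 := by norm_num
  have p523 : Nat.Prime 523 := by norm_num
  rw [← card_gkNeighbors hG p2] at h2
  rw [← card_gkNeighbors hG p3] at h3
  rw [← card_gkNeighbors hG p5] at h5
  rw [← card_gkNeighbors hG p7] at h7
  rw [← card_gkNeighbors hG p31] at h31
  rw [← card_gkNeighbors hG p61] at h61
  have hs : ∀ {p q}, p.Prime → q ∈ gkNeighbors G p → p ∈ gkNeighbors G q :=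
    fun {p q} hp h => gkNeighbors_symm hG hp h
  have e7 : gkNeighbors G 7 = {523} := by
    symm
    apply Finset.eq_of_subset_of_card_le
    · simpa using hs p523 (by simp [e523])
    · simp [h7]
  have n7 : ∀ {p}, p.Prime → p ≠ 523 → 7 ∉ gkNeighbors G p := fun {p} hp hne h => by
    have := hs hp h
    rw [e7, Finset.mem_singleton] at this
    exact hne this
  have n523 : ∀ {p}, p.Prime → p ≠ 7 → 523 ∉ gkNeighbors G p := fun {p} hp hne h => by
    have := hs hp h
    rw [e523, Finset.mem_singleton] at this
    exact hne this
  have hsub : ∀ {p q}, q ∈ gkNeighbors G p → p ≠ q ∧ q ∈ [2, 3, 5, 7, 31, 61, 523] := by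
    intro p q h
    simp only [gkNeighbors, Finset.mem_filter, Finset.mem_insert, Finset.mem_singleton] at h
    simp only [List.mem_cons, List.not_mem_nil, or_false]
    have h1 := h.1
    have h2 := h.2.1
    clear * - h1 h2
    omega
  have main : ∀ {p : ℕ} (s : Finset ℕ), p.Prime → p ≠ 523 → p ≠ 7 → (gkNeighbors G p).card = s.card →
      (∀ q ∈ [2, 3, 5, 31, 61], q ∈ gkNeighbors G p → q ∈ s) →
      gkNeighbors G p = s := by
    intro p s hp h1 h2 hcard hs'
    apply Finset.eq_of_subset_of_card_le _ hcard.ge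
    intro q hq
    apply hs' q _ hq
    have h3 := (hsub hq).2
    have h4 : q ≠ 7 := by rintro rfl; exact n7 hp h1 hq
    have h5 : q ≠ 523 := by rintro rfl; exact n523 hp h2 hq
    simp only [List.mem_cons, List.not_mem_nil, or_false] at h3 ⊢
    omega
  have nself : ∀ {p q}, q ∈ gkNeighbors G p → p ≠ q := fun h => (hsub h).1
  have e31 : gkNeighbors G 31 = {2, 3, 5, 61} := by
    apply main _ p31 (by norm_num) (by norm_num) (by rw [h31]; rfl)
    intro q hq h
    have := nself h
    simp only [List.mem_cons, List.not_mem_nil, or_false] at hq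
    simp only [Finset.mem_insert, Finset.mem_singleton]
    omega
  have e2 : gkNeighbors G 2 = {3, 5, 31, 61} := by
    apply main _ p2 (by norm_num) (by norm_num) (by rw [h2]; rfl)
    intro q hq h
    have := nself h
    simp only [List.mem_cons, List.not_mem_nil, or_false] at hq
    simp only [Finset.mem_insert, Finset.mem_singleton]
    omega
  have e61 : gkNeighbors G 61 = {2, 31} := by
    symm
    apply Finset.eq_of_subset_of_card_le
    · intro q hq
      simp only [Finset.mem_insert, Finset.mem_singleton] at hq
      rcases hq with rfl | rfl
      · exact hs p2 (by simp [e2])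
      · exact hs p31 (by simp [e31])
    · rw [h61]; rfl
  have n3 : 61 ∉ gkNeighbors G 3 := fun h => by
    have := hs p3 h
    simp [e61] at this
  have n5 : 61 ∉ gkNeighbors G 5 := fun h => by
    have := hs p5 h
    simp [e61] at this
  have e3 : gkNeighbors G 3 = {2, 5, 31} := by
    apply main _ p3 (by norm_num) (by norm_num) (by rw [h3]; rfl)
    intro q hq h
    have := nself h
    have : q ≠ 61 := by rintro rfl; exact n3 h
    simp only [List.mem_cons, List.not_mem_nil, or_false] at hq
    simp only [Finset.mem_insert, Finset.mem_singleton]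
    omega
  have hprime : ∀ q ∈ [2, 3, 5, 31, 61], q.Prime := by
    simp only [List.mem_cons, List.not_mem_nil, or_false]
    rintro q (rfl | rfl | rfl | rfl | rfl) <;> norm_num
  refine ⟨hG, ?_, ?_, ?_, ?_, ?_, ?_⟩
  · have : 5 ∈ gkNeighbors G 2 := by simp [e2]
    exact ((mem_gkNeighbors hG).1 this).2.2
  · have : 5 ∈ gkNeighbors G 3 := by simp [e3]
    exact ((mem_gkNeighbors hG).1 this).2.2
  · have : 5 ∈ gkNeighbors G 31 := by simp [e31]
    exact ((mem_gkNeighbors hG).1 this).2.2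
  · intro q hq g hg
    have hqp := hprime q hq
    have hq7 : 7 ≠ q := by rintro rfl; simp at hq
    have : q ∈ gkNeighbors G 7 := (mem_gkNeighbors hG).2 ⟨hq7, hqp, g, hg⟩
    rw [e7, Finset.mem_singleton] at this
    subst this
    simp at hq
  · intro q hq g hg
    have hqp := hprime q hq
    have hq7 : 523 ≠ q := by rintro rfl; simp at hq
    have : q ∈ gkNeighbors G 523 := (mem_gkNeighbors hG).2 ⟨hq7, hqp, g, hg⟩
    rw [e523, Finset.mem_singleton] at this
    subst this
    simp at hq
  · intro q hq g hg
    have hqp := hprime q (by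
      simp only [List.mem_cons, List.not_mem_nil, or_false] at hq ⊢
      omega)
    have hq7 : 61 ≠ q := by rintro rfl; simp at hq
    have : q ∈ gkNeighbors G 61 := (mem_gkNeighbors hG).2 ⟨hq7, hqp, g, hg⟩
    rw [e61] at this
    simp only [List.mem_cons, List.not_mem_nil, or_false, Finset.mem_insert, Finset.mem_singleton] at hq this
    omega

end Graph

section Arithmetic

lemma div_modEq_of_eq_mul {p m a b s : ℕ} (hm : m ≡ 1 [MOD p]) (h : a = m * b) (hs : s ∣ b)
    (hs0 : 0 < s) : a / s ≡ b / s [MOD p] := by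
  obtain ⟨t, rfl⟩ := hs
  rw [h, Nat.mul_div_cancel_left _ hs0, mul_left_comm, Nat.mul_div_cancel_left _ hs0]
  simpa using hm.mul_right t

lemma exists_form_of_dvd {h : ℕ} (hd : h ∣ 2^4 * 3 * 5 * 7 * 31^2 * 61^3 * 523)
    (h7 : ¬ 7 ∣ h) (h523 : ¬ 523 ∣ h) :
    ∃ e ∈ Nat.divisors 240, ∃ b ∈ Finset.range 3, ∃ c ∈ Finset.range 4,
      h = e * 31 ^ b * 61 ^ c := by
  have p7 : Nat.Prime 7 := by norm_num
  have p523 : Nat.Prime 523 := by norm_num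
  have h1 : h ∣ 2^4 * 3 * 5 * 7 * 31^2 * 61^3 :=
    ((Nat.Prime.coprime_iff_not_dvd p523).2 h523).symm.dvd_of_dvd_mul_right hd
  have h2 : h ∣ 240 * 31^2 * 61^3 := by
    have : 2^4 * 3 * 5 * 7 * 31^2 * 61^3 = 240 * 31^2 * 61^3 * 7 := by norm_num
    rw [this] at h1
    exact ((Nat.Prime.coprime_iff_not_dvd p7).2 h7).symm.dvd_of_dvd_mul_right h1
  obtain ⟨y, z, hy, hz, rfl⟩ := (Nat.dvd_mul).1 h2
  obtain ⟨c, hc, rfl⟩ := (Nat.dvd_prime_pow (by norm_num)).1 hz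
  obtain ⟨e, w, he, hw, rfl⟩ := (Nat.dvd_mul).1 hy
  obtain ⟨b, hb, rfl⟩ := (Nat.dvd_prime_pow (by norm_num)).1 hw
  exact ⟨e, Nat.mem_divisors.2 ⟨he, by norm_num⟩, b, Finset.mem_range.2 (by omega), c,
    Finset.mem_range.2 (by omega), rfl⟩

end Arithmetic

section General
variable {G : Type*} [Group G] [Finite G] {p : ℕ} {S H A B Q : Subgroup G}

lemma IsSylowIn.le_inf_normalizer (hS : IsSylowIn p S H) : S ≤ H ⊓ 𝐍(S) :=
  le_inf hS.1 le_normalizer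

lemma IsSylowIn.count_mod (hp : p.Prime) (hS : IsSylowIn p S H) :
    Nat.card H / Nat.card S ≡ Nat.card (H ⊓ 𝐍(S) : Subgroup G) / Nat.card S [MOD p] := by
  obtain ⟨m, hm, h⟩ := hS.count hp
  exact div_modEq_of_eq_mul hm h (card_dvd_of_le hS.le_inf_normalizer) Nat.card_pos

/-- A subgroup normalizing a subgroup `A` of prime order centralizes it as soon as its order is
coprime to `|A| - 1`. -/
lemma le_centralizer_of_coprime (hA : (Nat.card A).Prime) (hH : H ≤ 𝐍(A))
    (hc : (Nat.card H).Coprime (Nat.card A - 1)) : H ≤ 𝐂(A) := by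
  obtain ⟨e, he, h⟩ := card_eq_card_inf_centralizer_mul hA hH
  have he1 : e = 1 := Nat.eq_one_of_dvd_coprimes hc (Dvd.intro_left _ h.symm) he
  rw [he1, mul_one] at h
  exact inf_eq_left.1 (eq_of_le_of_card_ge inf_le_left h.le)

lemma le_centralizer_comm : A ≤ 𝐂(B) ↔ B ≤ 𝐂(A) := le_centralizer_iff

lemma relIndex_mul_card_inf (A B : Subgroup G) :
    A.relIndex B * Nat.card (A ⊓ B : Subgroup G) = Nat.card B := by
  rw [← card_mul_index ((A ⊓ B).subgroupOf B), card_subgroupOf_of_le inf_le_right,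
    inf_subgroupOf_right, mul_comm, relIndex]

lemma card_mul_card_le {M : Subgroup G} (hA : A ≤ M) (hB : B ≤ M) :
    Nat.card A * Nat.card B ≤ Nat.card M * Nat.card (A ⊓ B : Subgroup G) := by
  have h1 := relIndex_mul_card_inf A B
  have h2 := relIndex_mul_card_inf A M
  rw [inf_eq_left.2 hA] at h2
  have h3 : A.relIndex B ≤ A.relIndex M :=
    relIndex_le_of_le_right hB (fun h => by rw [h, zero_mul] at h2; exact Nat.card_pos.ne h2)
  calc Nat.card A * Nat.card B
      = Nat.card A * Nat.card (A ⊓ B : Subgroup G) * A.relIndex B := by rw [← h1]; ring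
    _ ≤ Nat.card A * Nat.card (A ⊓ B : Subgroup G) * A.relIndex M := Nat.mul_le_mul_left _ h3
    _ = _ := by rw [← h2]; ring

lemma le_centralizer_of_card_sq (hp : p.Prime) (hS : Nat.card S = p ^ 2) : S ≤ 𝐂(S) := by
  have := Fact.mk hp
  have := IsPGroup.isMulCommutative_of_card_eq_prime_sq hS
  exact le_centralizer_iff_isMulCommutative.2 this

lemma not_dvd_card_centralizer {q : ℕ} (hp : p.Prime) (hq : q.Prime) (hpq : p ≠ q)
    (h : ∀ g : G, orderOf g ≠ p * q) (hA : p ∣ Nat.card A) : ¬ q ∣ Nat.card 𝐂(A) := by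
  intro hd
  obtain ⟨x, hxA, hx⟩ := exists_mem_orderOf hp hA
  obtain ⟨y, hyC, hy⟩ := exists_mem_orderOf hq hd
  exact h _ (orderOf_mul_of_commute hp hq hpq hx hy (commute_of_mem_centralizer hyC hxA).symm)

lemma modEq_one_of_dvd_normalizer {r : ℕ} (hr : r.Prime) (hd : r ∣ Nat.card 𝐍(S))
    (h : ∀ q : ℕ, q.Prime → q ∣ Nat.card S → q ≠ r ∧ ∀ g : G, orderOf g ≠ r * q) :
    Nat.card S ≡ 1 [MOD r] := by
  have := Fact.mk hr
  obtain ⟨x, hxN, hx⟩ := exists_mem_orderOf hr hd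
  have hz : IsPGroup r (zpowers x) := IsPGroup.of_card (n := 1) (by rw [Nat.card_zpowers, hx, pow_one])
  refine (card_inf_centralizer_modEq hr hz (zpowers_le.2 hxN)).trans ?_
  suffices Nat.card (S ⊓ 𝐂(zpowers x) : Subgroup G) = 1 by rw [this]
  by_contra h1
  obtain ⟨q, hq, hqd⟩ := Nat.exists_prime_and_dvd h1
  obtain ⟨h2, h3⟩ := h q hq (hqd.trans (card_dvd_of_le inf_le_left))
  exact not_dvd_card_centralizer hr hq h2.symm h3 (by rw [Nat.card_zpowers, hx])
    (hqd.trans (card_dvd_of_le inf_le_right))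

lemma eq_of_le_of_card_eq (h : A ≤ B) (hc : Nat.card A = Nat.card B) : A = B :=
  eq_of_le_of_card_ge h hc.ge

end General

lemma IsSylowIn.normal_of_card {G : Type*} [Group G] [Finite G] {p : ℕ} {S H : Subgroup G}
    (hp : p.Prime) (hS : IsSylowIn p S H)
    (h : ∀ m j, m ≡ 1 [MOD p] → Nat.card H = m * (Nat.card S * j) → m = 1) : H ≤ 𝐍(S) := by
  obtain ⟨m, hm, hc⟩ := hS.count hp
  obtain ⟨j, hj⟩ := card_dvd_of_le hS.le_inf_normalizer
  rw [hj] at hc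
  obtain rfl := h m j hm hc
  rw [one_mul, ← hj] at hc
  exact inf_eq_left.1 (eq_of_le_of_card_eq inf_le_left hc.symm)

namespace U361Data
variable {G : Type*} [Group G] [Finite G] {S H A R T : Subgroup G}

lemma card_top' (hG : U361Data G) :
    Nat.card (⊤ : Subgroup G) = 2^4 * 3 * 5 * 7 * 31^2 * 61^3 * 523 := by
  rw [card_top, hG.card]

lemma card_dvd (hG : U361Data G) (H : Subgroup G) :
    Nat.card H ∣ 2^4 * 3 * 5 * 7 * 31^2 * 61^3 * 523 := hG.card ▸ card_subgroup_dvd_card H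

lemma not_seven_dvd_normalizer (hG : U361Data G) {q k : ℕ} (hq : q ∈ [31, 61])
    (hS : Nat.card S = q ^ k) (hk : ¬ q ^ k ≡ 1 [MOD 7]) : ¬ 7 ∣ Nat.card 𝐍(S) := fun hd =>
  hk <| hS ▸ modEq_one_of_dvd_normalizer (by norm_num) hd fun r hr hrd => by
    have hrq : r = q := by
      rw [hS] at hrd
      refine (Nat.prime_dvd_prime_iff_eq hr ?_).1 (hr.dvd_of_dvd_pow hrd)
      simp only [List.mem_cons, List.not_mem_nil, or_false] at hq
      rcases hq with rfl | rfl <;> norm_num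
    subst hrq
    simp only [List.mem_cons, List.not_mem_nil, or_false] at hq
    exact ⟨by omega, hG.not_adj_seven r (by rcases hq with rfl | rfl <;> simp)⟩

lemma not_523_dvd_normalizer (hG : U361Data G) {q k : ℕ} (hq : q ∈ [31, 61])
    (hS : Nat.card S = q ^ k) (hk : ¬ q ^ k ≡ 1 [MOD 523]) : ¬ 523 ∣ Nat.card 𝐍(S) := fun hd =>
  hk <| hS ▸ modEq_one_of_dvd_normalizer (by norm_num) hd fun r hr hrd => by
    have hrq : r = q := by
      rw [hS] at hrd
      refine (Nat.prime_dvd_prime_iff_eq hr ?_).1 (hr.dvd_of_dvd_pow hrd)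
      simp only [List.mem_cons, List.not_mem_nil, or_false] at hq
      rcases hq with rfl | rfl <;> norm_num
    subst hrq
    simp only [List.mem_cons, List.not_mem_nil, or_false] at hq
    exact ⟨by omega, hG.not_adj_523 r (by rcases hq with rfl | rfl <;> simp)⟩

lemma exists_form_of_le_normalizer (hG : U361Data G) {q k : ℕ}
    (hqk : (q, k) ∈ [(31, 1), (31, 2), (61, 3)]) (hS : Nat.card S = q ^ k) (hH : H ≤ 𝐍(S)) :
    ∃ e ∈ Nat.divisors 240, ∃ b ∈ Finset.range 3, ∃ c ∈ Finset.range 4,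
      Nat.card H = e * 31 ^ b * 61 ^ c := by
  have h1 : q ∈ [31, 61] ∧ ¬ q ^ k ≡ 1 [MOD 7] ∧ ¬ q ^ k ≡ 1 [MOD 523] := by
    have : ∀ x ∈ [(31, 1), (31, 2), (61, 3)], x.1 ∈ [31, 61] ∧ ¬ x.1 ^ x.2 ≡ 1 [MOD 7] ∧
      ¬ x.1 ^ x.2 ≡ 1 [MOD 523] := by decide
    exact this _ hqk
  exact exists_form_of_dvd (hG.card_dvd H)
    (fun h => hG.not_seven_dvd_normalizer h1.1 hS h1.2.1 (h.trans (card_dvd_of_le hH)))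
    (fun h => hG.not_523_dvd_normalizer h1.1 hS h1.2.2 (h.trans (card_dvd_of_le hH)))

lemma isSylowIn_31 (hG : U361Data G) (hS : Nat.card S = 31 ^ 2) (hSH : S ≤ H) :
    IsSylowIn 31 S H := by
  have h : IsSylowIn 31 S ⊤ := isSylowIn_of_card (k := 2) (r := 2^4 * 3 * 5 * 7 * 61^3 * 523)
    (by norm_num) le_top hS (by rw [hG.card_top']; norm_num) (by norm_num)
  exact h.of_le (by norm_num) hSH le_top

lemma isSylowIn_61 (hG : U361Data G) (hS : Nat.card S = 61 ^ 3) (hSH : S ≤ H) :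
    IsSylowIn 61 S H := by
  have h : IsSylowIn 61 S ⊤ := isSylowIn_of_card (k := 3) (r := 2^4 * 3 * 5 * 7 * 31^2 * 523)
    (by norm_num) le_top hS (by rw [hG.card_top']; norm_num) (by norm_num)
  exact h.of_le (by norm_num) hSH le_top

lemma card_normalizer_31 (hG : U361Data G) (hS : Nat.card S = 31 ^ 2) :
    Nat.card 𝐍(S) = 961 * 24 ∨ Nat.card 𝐍(S) = 961 * 24 * 61 ^ 2 := by
  have h1 := (hG.isSylowIn_31 hS le_top).count_mod (by norm_num)
  have h2 := card_dvd_of_le (le_normalizer (H := S))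
  rw [top_inf_eq, hG.card_top', hS] at h1
  obtain ⟨e, he, b, hb, c, hc, h⟩ := hG.exists_form_of_le_normalizer (q := 31) (k := 2)
    (by simp) hS le_rfl
  rw [h] at h1 h2 ⊢
  rw [hS] at h2
  clear * - h1 h2 he hb hc
  revert h1 h2
  revert c
  revert b
  revert e
  decide +kernel

lemma five_not_dvd_normalizer_31 (hG : U361Data G) (hS : Nat.card S = 31 ^ 2) :
    ¬ 5 ∣ Nat.card 𝐍(S) := by
  rcases hG.card_normalizer_31 hS with h | h <;> rw [h] <;> norm_num

lemma dvd_card_centralizer_of_adj_five (hG : U361Data G) {q : ℕ}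
    (h : ∃ g : G, orderOf g = q * 5) (hT : Nat.card T = 5) :
    q ∣ Nat.card 𝐂(T) := by
  have p5 : Nat.Prime 5 := by norm_num
  obtain ⟨g, hg⟩ := h
  have hq0 : q ≠ 0 := by
    rintro rfl
    have := orderOf_pos g
    omega
  have hs : ∀ {T' : Subgroup G}, Nat.card T' = 5 → IsSylowIn 5 T' ⊤ := fun {T'} hT' =>
    isSylowIn_of_card (k := 1) (r := 2^4 * 3 * 7 * 31^2 * 61^3 * 523) p5 le_top hT'
      (by rw [hG.card_top']; norm_num) (by norm_num)
  have hT' : Nat.card (zpowers (g ^ q)) = 5 := by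
    rw [Nat.card_zpowers, orderOf_pow_of_dvd hq0 (by rw [hg]; exact Dvd.intro _ rfl), hg,
      Nat.mul_div_cancel_left _ (Nat.pos_of_ne_zero hq0)]
  obtain ⟨x, -, hx⟩ := (hs hT').exists_conj p5 (hs hT)
  rw [← hx, centralizer_conj_smul, card_conj_smul]
  have h5 : g ^ 5 ∈ 𝐂(zpowers (g ^ q)) := by
    rw [mem_centralizer_iff]
    rintro y ⟨k, rfl⟩
    exact (((Commute.refl g).pow_pow q 5).zpow_left k).eq
  have := orderOf_dvd_natCard (⟨g ^ 5, h5⟩ : 𝐂(zpowers (g ^ q)))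
  rwa [orderOf_mk, orderOf_pow_of_dvd (by norm_num) (by rw [hg]; exact Dvd.intro_left _ rfl), hg,
    Nat.mul_div_cancel _ (by norm_num)] at this

lemma exists_card_31 (hG : U361Data G) :
    ∃ R : Subgroup G, Nat.card R = 31 ∧ 240 ∣ Nat.card 𝐍(R) := by
  have p5 : Nat.Prime 5 := by norm_num
  have p31 : Nat.Prime 31 := by norm_num
  obtain ⟨T, hT⟩ := exists_isSylowIn p5 (⊤ : Subgroup G)
  have hT5 : Nat.card T = 5 := hT.card_eq (k := 1) (r := 2^4 * 3 * 7 * 31^2 * 61^3 * 523) p5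
    (by rw [hG.card_top']; norm_num) (by norm_num)
  have hcount := hT.count_mod p5
  rw [top_inf_eq, hG.card_top', hT5] at hcount
  have hd2 := hG.dvd_card_centralizer_of_adj_five hG.adj_two_five hT5
  have hd3 := hG.dvd_card_centralizer_of_adj_five hG.adj_three_five hT5
  have hd31 := hG.dvd_card_centralizer_of_adj_five hG.adj_five_31 hT5
  have hCN := card_dvd_of_le (centralizer_le_normalizer (T : Set G))
  have hTN := card_dvd_of_le (le_normalizer (H := T))
  obtain ⟨e, he, hce⟩ := card_eq_card_inf_centralizer_mul (A := T) (by rw [hT5]; exact p5) le_rfl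
  rw [inf_eq_right.2 (centralizer_le_normalizer _)] at hce
  have hne : ∀ q : ℕ, q.Prime → 5 < q → (∀ g : G, orderOf g ≠ 5 * q) → ¬ q ∣ Nat.card 𝐍(T) := by
    intro q hq h5 h hd
    rw [hce] at hd
    rcases hq.dvd_mul.1 hd with hd | hd
    · exact not_dvd_card_centralizer p5 hq (by omega) h (by rw [hT5]) hd
    · rw [hT5] at he
      have := Nat.le_of_dvd (by norm_num) (hd.trans he)
      omega
  obtain ⟨e, he, b, hb, c, hc, h⟩ := exists_form_of_dvd (hG.card_dvd 𝐍(T))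
    (hne 7 (by norm_num) (by norm_num) fun g => by
      rw [mul_comm]; exact hG.not_adj_seven 5 (by simp) g)
    (hne 523 (by norm_num) (by norm_num) fun g => by
      rw [mul_comm]; exact hG.not_adj_523 5 (by simp) g)
  have h61 := hne 61 (by norm_num) (by norm_num) fun g => by
      rw [mul_comm]; exact hG.not_adj_61 5 (by simp) g
  have key : Nat.card 𝐍(T) = 240 * 31 ^ 1 ∨ Nat.card 𝐍(T) = 240 * 31 ^ 2 := by
    have h2 := hd2.trans hCN
    have h3 := hd3.trans hCN
    have h31 := hd31.trans hCN
    rw [hT5] at hTN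
    rw [h] at hcount hTN h2 h3 h31 h61 ⊢
    clear * - h2 h3 h31 h61 hcount hTN he hb hc
    revert hcount hTN h2 h3 h31 h61
    revert c
    revert b
    revert e
    decide +kernel
  obtain ⟨b, hb, hN⟩ : ∃ b ∈ [1, 2], Nat.card 𝐍(T) = 240 * 31 ^ b := by
    rcases key with h | h
    · exact ⟨1, by simp, h⟩
    · exact ⟨2, by simp, h⟩
  obtain ⟨R, hR⟩ := exists_isSylowIn p31 𝐍(T)
  have hRc : Nat.card R = 31 ^ b := hR.card_eq p31 (by rw [hN, mul_comm]) (by norm_num)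
  have hRn := hR.normal_of_card p31 (by
    intro m j hm hj
    rw [hN, hRc, mul_left_comm, mul_comm 240] at hj
    have hm2 : m ∈ Nat.divisors 240 := Nat.mem_divisors.2
      ⟨Dvd.intro _ (Nat.eq_of_mul_eq_mul_left (by positivity) hj).symm, by norm_num⟩
    clear * - hm hm2
    revert hm
    revert m
    decide)
  have hTR := card_dvd_of_le hRn
  simp only [List.mem_cons, List.not_mem_nil, or_false] at hb
  rcases hb with rfl | rfl
  · exact ⟨R, by simpa using hRc, (Dvd.intro _ hN.symm).trans hTR⟩
  · refine (hG.five_not_dvd_normalizer_31 hRc (dvd_trans ?_ hTR)).elim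
    rw [hN]
    norm_num

end U361Data

lemma card_eq_of_mem_divisors_sq {p n : ℕ} (hp : p.Prime) (h : n ∣ p ^ 2) :
    n = 1 ∨ n = p ∨ n = p ^ 2 := by
  obtain ⟨k, hk, rfl⟩ := (Nat.dvd_prime_pow hp).1 h
  interval_cases k <;> simp

namespace U361Data
variable {G : Type*} [Group G] [Finite G] {S H A R T : Subgroup G}

lemma sup_eq_of_card_sq {R' : Subgroup G} (hS : Nat.card S = 31 ^ 2)
    (hR : Nat.card R = 31) (hR' : Nat.card R' = 31) (hRS : R ≤ S) (hRS' : R' ≤ S) (hne : R' ≠ R) :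
    R ⊔ R' = S := by
  refine eq_of_le_of_card_eq (sup_le hRS hRS') ?_
  have h := card_dvd_of_le (sup_le hRS hRS')
  rw [hS] at h
  rcases card_eq_of_mem_divisors_sq (by norm_num) h with h | h | h
  · have := card_dvd_of_le (le_sup_left : R ≤ R ⊔ R')
    rw [h, hR] at this
    norm_num at this
  · have h1 := eq_of_le_of_card_eq (le_sup_left : R ≤ R ⊔ R') (by rw [h, hR])
    have h2 := eq_of_le_of_card_eq (le_sup_right : R' ≤ R ⊔ R') (by rw [h, hR'])
    exact (hne (h2.trans h1.symm)).elim
  · rw [h, hS]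

lemma le_normalizer_sup {x : G} {A B : Subgroup G} (hA : x ∈ 𝐍(A)) (hB : x ∈ 𝐍(B)) :
    x ∈ 𝐍(A ⊔ B) := by
  rw [← conj_smul_eq_iff] at *
  rw [smul_sup, hA, hB]

lemma le_centralizer_of_dvd_normalizer_31 {Q : Subgroup G} (hS : Nat.card S = 31 ^ 2)
    (hQ : IsPGroup 61 Q) (hQS : Q ≤ 𝐍(S)) : S ≤ 𝐂(Q) := by
  have h := card_inf_centralizer_modEq (by norm_num) hQ hQS
  have hd := card_dvd_of_le (inf_le_left : S ⊓ 𝐂(Q) ≤ S)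
  rw [hS] at h hd
  rcases card_eq_of_mem_divisors_sq (by norm_num) hd with h' | h' | h'
  · rw [h'] at h
    exact absurd h (by decide)
  · rw [h'] at h
    exact absurd h (by decide)
  · exact inf_eq_left.1 (eq_of_le_of_card_eq inf_le_left (by rw [h', hS]))

/-- If the normalizer of a Sylow `31`-subgroup `S` were too large, all conjugates of `R` would
lie in `S`. -/
lemma conj_le_centralizer_of_card (hG : U361Data G) (hS : Nat.card S = 31 ^ 2)
    (hR : Nat.card R = 31) (hRS : R ≤ S)
    (hL : Nat.card 𝐍(R) = 961 * 240 * 61 ^ 3)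
    (hLS : Nat.card (𝐍(R) ⊓ 𝐍(S) : Subgroup G) = 961 * 8 * 61 ^ 2)
    (hNS : Nat.card 𝐍(S) = 961 * 24 * 61 ^ 2) (g : G) : MulAut.conj g • R ≤ 𝐂(R) := by
  have hSC : S ≤ 𝐂(R) := (le_centralizer_of_card_sq (by norm_num) hS).trans
    (centralizer_le hRS)
  let α := 𝐍(R) ⧸ (𝐍(S)).subgroupOf 𝐍(R)
  let β := 𝐍(S) ⧸ (𝐍(R)).subgroupOf 𝐍(S)
  have hα : Nat.card α = 1830 := by
    have h := relIndex_mul_card_inf 𝐍(S) 𝐍(R)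
    rw [inf_comm, hLS, hL] at h
    change (𝐍(S)).relIndex 𝐍(R) = _
    omega
  have hβ : Nat.card β = 3 := by
    have h := relIndex_mul_card_inf 𝐍(R) 𝐍(S)
    rw [hLS, hNS] at h
    change (𝐍(R)).relIndex 𝐍(S) = _
    omega
  have hγ : Nat.card (G ⧸ 𝐍(R)) = 3661 := by
    have h := card_mul_index 𝐍(R)
    rw [hL, hG.card] at h
    change (𝐍(R)).index = _
    omega
  let f : Option (α × {b : β // b ≠ ((1 : 𝐍(S)) : β)}) → G ⧸ 𝐍(R) := fun o =>
    o.elim ((1 : G) : G ⧸ 𝐍(R)) fun x =>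
      ((x.1.out * x.2.1.out : G) : G ⧸ 𝐍(R))
  have hout : ∀ b : β, b ≠ ((1 : 𝐍(S)) : β) → (b.out : G) ∉ 𝐍(R) := by
    intro b hb h
    apply hb
    rw [← QuotientGroup.out_eq' b, QuotientGroup.eq]
    simpa [mem_subgroupOf] using h
  have hle : ∀ b : β, MulAut.conj (b.out : G) • R ≤ S := fun b =>
    (conj_smul_mono hRS).trans (conj_smul_eq_iff.2 b.out.2).le
  have hSsup : ∀ b : β, b ≠ ((1 : 𝐍(S)) : β) → R ⊔ MulAut.conj (b.out : G) • R = S := by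
    intro b hb
    refine sup_eq_of_card_sq hS hR (by rw [card_conj_smul, hR]) hRS (hle b) fun h => hout b hb ?_
    exact conj_smul_eq_iff.1 h
  have hf : Function.Injective f := by
    have hnone : ∀ x, f none ≠ f (some x) := by
      rintro ⟨a, b, hb⟩ h
      have h := QuotientGroup.eq.1 h
      rw [inv_one, one_mul] at h
      exact hout b hb (((𝐍(R)).mul_mem_cancel_left a.out.2).1 h)
    rintro (_ | ⟨a, b, hb⟩) (_ | ⟨a', b', hb'⟩) h
    · rfl
    · exact (hnone _ h).elim
    · exact (hnone _ h.symm).elim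
    · have h := QuotientGroup.eq.1 h
      simp only at h
      have h1 : MulAut.conj (a.out * b.out : G) • R = MulAut.conj (a'.out * b'.out : G) • R := by
        rw [← conj_smul_eq_iff, mul_inv_rev, conj_smul_mul] at h
        have h2 := conj_smul_eq_comm h
        rwa [← mul_inv_rev, inv_inv] at h2
      have h2 : MulAut.conj ((a'.out⁻¹ * a.out : 𝐍(R)) : G) • MulAut.conj (b.out : G) • R =
          MulAut.conj (b'.out : G) • R := by
        rw [← conj_smul_mul, coe_mul, mul_assoc, conj_smul_mul, h1, ← conj_smul_mul]
        simp
      have h3 : MulAut.conj ((a'.out⁻¹ * a.out : 𝐍(R)) : G) • R = R :=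
        conj_smul_eq_iff.2 (a'.out⁻¹ * a.out).2
      have h4 : ((a'.out⁻¹ * a.out : 𝐍(R)) : G) ∈ 𝐍(S) := by
        rw [← conj_smul_eq_iff]
        have h5 := congrArg (MulAut.conj ((a'.out⁻¹ * a.out : 𝐍(R)) : G) • ·) (hSsup b hb)
        rw [smul_sup, h3, h2, hSsup b' hb'] at h5
        exact h5.symm
      have ha : a' = a := by
        rw [← QuotientGroup.out_eq' a, ← QuotientGroup.out_eq' a', QuotientGroup.eq]
        exact h4
      subst ha
      have hb : b = b' := by
        rw [← QuotientGroup.out_eq' b, ← QuotientGroup.out_eq' b', QuotientGroup.eq]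
        simpa [mem_subgroupOf, mul_assoc] using h
      subst hb
      rfl
  have hcard : Nat.card (Option (α × {b : β // b ≠ ((1 : 𝐍(S)) : β)})) = Nat.card (G ⧸ 𝐍(R)) := by
    have h2 : Nat.card {b : β // b ≠ ((1 : 𝐍(S)) : β)} = 2 := by
      have := Fintype.ofFinite β
      classical
      rw [Nat.card_eq_fintype_card] at hβ ⊢
      rw [Fintype.card_subtype_compl, hβ]
      simp
    rw [Finite.card_option, Nat.card_prod, h2, hα, hγ]
  obtain ⟨o, ho⟩ := ((Nat.bijective_iff_injective_and_card f).2 ⟨hf, hcard⟩).2 (g : G ⧸ 𝐍(R))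
  have hR1 : R ≤ 𝐂(R) := hRS.trans hSC
  rcases o with _ | ⟨a, b, hb⟩
  · have h := QuotientGroup.eq.1 ho
    rw [inv_one, one_mul] at h
    rwa [conj_smul_eq_iff.2 h]
  · have h := QuotientGroup.eq.1 ho
    have hg : g = a.out * (b.out * ((a.out * b.out : G)⁻¹ * g)) := by group
    rw [hg, conj_smul_mul, conj_smul_mul, conj_smul_eq_iff.2 h]
    refine (conj_smul_mono ((hle b).trans hSC)).trans ?_
    rw [← centralizer_conj_smul, conj_smul_eq_iff.2 a.out.2]

lemma card_normalizer_of_240_dvd (hG : U361Data G) (hR : Nat.card R = 31)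
    (h240 : 240 ∣ Nat.card 𝐍(R)) (hS : Nat.card S = 31 ^ 2) (hRS : R ≤ S) :
    Nat.card 𝐍(R) = 961 * 240 * 61 ∧ Nat.card 𝐍(S) = 961 * 24 ∧
      Nat.card (𝐍(R) ⊓ 𝐍(S) : Subgroup G) = 961 * 8 := by
  have p31 : Nat.Prime 31 := by norm_num
  have hSC : S ≤ 𝐂(R) := (le_centralizer_of_card_sq p31 hS).trans (centralizer_le hRS)
  have hSL : S ≤ 𝐍(R) := hSC.trans (centralizer_le_normalizer _)
  have hSd := card_dvd_of_le hSL
  have hcount := (hG.isSylowIn_31 hS hSL).count_mod p31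
  have h961 := card_dvd_of_le (hG.isSylowIn_31 hS hSL).le_inf_normalizer
  have hLSd := card_dvd_of_le (inf_le_right : 𝐍(R) ⊓ 𝐍(S) ≤ 𝐍(S))
  have hLSd' := card_dvd_of_le (inf_le_left : 𝐍(R) ⊓ 𝐍(S) ≤ 𝐍(R))
  rw [hS] at hSd hcount h961
  obtain ⟨e, he, b, hb, c, hc, hL⟩ := hG.exists_form_of_le_normalizer (q := 31) (k := 1)
    (by simp) (by rw [hR, pow_one]) (le_refl 𝐍(R))
  have hL' : e * 31 ^ b = 240 * 961 := by
    rw [hL] at h240 hSd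
    clear * - he hb hc h240 hSd
    revert h240 hSd
    revert c
    revert b
    revert e
    decide +kernel
  rw [hL'] at hL
  obtain ⟨d, hd⟩ := h961
  have hne (h : ¬ 𝐍(S) ≤ 𝐍(R)) : ∃ h ∈ 𝐍(S), MulAut.conj h • R ≠ R := by
    obtain ⟨x, hx, hx'⟩ := SetLike.not_le_iff_exists.1 h
    exact ⟨x, hx, fun h => hx' (conj_smul_eq_iff.1 h)⟩
  have hsup {h : G} (hh : h ∈ 𝐍(S)) (hn : MulAut.conj h • R ≠ R) : R ⊔ MulAut.conj h • R = S :=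
    sup_eq_of_card_sq hS hR (by rw [card_conj_smul, hR]) hRS
      ((conj_smul_mono hRS).trans (conj_smul_eq_iff.2 hh).le) hn
  rcases hG.card_normalizer_31 hS with hN | hN
  · have key : (c = 1 ∨ c = 3) ∧ d = 8 := by
      rw [hN, hd] at hLSd
      rw [hL, hd, Nat.mul_div_cancel_left _ (by norm_num)] at hcount
      have hd24 : d ∈ Nat.divisors 24 := Nat.mem_divisors.2
        ⟨Nat.dvd_of_mul_dvd_mul_left (by norm_num) hLSd, by norm_num⟩
      clear * - hc hd24 hcount
      revert hcount
      revert c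
      revert d
      decide +kernel
    obtain ⟨rfl | rfl, rfl⟩ := key
    · exact ⟨by rw [hL]; norm_num, hN, hd⟩
    · exfalso
      obtain ⟨h, hh, hn⟩ := hne fun h => by
        rw [inf_eq_right.2 h, hN] at hd
        norm_num at hd
      have h1 := card_mul_card_le (le_top : 𝐍(R) ≤ ⊤) (le_top : 𝐍(MulAut.conj h • R) ≤ ⊤)
      have h2 : 𝐍(R) ⊓ 𝐍(MulAut.conj h • R) ≤ 𝐍(R) ⊓ 𝐍(S) := fun x hx =>
        ⟨hx.1, hsup hh hn ▸ le_normalizer_sup hx.1 hx.2⟩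
      have h3 := Nat.le_of_dvd Nat.card_pos (card_dvd_of_le h2)
      rw [normalizer_conj_smul, card_conj_smul, hL, hG.card_top', ← normalizer_conj_smul] at h1
      omega
  · exfalso
    obtain ⟨Q, hQ⟩ := exists_isSylowIn (p := 61) (by norm_num) 𝐍(S)
    have hQc : Nat.card Q = 61 ^ 2 := hQ.card_eq (by norm_num) (by rw [hN, mul_comm]) (by norm_num)
    have hQS := le_centralizer_comm.1 (le_centralizer_of_dvd_normalizer_31 hS hQ.isPGroup hQ.1)
    have hQL : Q ≤ 𝐍(R) ⊓ 𝐍(S) := le_inf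
      ((hQS.trans (centralizer_le hRS)).trans (centralizer_le_normalizer _)) hQ.1
    have hQd := card_dvd_of_le hQL
    rw [hQc] at hQd
    have hQd' := hQd.trans hLSd'
    have key : c = 3 ∧ d = 8 * 61 ^ 2 := by
      rw [hN, hd] at hLSd
      rw [hL, hd, Nat.mul_div_cancel_left _ (by norm_num)] at hcount
      rw [hd] at hQd
      rw [hL] at hQd'
      have hQd2 : 61 ^ 2 ∣ d := Nat.Coprime.dvd_of_dvd_mul_left (by norm_num) hQd
      obtain ⟨d, rfl⟩ := hQd2
      have hd24 : d ∈ Nat.divisors 24 := Nat.mem_divisors.2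
        ⟨Nat.dvd_of_mul_dvd_mul_left (k := 961 * 61 ^ 2) (by norm_num)
          (by convert hLSd using 1 <;> ring), by norm_num⟩
      clear * - hc hd24 hcount hQd'
      revert hcount hQd'
      revert c
      revert d
      decide +kernel
    obtain ⟨rfl, rfl⟩ := key
    have hall := hG.conj_le_centralizer_of_card hS hR hRS (by rw [hL]) (by rw [hd]; norm_num) hN
    have hSC' : ∀ g : G, MulAut.conj g • R ≤ S := by
      intro g
      obtain ⟨h, hh, hn⟩ := hne fun h => by
        rw [inf_eq_right.2 h, hN] at hd
        norm_num at hd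
      refine ((hG.isSylowIn_31 hS le_normalizer).le_of_normal p31 le_rfl ?_ ?_)
      · exact IsPGroup.of_card (n := 1) (by rw [card_conj_smul, hR, pow_one])
      · refine le_trans ?_ (centralizer_le_normalizer _)
        rw [le_centralizer_comm, ← hsup hh hn, sup_le_iff, le_centralizer_comm]
        refine ⟨hall g, ?_⟩
        rw [le_centralizer_comm]
        have := conj_smul_mono (g := h) (hall (h⁻¹ * g))
        rwa [← conj_smul_mul, mul_inv_cancel_left, ← centralizer_conj_smul] at this
    have htop : 𝐍(S) = ⊤ := by
      rw [eq_top_iff]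
      intro g _
      obtain ⟨h, hh, hn⟩ := hne fun h => by
        rw [inf_eq_right.2 h, hN] at hd
        norm_num at hd
      rw [← conj_smul_eq_iff]
      refine eq_of_le_of_card_eq ?_ card_conj_smul
      conv_lhs => rw [← hsup hh hn, smul_sup, ← conj_smul_mul]
      exact sup_le (hSC' _) (hSC' _)
    rw [htop, hG.card_top'] at hN
    norm_num at hN

/-- If `S` is a Sylow subgroup of `𝐂(R)`, the Frattini argument shows that the index of `𝐂(R)` in
`𝐍(R)` divides the order of `𝐍(R) ⊓ 𝐍(S)`. -/
lemma card_normalizer_dvd {p : ℕ} (hp : p.Prime) (hS : IsSylowIn p S 𝐂(R)) :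
    Nat.card 𝐍(R) ∣ Nat.card 𝐂(R) * Nat.card (𝐍(R) ⊓ 𝐍(S) : Subgroup G) := by
  have h1 := card_mul_index (R.normalizerMonoidHom).ker
  have hk : Nat.card (R.normalizerMonoidHom).ker = Nat.card 𝐂(R) := by
    rw [normalizerMonoidHom_ker, card_subgroupOf_of_le (centralizer_le_normalizer _)]
  rw [← h1, hk, index_ker]
  refine mul_dvd_mul_left _ ?_
  rw [← card_subgroupOf_of_le (inf_le_left : 𝐍(R) ⊓ 𝐍(S) ≤ 𝐍(R))]
  have h2 : (R.normalizerMonoidHom).range =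
      ((𝐍(R) ⊓ 𝐍(S)).subgroupOf 𝐍(R)).map R.normalizerMonoidHom := by
    apply le_antisymm
    · rintro _ ⟨g, rfl⟩
      obtain ⟨a, ha, hag⟩ := hS.frattini hp (g := (g : G)) (by
        rw [← conj_smul_eq_iff, ← centralizer_conj_smul, conj_smul_eq_iff.2 g.2])
      have haN := centralizer_le_normalizer _ ha
      refine ⟨⟨a, haN⟩ * g, mem_subgroupOf.2 ⟨𝐍(R).mul_mem haN g.2, hag⟩, ?_⟩
      have : (⟨a, haN⟩ : 𝐍(R)) ∈ (R.normalizerMonoidHom).ker := by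
        rw [normalizerMonoidHom_ker]
        exact mem_subgroupOf.2 ha
      rw [map_mul, MonoidHom.mem_ker.1 this, one_mul]
    · exact map_le_range _ _
  rw [h2]
  exact card_map_dvd _ _

lemma exists_R (hG : U361Data G) : ∃ R : Subgroup G, Nat.card R = 31 ∧
    Nat.card 𝐍(R) = 961 * 240 * 61 ∧ 15 ∣ Nat.card 𝐂(R) ∧ (∃ g : G, MulAut.conj g • R ≠ R ∧ MulAut.conj g • R ≤ 𝐂(R)) ∧
    ∀ S : Subgroup G, Nat.card S = 31 ^ 2 → Nat.card 𝐍(S) = 961 * 24 := by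
  have p31 : Nat.Prime 31 := by norm_num
  obtain ⟨R, hR, h240⟩ := exists_card_31 hG
  obtain ⟨S, hS, hRS⟩ := exists_isSylowIn_ge p31 (le_top : R ≤ ⊤)
    (IsPGroup.of_card (n := 1) (by rw [hR, pow_one]))
  have hSc : Nat.card S = 31 ^ 2 := hS.card_eq (r := 2^4 * 3 * 5 * 7 * 61^3 * 523) p31
    (by rw [hG.card_top']; norm_num) (by norm_num)
  obtain ⟨hL, hN, hLS⟩ := hG.card_normalizer_of_240_dvd hR h240 hSc hRS
  refine ⟨R, hR, hL, ?_, ?_, fun S' hS' => ?_⟩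
  · have h := card_normalizer_dvd p31 (hG.isSylowIn_31 hSc
      ((le_centralizer_of_card_sq p31 hSc).trans (centralizer_le hRS)))
    rw [hL, hLS] at h
    have h15 : 15 ∣ Nat.card 𝐂(R) * (961 * 8) := dvd_trans (by norm_num) h
    exact (show Nat.Coprime 15 (961 * 8) by norm_num).dvd_of_dvd_mul_right h15
  · have : ¬ 𝐍(S) ≤ 𝐍(R) := fun h => by
      rw [inf_eq_right.2 h, hN] at hLS
      norm_num at hLS
    obtain ⟨x, hx, hx'⟩ := SetLike.not_le_iff_exists.1 this
    exact ⟨x, fun h => hx' (conj_smul_eq_iff.1 h), (conj_smul_mono hRS).trans <|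
      (conj_smul_eq_iff.2 hx).le.trans <|
        (le_centralizer_of_card_sq p31 hSc).trans (centralizer_le hRS)⟩
  · obtain ⟨g, -, rfl⟩ := hS.exists_conj p31 (hG.isSylowIn_31 hS' le_top)
    rw [normalizer_conj_smul, card_conj_smul, hN]

end U361Data

namespace U361Data
variable {G : Type*} [Group G] [Finite G] {S H A R U P : Subgroup G}

/-- A subgroup of order `31` with the centralizer structure found in `exists_R`. -/
structure Base (R : Subgroup G) : Prop where
  card_R : Nat.card R = 31
  card_L : Nat.card 𝐍(R) = 961 * 240 * 61
  exists_conj : ∃ g : G, MulAut.conj g • R ≠ R ∧ MulAut.conj g • R ≤ 𝐂(R)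
  card_normalizer : ∀ S : Subgroup G, Nat.card S = 31 ^ 2 → Nat.card 𝐍(S) = 961 * 24

lemma Base.not_le_normalizer (hB : Base R) (hS : Nat.card S = 31 ^ 2) (h : 61 ∣ Nat.card H) :
    ¬ H ≤ 𝐍(S) := fun hH => by
  have := h.trans (card_dvd_of_le hH)
  rw [hB.card_normalizer S hS] at this
  norm_num at this

lemma centralizer_61_of_le (hR : Nat.card R = 31) (hU : Nat.card U = 61) (hUL : U ≤ 𝐍(R)) :
    U ≤ 𝐂(R) :=
  le_centralizer_of_coprime (by rw [hR]; norm_num) hUL (by rw [hU, hR]; norm_num)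

lemma Base.card_inf_normalizer_U (hB : Base R) (hG : U361Data G) (hU : Nat.card U = 61)
    (hUL : U ≤ 𝐍(R)) : Nat.card (𝐍(R) ⊓ 𝐍(U) : Subgroup G) = 61 * 3720 := by
  have hUR := centralizer_61_of_le hB.card_R hU hUL
  have hUS : IsSylowIn 61 U 𝐍(R) := isSylowIn_of_card (k := 1) (r := 961 * 240) (by norm_num) hUL
    hU (by rw [hB.card_L]; norm_num) (by norm_num)
  obtain ⟨e, he, b, hb, c, hc, h⟩ := hG.exists_form_of_le_normalizer (q := 31) (k := 1)
    (by simp) (by rw [hB.card_R, pow_one]) (inf_le_left : 𝐍(R) ⊓ 𝐍(U) ≤ 𝐍(R))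
  have hRle : R ≤ 𝐍(R) ⊓ 𝐍(U) := le_inf le_normalizer
    ((le_centralizer_comm.1 hUR).trans (centralizer_le_normalizer _))
  have h31 := card_dvd_of_le hRle
  have hUd := card_dvd_of_le hUS.le_inf_normalizer
  have hd := card_dvd_of_le (inf_le_left : 𝐍(R) ⊓ 𝐍(U) ≤ 𝐍(R))
  have hcount := hUS.count_mod (by norm_num)
  rw [hU] at hUd hcount
  rw [hB.card_R] at h31
  rw [hB.card_L] at hd hcount
  have key : Nat.card (𝐍(R) ⊓ 𝐍(U) : Subgroup G) = 61 * 3720 ∨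
      Nat.card (𝐍(R) ⊓ 𝐍(U) : Subgroup G) = 961 * 240 * 61 := by
    rw [h] at h31 hUd hd hcount ⊢
    clear * - h31 hUd hd hcount he hb hc
    revert h31 hUd hd hcount
    revert c
    revert b
    revert e
    decide +kernel
  rcases key with h' | h'
  · exact h'
  · obtain ⟨S', hS'⟩ := exists_isSylowIn (p := 31) (by norm_num) (𝐍(R) ⊓ 𝐍(U))
    have hc' : Nat.card S' = 31 ^ 2 := hS'.card_eq (r := 240 * 61) (by norm_num)
      (by rw [h']; norm_num) (by norm_num)
    have := le_centralizer_of_coprime (by rw [hU]; norm_num) (hS'.1.trans inf_le_right)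
      (by rw [hU, hc']; norm_num)
    exact (hB.not_le_normalizer hc' (by rw [hU])
      ((le_centralizer_comm.1 this).trans (centralizer_le_normalizer _))).elim

lemma Base.card_centralizer_U (hB : Base R) (hG : U361Data G) (hU : Nat.card U = 61)
    (hUL : U ≤ 𝐍(R)) : ∃ z ∈ Finset.range 4, Nat.card 𝐂(U) = 2 ^ z * 31 * 61 ^ 3 := by
  have hUR := centralizer_61_of_le hB.card_R hU hUL
  have hRU := le_centralizer_comm.1 hUR
  have hUU : U ≤ 𝐂(U) := by
    have := Fact.mk (show Nat.Prime 61 by norm_num)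
    have := isCyclic_of_prime_card hU
    exact le_centralizer_iff_isMulCommutative.2 inferInstance
  have hne : ∀ q : ℕ, q.Prime → q ≠ 61 → (∀ g : G, orderOf g ≠ 61 * q) → ¬ q ∣ Nat.card 𝐂(U) :=
    fun q hq hq' h => not_dvd_card_centralizer (by norm_num) hq hq'.symm h (by rw [hU])
  have h3 := hne 3 (by norm_num) (by norm_num) fun g => by
    rw [mul_comm]; exact hG.not_adj_61 3 (by simp) g
  have h5 := hne 5 (by norm_num) (by norm_num) fun g => by
    rw [mul_comm]; exact hG.not_adj_61 5 (by simp) g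
  obtain ⟨e, he, b, hb, c, hc, h⟩ := exists_form_of_dvd (hG.card_dvd 𝐂(U))
    (hne 7 (by norm_num) (by norm_num) fun g => by
      rw [mul_comm]; exact hG.not_adj_seven 61 (by simp) g)
    (hne 523 (by norm_num) (by norm_num) fun g => by
      rw [mul_comm]; exact hG.not_adj_523 61 (by simp) g)
  have hb2 : b ≠ 2 := by
    rintro rfl
    obtain ⟨S', hS'⟩ := exists_isSylowIn (p := 31) (by norm_num) 𝐂(U)
    have hc' : Nat.card S' = 31 ^ 2 := hS'.card_eq (r := e * 61 ^ c) (by norm_num)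
      (by rw [h]; ring) fun hd => by
        rcases (show Nat.Prime 31 by norm_num).dvd_mul.1 hd with hd | hd
        · exact absurd (hd.trans (Nat.dvd_of_mem_divisors he)) (by norm_num)
        · exact absurd ((show Nat.Prime 31 by norm_num).dvd_of_dvd_pow hd) (by norm_num)
    exact hB.not_le_normalizer hc' (by rw [hU])
      ((le_centralizer_comm.1 hS'.1).trans (centralizer_le_normalizer _))
  have h31 := card_dvd_of_le hRU
  have hRS : IsSylowIn 31 R 𝐂(U) := by
    rw [hB.card_R, h] at h31
    refine isSylowIn_of_card (k := 1) (r := e * 61 ^ c) (by norm_num) hRU hB.card_R ?_ ?_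
    · rw [h]
      have : b = 1 := by
        clear * - h31 hb2 he hb hc
        revert h31 hb2
        revert c
        revert b
        revert e
        decide +kernel
      rw [this]
      ring
    · intro hd
      rcases (show Nat.Prime 31 by norm_num).dvd_mul.1 hd with hd | hd
      · exact absurd (hd.trans (Nat.dvd_of_mem_divisors he)) (by norm_num)
      · exact absurd ((show Nat.Prime 31 by norm_num).dvd_of_dvd_pow hd) (by norm_num)
  have hcount := hRS.count_mod (by norm_num)
  have hd1 : Nat.card (𝐂(U) ⊓ 𝐍(R) : Subgroup G) ∣ 61 * 3720 := by
    rw [← hB.card_inf_normalizer_U hG hU hUL]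
    refine card_dvd_of_le ?_
    rw [inf_comm]
    exact inf_le_inf_left _ (centralizer_le_normalizer _)
  have hd2 := card_dvd_of_le (inf_le_left : 𝐂(U) ⊓ 𝐍(R) ≤ 𝐂(U))
  have hd3 := card_dvd_of_le (le_inf hUU hUL)
  have hd4 := card_dvd_of_le (le_inf hRU (le_normalizer (H := R)))
  have h61 : 61 ^ 2 ∣ Nat.card 𝐂(U) := by
    have := Fact.mk (show Nat.Prime 61 by norm_num)
    have h1 := Sylow.prime_pow_dvd_card_normalizer (p := 61) (n := 1) (H := U)
      (by rw [hG.card]; norm_num) (by rw [hU, pow_one])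
    obtain ⟨e', he', h2⟩ := card_eq_card_inf_centralizer_mul (A := U) (by rw [hU]; norm_num) le_rfl
    rw [inf_eq_right.2 (centralizer_le_normalizer _)] at h2
    rw [h2] at h1
    rw [hU] at he'
    exact Nat.Coprime.dvd_of_dvd_mul_right
      (Nat.Coprime.coprime_dvd_right he' (by norm_num)) h1
  rw [hB.card_R] at h31 hcount hd4
  rw [hU] at hd3
  obtain ⟨y, hy⟩ := Nat.Coprime.mul_dvd_of_dvd_of_dvd (by norm_num) hd3 hd4
  have hy2 : y ∈ Nat.divisors 120 := by
    refine Nat.mem_divisors.2 ⟨?_, by norm_num⟩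
    rw [hy] at hd1
    exact Nat.dvd_of_mul_dvd_mul_left (k := 61 * 31) (by norm_num) (hd1.trans (by norm_num))
  rw [h] at h31 h61 hcount hd2 h3 h5 ⊢
  rw [hy] at hcount hd2
  clear * - h31 h61 hcount hd2 h3 h5 hb2 hy2 he hb hc
  revert h31 h61 hcount hd2 h3 h5 hb2
  revert c
  revert b
  revert e
  revert y
  decide +kernel

lemma le_normalizer_of_card_sq {P₀ : Subgroup G} (h : P₀ ≤ P) (h0 : Nat.card P₀ = 61 ^ 2)
    (hP : Nat.card P = 61 ^ 3) : P ≤ 𝐍(P₀) := by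
  rw [← normal_subgroupOf_iff_le_normalizer h]
  refine normal_of_index_eq_minFac_card ?_
  have h1 := card_mul_index (P₀.subgroupOf P)
  rw [card_subgroupOf_of_le h, h0, hP] at h1
  rw [hP, Nat.Prime.pow_minFac (by norm_num) (by norm_num)]
  omega

lemma card_modEq_of_le_normalizer (hR : Nat.card R = 31) (hA : R ≤ 𝐍(A)) :
    Nat.card A ≡ Nat.card (A ⊓ 𝐂(R) : Subgroup G) [MOD 31] :=
  card_inf_centralizer_modEq (by norm_num) (IsPGroup.of_card (n := 1) (by rw [hR, pow_one])) hA

lemma Base.card_inf_centralizer (hB : Base R) (hA : ∃ k, Nat.card A = 61 ^ k) :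
    Nat.card (A ⊓ 𝐂(R) : Subgroup G) = 1 ∨ Nat.card (A ⊓ 𝐂(R) : Subgroup G) = 61 := by
  obtain ⟨k, hk⟩ := hA
  have h1 := card_dvd_of_le (inf_le_left : A ⊓ 𝐂(R) ≤ A)
  have h2 := card_dvd_of_le (inf_le_right.trans (centralizer_le_normalizer _) : A ⊓ 𝐂(R) ≤ 𝐍(R))
  rw [hk] at h1
  rw [hB.card_L] at h2
  obtain ⟨j, -, hj⟩ := (Nat.dvd_prime_pow (by norm_num)).1 h1
  rw [hj] at h2 ⊢
  rcases lt_or_ge j 2 with h | h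
  · interval_cases j <;> simp
  · exact absurd ((pow_dvd_pow 61 h).trans h2) (by norm_num)

lemma Base.inf_centralizer_eq (hB : Base R) (hU : Nat.card U = 61) (hUR : U ≤ 𝐂(R))
    (hUA : U ≤ A) (hA : ∃ k, Nat.card A = 61 ^ k) : A ⊓ 𝐂(R) = U := by
  symm
  refine eq_of_le_of_card_eq (le_inf hUA hUR) ?_
  rcases hB.card_inf_centralizer hA with h | h
  · have := card_dvd_of_le (le_inf hUA hUR)
    rw [h, hU] at this
    norm_num at this
  · rw [h, hU]

lemma Base.exists_sylow_centralizer (hB : Base R) (hG : U361Data G) (hU : Nat.card U = 61)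
    (hUL : U ≤ 𝐍(R)) :
    ∃ P : Subgroup G, Nat.card P = 61 ^ 3 ∧ U ≤ P ∧ P ≤ 𝐂(U) ∧ 𝐂(U) ≤ 𝐍(P) := by
  have p61 : Nat.Prime 61 := by norm_num
  have hUR := centralizer_61_of_le hB.card_R hU hUL
  have hRU := le_centralizer_comm.1 hUR
  have hUU : U ≤ 𝐂(U) := by
    have := Fact.mk p61
    have := isCyclic_of_prime_card hU
    exact le_centralizer_iff_isMulCommutative.2 inferInstance
  obtain ⟨z, hz, hC⟩ := hB.card_centralizer_U hG hU hUL
  have hz31 : ¬ 61 ∣ 2 ^ z * 31 := by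
    clear * - hz
    revert z
    decide
  have hR31 : IsSylowIn 31 R 𝐂(U) := by
    refine isSylowIn_of_card (k := 1) (r := 2 ^ z * 61 ^ 3) (by norm_num) hRU hB.card_R
      (by rw [hC]; ring) ?_
    clear * - hz
    revert z
    decide
  obtain ⟨P, hP, hUP⟩ := exists_isSylowIn_ge p61 hUU
    (IsPGroup.of_card (n := 1) (by rw [hU, pow_one]))
  have hPc : Nat.card P = 61 ^ 3 := hP.card_eq p61 (by rw [hC, mul_comm]) hz31
  refine ⟨P, hPc, hUP, hP.1, ?_⟩
  by_contra hn
  obtain ⟨c, hc, hc'⟩ := SetLike.not_le_iff_exists.1 hn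
  rw [← conj_smul_eq_iff] at hc'
  set P' := MulAut.conj c • P with hP'
  have hP'c : Nat.card P' = 61 ^ 3 := by rw [hP', card_conj_smul, hPc]
  have hP'C : P' ≤ 𝐂(U) := (hP.conj_mem hc).1
  have hUP' : U ≤ P' := by
    have := conj_smul_mono (g := c) hUP
    rwa [conj_smul_of_centralizer hc] at this
  have h0 : Nat.card (P ⊓ P' : Subgroup G) = 61 ^ 2 := by
    have h1 := card_mul_card_le hP.1 hP'C
    have h2 := card_dvd_of_le (inf_le_left : P ⊓ P' ≤ P)
    rw [hPc, hP'c, hC] at h1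
    rw [hPc] at h2
    have h4 : Nat.card (P ⊓ P' : Subgroup G) ≠ 61 ^ 3 := fun h => by
      have h5 := eq_of_le_of_card_eq (inf_le_left : P ⊓ P' ≤ P) (by rw [h, hPc])
      have h6 := eq_of_le_of_card_eq (inf_le_right : P ⊓ P' ≤ P') (by rw [h, hP'c])
      exact hc' (h6.symm.trans h5)
    have hz8 : 2 ^ z ≤ 8 := by
      clear * - hz
      revert z
      decide
    obtain ⟨j, hj, hj'⟩ := (Nat.dvd_prime_pow p61).1 h2
    rw [hj'] at h1 h4 ⊢
    have h3 : 2 ^ z * 31 * 61 ^ 3 * 61 ^ j ≤ 8 * 31 * 61 ^ 3 * 61 ^ j := by gcongr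
    clear * - h1 h3 h4 hj
    interval_cases j <;> omega
  have hPN := le_normalizer_of_card_sq inf_le_left h0 hPc
  have hP'N := le_normalizer_of_card_sq inf_le_right h0 hP'c
  have hPD : IsSylowIn 61 P (𝐂(U) ⊓ 𝐍(P ⊓ P')) :=
    hP.of_le p61 (le_inf hP.1 hPN) inf_le_left
  have h31 : 31 ∣ Nat.card (𝐂(U) ⊓ 𝐍(P ⊓ P') : Subgroup G) := by
    obtain ⟨m, hm, hD⟩ := hPD.count p61
    have hdC := card_dvd_of_le (inf_le_left : 𝐂(U) ⊓ 𝐍(P ⊓ P') ≤ 𝐂(U))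
    obtain ⟨j, hj⟩ := card_dvd_of_le hPD.le_inf_normalizer
    rw [hD, hC, hj, hPc, mul_comm (2 ^ z * 31), mul_left_comm] at hdC
    have hmd := (Dvd.intro _ rfl : m ∣ m * j).trans (Nat.dvd_of_mul_dvd_mul_left (by norm_num) hdC)
    have hm1 : m ≠ 1 := by
      rintro rfl
      rw [one_mul] at hD
      have h7 : 𝐂(U) ⊓ 𝐍(P ⊓ P') ≤ 𝐍(P) :=
        inf_eq_left.1 (eq_of_le_of_card_eq inf_le_left hD.symm)
      refine hc' (hPD.eq_of_normal p61 h7 ?_)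
      exact (hP.conj_mem hc).of_le p61 (le_inf hP'C hP'N) inf_le_left
    have hm62 : 31 ∣ m := by
      have hm' : m ∈ Nat.divisors 248 := Nat.mem_divisors.2 ⟨hmd.trans ?_, by norm_num⟩
      · clear * - hm hm' hm1
        revert hm hm1
        revert m
        decide
      · clear * - hz
        revert z
        decide
    rw [hD]
    exact hm62.mul_right _
  obtain ⟨R₁, hR₁⟩ := exists_isSylowIn (p := 31) (by norm_num) (𝐂(U) ⊓ 𝐍(P ⊓ P'))
  have hR₁0 : Nat.card R₁ = 31 := by
    obtain ⟨k, hk⟩ : ∃ k, Nat.card R₁ = 31 ^ k := ⟨_, hR₁.2⟩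
    have h1 := card_dvd_of_le (hR₁.1.trans inf_le_left)
    have h2 : k ≠ 0 := fun h => by
      have h3 := Nat.factorization_eq_zero_iff (Nat.card (𝐂(U) ⊓ 𝐍(P ⊓ P') : Subgroup G)) 31
      rw [hR₁.2, h] at hk
      have h4 := Nat.pow_right_injective (le_refl 2 |>.trans (by norm_num : 2 ≤ 31)) hk
      rcases h3.1 h4 with h5 | h5 | h5
      · exact h5 (by norm_num)
      · exact h5 h31
      · exact Nat.card_pos.ne' h5
    have h3 : k < 2 := by
      by_contra hk2
      rw [hk, hC] at h1
      have := (pow_dvd_pow 31 (not_lt.1 hk2)).trans h1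
      clear * - this hz
      revert z
      decide +kernel
    rw [hk, show k = 1 by omega, pow_one]
  have hR₁S : IsSylowIn 31 R₁ 𝐂(U) := ⟨hR₁.1.trans inf_le_left, by
    rw [hR₁0, ← hR31.2, hB.card_R]⟩
  obtain ⟨d, hd, hdR⟩ := hR₁S.exists_conj (by norm_num) hR31
  have hRN : R ≤ 𝐍(MulAut.conj d • (P ⊓ P')) := by
    rw [normalizer_conj_smul, ← hdR]
    exact conj_smul_mono (hR₁.1.trans inf_le_right)
  have h62 := card_modEq_of_le_normalizer hB.card_R hRN
  have hUd : U ≤ MulAut.conj d • (P ⊓ P') := by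
    have := conj_smul_mono (g := d) (le_inf hUP hUP')
    rwa [conj_smul_of_centralizer hd] at this
  rw [hB.inf_centralizer_eq hU hUR hUd ⟨2, by rw [card_conj_smul, h0]⟩, card_conj_smul, h0, hU]
    at h62
  exact absurd h62 (by decide)

lemma Base.card_normalizer_P (hB : Base R) (hG : U361Data G) (hU : Nat.card U = 61)
    (hUL : U ≤ 𝐍(R)) (hP : Nat.card P = 61 ^ 3) (hUP : U ≤ P) (hCP : 𝐂(U) ≤ 𝐍(P)) :
    Nat.card 𝐍(P) = 61 ^ 3 * 3720 := by
  have hUR := centralizer_61_of_le hB.card_R hU hUL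
  have hRU := le_centralizer_comm.1 hUR
  obtain ⟨e, he, b, hb, c, hc, h⟩ := hG.exists_form_of_le_normalizer (q := 61) (k := 3)
    (by simp) hP (le_refl 𝐍(P))
  have hRP := hRU.trans hCP
  have h31 := card_dvd_of_le hRP
  have h61 := card_dvd_of_le (le_normalizer (H := P))
  have hcount := (hG.isSylowIn_61 hP le_top).count_mod (by norm_num)
  rw [top_inf_eq, hP, hG.card_top'] at hcount
  rw [hB.card_R] at h31
  rw [hP] at h61
  have key : Nat.card 𝐍(P) = 61 ^ 3 * 3720 ∨ Nat.card 𝐍(P) = 31 ^ 2 * (240 * 61 ^ 3) := by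
    rw [h] at h31 h61 hcount ⊢
    clear * - h31 h61 hcount he hb hc
    revert h31 h61 hcount
    revert c
    revert b
    revert e
    decide +kernel
  rcases key with h | h
  · exact h
  · obtain ⟨S', hS', hRS'⟩ := exists_isSylowIn_ge (p := 31) (by norm_num) hRP
      (IsPGroup.of_card (n := 1) (by rw [hB.card_R, pow_one]))
    have hc' : Nat.card S' = 31 ^ 2 := hS'.card_eq (by norm_num) h (by norm_num)
    have hS'R : S' ≤ 𝐂(R) :=
      (le_centralizer_of_card_sq (by norm_num) hc').trans (centralizer_le hRS')
    have hle : S' ≤ 𝐍(R) ⊓ 𝐍(U) := by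
      refine le_inf (hS'R.trans (centralizer_le_normalizer _)) ?_
      rw [← hB.inf_centralizer_eq hU hUR hUP ⟨3, hP⟩]
      intro x hx
      have h1 := conj_smul_eq_iff.2 (hS'.1 hx)
      have h2 := conj_smul_eq_iff.2 (centralizer_le_normalizer _ (hS'R hx))
      rw [← conj_smul_eq_iff, smul_inf, h1, ← centralizer_conj_smul, h2]
    have := card_dvd_of_le hle
    rw [hc', hB.card_inf_normalizer_U hG hU hUL] at this
    norm_num at this

end U361Data

/-- The permutation group data extracted from the local analysis: `G` acts on `Ω` like `U₃(61)` on
the isotropic points, `P` being a Sylow `61`-subgroup fixing `o`, `U` its center, and `R` a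
subgroup of order `31` fixing `o` and `z`. -/
structure Config {G Ω : Type*} [Group G] [MulAction G Ω] (o z : Ω) (P U R : Subgroup G) :
    Prop where
  card_G : Nat.card G = 2^4 * 3 * 5 * 7 * 31^2 * 61^3 * 523
  card_P : Nat.card P = 61 ^ 3
  card_U : Nat.card U = 61
  card_R : Nat.card R = 31
  U_le : U ≤ P
  P_le : P ≤ 𝐂(U)
  smul_o : ∀ g : G, g • o = o ↔ g ∈ 𝐍(P)
  z_ne : z ≠ o
  regular : ∀ ω : Ω, ω ≠ o → ∃! p : P, (p : G) • z = ω
  faithful : ∀ g : G, (∀ ω : Ω, g • ω = ω) → g = 1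
  P_inf : P ⊓ 𝐂(R) = U
  R_o : ∀ r ∈ R, r • o = o
  R_z : ∀ r ∈ R, r • z = z
  K_le : ∀ k : G, k • o = o → k • z = z → k ∈ 𝐍(R)
  card_K : Nat.card (MulAction.stabilizer G o ⊓ MulAction.stabilizer G z : Subgroup G) = 3720
  fix_R : ∀ ω : Ω, (∀ r ∈ R, r • ω = ω) → ∃ l ∈ 𝐍(R), l • o = ω
  card_L : Nat.card 𝐍(R) = 961 * 240 * 61
  dvd_card_C : 15 ∣ Nat.card 𝐂(R)
  orderOf_ne : ∀ q ∈ [3, 5], ∀ g : G, orderOf g ≠ 61 * q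
  exists_conj : ∃ g : G, MulAut.conj g • R ≠ R ∧ MulAut.conj g • R ≤ 𝐂(R)

namespace U361Data
variable {G : Type*} [Group G] [Finite G] {S H A R U P : Subgroup G}

lemma inf_eq_bot_of_prime {A B : Subgroup G} {p : ℕ} (hp : p.Prime) (hA : Nat.card A = p)
    (hB : Nat.card B = p) (h : A ≠ B) : A ⊓ B = ⊥ := by
  rcases (Nat.dvd_prime hp).1 (hA ▸ card_dvd_of_le (inf_le_left : A ⊓ B ≤ A)) with h1 | h1
  · exact card_eq_one.1 h1
  · exact (h ((eq_of_le_of_card_eq (inf_le_left : A ⊓ B ≤ A) (by rw [h1, hA])).symm.trans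
      (eq_of_le_of_card_eq inf_le_right (by rw [h1, hB])))).elim

lemma Base.card_sup (hB : Base R) (hG : U361Data G) (hS : Nat.card S = 31) (hSL : S ≤ 𝐍(R))
    (hne : S ≠ R) : Nat.card (R ⊔ S : Subgroup G) = 31 ^ 2 := by
  have := Fact.mk (show Nat.Prime 31 by norm_num)
  have h1 : IsPGroup 31 (R ⊔ S : Subgroup G) := by
    rw [sup_comm]
    exact IsPGroup.to_sup_of_normal_right' (IsPGroup.of_card (n := 1) (by rw [hS, pow_one]))
      (IsPGroup.of_card (n := 1) (by rw [hB.card_R, pow_one])) hSL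
  obtain ⟨k, hk⟩ := IsPGroup.iff_card.1 h1
  have h2 := hG.card_dvd (R ⊔ S)
  have h3 := card_dvd_of_le (le_sup_left : R ≤ R ⊔ S)
  rw [hk] at h2 h3 ⊢
  have h4 : k < 3 := by
    by_contra h
    exact absurd ((pow_dvd_pow 31 (not_lt.1 h)).trans h2) (by norm_num)
  interval_cases k
  · rw [hB.card_R] at h3
    norm_num at h3
  · exact (hne ((eq_of_le_of_card_eq (le_sup_right : S ≤ R ⊔ S) (by rw [hk, hS, pow_one])).trans
      (eq_of_le_of_card_eq le_sup_left (by rw [hk, hB.card_R, pow_one])).symm)).elim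
  · rfl

lemma Base.inf_normalizer_eq (hB : Base R) (hU : Nat.card U = 61)
    (hUL : U ≤ 𝐍(R)) (hP : Nat.card P = 61 ^ 3) (hUP : U ≤ P) (hPC : P ≤ 𝐂(U))
    (hPS : IsSylowIn 61 P 𝐂(U)) (hCP : 𝐂(U) ≤ 𝐍(P)) : 𝐍(R) ⊓ 𝐍(P) = 𝐍(R) ⊓ 𝐍(U) := by
  have hUR := centralizer_61_of_le hB.card_R hU hUL
  apply le_antisymm
  · refine le_inf inf_le_left fun x hx => ?_
    have h1 := conj_smul_eq_iff.2 hx.1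
    have h2 := conj_smul_eq_iff.2 hx.2
    rw [← hB.inf_centralizer_eq hU hUR hUP ⟨3, hP⟩, ← conj_smul_eq_iff, smul_inf, h2,
      ← centralizer_conj_smul, h1]
  · refine le_inf inf_le_left (inf_le_right.trans ?_)
    refine le_trans (fun x hx => ?_) (hPS.normalizer_le_of_normal (by norm_num) hCP)
    rw [← conj_smul_eq_iff] at hx ⊢
    rw [← centralizer_conj_smul, hx]

lemma Base.inf_conj_eq_bot (hB : Base R) (hG : U361Data G) (hU : Nat.card U = 61)
    (hUL : U ≤ 𝐍(R)) (hP : Nat.card P = 61 ^ 3) (hUP : U ≤ P) (hPC : P ≤ 𝐂(U))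
    (hRP : R ≤ 𝐍(P)) {l : G} (hl : l ∈ 𝐍(R)) (hlU : l ∉ 𝐍(U)) :
    P ⊓ MulAut.conj l • P = ⊥ := by
  have p31 : Nat.Prime 31 := by norm_num
  have p61 : Nat.Prime 61 := by norm_num
  have hUR := centralizer_61_of_le hB.card_R hU hUL
  have hlR := conj_smul_eq_iff.2 hl
  have hlU' := fun h => hlU (conj_smul_eq_iff.1 h)
  have hPR := hB.inf_centralizer_eq hU hUR hUP ⟨3, hP⟩
  have hRP' : R ≤ 𝐍(MulAut.conj l • P) := by
    rw [normalizer_conj_smul, ← hlR]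
    exact conj_smul_mono hRP
  set D := P ⊓ MulAut.conj l • P with hD
  have hRD : R ≤ 𝐍(D) := fun x hx => by
    rw [← conj_smul_eq_iff, hD, smul_inf, conj_smul_eq_iff.2 (hRP hx),
      conj_smul_eq_iff.2 (hRP' hx)]
  have hDR : D ⊓ 𝐂(R) = ⊥ := by
    rw [eq_bot_iff, ← inf_eq_bot_of_prime p61 hU (by rw [card_conj_smul, hU])
      (fun h => hlU' h.symm)]
    refine le_inf ?_ ?_
    · rw [← hPR]
      exact inf_le_inf_right _ inf_le_left
    · rw [← hPR, smul_inf, ← centralizer_conj_smul, hlR]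
      exact inf_le_inf_right _ inf_le_right
  have hc := card_modEq_of_le_normalizer hB.card_R hRD
  rw [hDR, card_bot] at hc
  have hDd := card_dvd_of_le (inf_le_left : D ≤ P)
  rw [hP] at hDd
  have hD2 : Nat.card D = 1 ∨ Nat.card D = 61 ^ 2 := by
    obtain ⟨j, hj, hj'⟩ := (Nat.dvd_prime_pow p61).1 hDd
    rw [hj'] at hc ⊢
    clear * - hj hc
    revert hc
    revert j
    decide
  rcases hD2 with hD1 | hD2
  · exact card_eq_one.1 hD1
  exfalso
  have hlUL : MulAut.conj l • U ≤ 𝐍(R) := by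
    have h : 𝐍(R) = MulAut.conj l • 𝐍(R) := by rw [← normalizer_conj_smul, hlR]
    rw [h]
    exact conj_smul_mono hUL
  have hDU : D ≤ 𝐂(U) := inf_le_left.trans hPC
  have hDU' : D ≤ 𝐂(MulAut.conj l • U) := by
    rw [centralizer_conj_smul]
    exact inf_le_right.trans (conj_smul_mono hPC)
  set E := 𝐍(R) ⊓ 𝐂(D) with hE
  have hUE : U ≤ E := le_inf hUL (le_centralizer_comm.1 hDU)
  have hUE' : MulAut.conj l • U ≤ E := le_inf hlUL (le_centralizer_comm.1 hDU')
  have hs : ∀ {V : Subgroup G}, Nat.card V = 61 → V ≤ E → IsSylowIn 61 V E := fun hV h =>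
    (isSylowIn_of_card (k := 1) (r := 961 * 240) p61 (h.trans inf_le_left) hV
      (by rw [hB.card_L]; norm_num) (by norm_num)).of_le p61 h inf_le_left
  have hUS := hs hU hUE
  have hUS' := hs (by rw [card_conj_smul, hU]) hUE'
  have hEN : ¬ E ≤ 𝐍(U) := fun h => hlU' (hUS.eq_of_normal p61 h hUS')
  have hEd := card_dvd_of_le (inf_le_left : E ≤ 𝐍(R))
  rw [hB.card_L] at hEd
  have h61D : 61 ∣ Nat.card D := by rw [hD2]; norm_num
  have h35 : ∀ q ∈ [3, 5], ¬ q ∣ Nat.card E := fun q hq hd => by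
    have hq' : q.Prime ∧ 61 ≠ q := by
      revert q
      norm_num
    refine not_dvd_card_centralizer p61 hq'.1 hq'.2 (fun g => ?_) h61D
      (hd.trans (card_dvd_of_le inf_le_right))
    rw [mul_comm]
    simp only [List.mem_cons, List.not_mem_nil, or_false] at hq
    obtain rfl | rfl := hq
    · exact hG.not_adj_61 3 (by simp) g
    · exact hG.not_adj_61 5 (by simp) g
  have h61E := card_dvd_of_le hUE
  rw [hU] at h61E
  obtain ⟨f, hf⟩ := h61E
  have hf' : f ∣ 961 * 16 := by
    have h3 := h35 3 (by simp)
    have h5 := h35 5 (by simp)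
    have hf2 : f ∣ 961 * 16 * 3 * 5 := by
      rw [hf, mul_comm 61] at hEd
      exact Nat.dvd_of_mul_dvd_mul_right (by norm_num) hEd
    rw [hf] at h3 h5
    have h5' := ((Nat.Prime.coprime_iff_not_dvd (by norm_num)).2
      (fun h => h5 (h.mul_left _))).symm.dvd_of_dvd_mul_right hf2
    exact ((Nat.Prime.coprime_iff_not_dvd (by norm_num)).2
      (fun h => h3 (h.mul_left _))).symm.dvd_of_dvd_mul_right h5'
  have hdiv : ∀ {m : ℕ}, m ∣ 961 * 16 → ∃ w ∈ Finset.range 5,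
      m = 2 ^ w ∨ m = 31 * 2 ^ w ∨ m = 961 * 2 ^ w := by
    rintro m hm
    obtain ⟨y, x, hy, hx, rfl⟩ := Nat.dvd_mul.1 hm
    obtain ⟨b, hb, rfl⟩ := (Nat.dvd_prime_pow p31 (m := 2)).1 hy
    obtain ⟨w, hw, rfl⟩ := (Nat.dvd_prime_pow Nat.prime_two (m := 4)).1 hx
    refine ⟨w, Finset.mem_range.2 (by omega), ?_⟩
    interval_cases b <;> simp
  obtain ⟨S₁, hS₁⟩ := exists_isSylowIn p31 E
  have hf31 : 31 ∣ f := by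
    obtain ⟨m, hm, hmE⟩ := hUS.count p61
    obtain ⟨j, hj⟩ := card_dvd_of_le hUS.le_inf_normalizer
    rw [hU] at hj
    have hm1 : m ≠ 1 := by
      rintro rfl
      rw [one_mul] at hmE
      exact hEN (inf_eq_left.1 (eq_of_le_of_card_eq inf_le_left hmE.symm))
    have hmf : m ∣ f := by
      rw [hj, hf, mul_left_comm] at hmE
      exact Dvd.intro _ (Nat.eq_of_mul_eq_mul_left (by norm_num) hmE).symm
    refine dvd_trans ?_ hmf
    obtain ⟨w, hw, rfl | rfl | rfl⟩ := hdiv (hmf.trans hf')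
    · exfalso
      clear * - hm hm1 hw
      revert hm hm1
      revert w
      decide
    · exact Dvd.intro _ rfl
    · exact ⟨31 * 2 ^ w, by ring⟩
  have hfx : (∃ w ∈ Finset.range 5, f = 31 * 2 ^ w) ∨ (∃ w ∈ Finset.range 5, f = 961 * 2 ^ w) := by
    obtain ⟨w, hw, h | h | h⟩ := hdiv hf'
    · rw [h] at hf31
      exact absurd (p31.dvd_of_dvd_pow hf31) (by norm_num)
    · exact Or.inl ⟨w, hw, h⟩
    · exact Or.inr ⟨w, hw, h⟩
  rcases hfx with ⟨w, hw, rfl⟩ | ⟨w, hw, rfl⟩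
  · have hS₁c : Nat.card S₁ = 31 := by
      rw [hS₁.card_eq (k := 1) (r := 2 ^ w * 61) p31 (by rw [hf]; ring) (by
        clear * - hw
        revert w
        decide), pow_one]
    have hEN1 : E ≤ 𝐍(S₁) := hS₁.normal_of_card p31 fun m j hm hj => by
      rw [hf, hS₁c, mul_left_comm, mul_left_comm m] at hj
      have hj := Nat.eq_of_mul_eq_mul_left (by norm_num) hj
      have hm' : m ∈ Nat.divisors (61 * 16) := by
        refine Nat.mem_divisors.2 ⟨(Dvd.intro _ hj.symm).trans (mul_dvd_mul_left _ ?_),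
          by norm_num⟩
        clear * - hw
        revert w
        decide
      clear * - hm hm'
      revert hm
      revert m
      decide +kernel
    have hRE : R ≤ 𝐍(E) := fun x hx => by
      have h1 := conj_smul_eq_iff.2 (hRD hx)
      rw [← conj_smul_eq_iff, hE, smul_inf, ← centralizer_conj_smul, h1, ← normalizer_conj_smul,
        conj_smul_eq_iff.2 (le_normalizer hx)]
    have hne : S₁ ≠ R := by
      rintro rfl
      have := hS₁.1.trans inf_le_right
      have := inf_eq_left.2 (le_centralizer_comm.1 this)
      rw [hDR] at this
      rw [← this, card_bot] at hD2
      norm_num at hD2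
    have h961 := hB.card_sup hG hS₁c (hS₁.1.trans inf_le_left) hne
    refine hB.not_le_normalizer h961 (H := U) (by rw [hU]) fun x hx => ?_
    exact le_normalizer_sup (hUL hx) (hEN1 (hUE hx))
  · have hS₁c : Nat.card S₁ = 31 ^ 2 := by
      rw [hS₁.card_eq (k := 2) (r := 2 ^ w * 61) p31 (by rw [hf]; ring) (by
        clear * - hw
        revert w
        decide)]
    exact hB.not_le_normalizer hS₁c h61D <|
      (le_centralizer_comm.1 (hS₁.1.trans inf_le_right)).trans (centralizer_le_normalizer _)

end U361Data

namespace U361Data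
variable {G : Type*} [Group G] [Finite G] {S H A R U P : Subgroup G}

lemma smul_mk_eq_iff (g a b : G) :
    g • (a : G ⧸ 𝐍(P)) = (b : G ⧸ 𝐍(P)) ↔ MulAut.conj g • MulAut.conj a • P = MulAut.conj b • P := by
  change ((g * a : G) : G ⧸ 𝐍(P)) = _ ↔ _
  rw [eq_comm, QuotientGroup.eq, ← conj_smul_eq_iff, ← conj_smul_mul, conj_smul_mul, map_inv,
    inv_smul_eq_iff]

/-- A normal subgroup whose order has no prime divisor other than `2, 3, 5, 31` is trivial once
its order is a divisor of `3720`. -/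
lemma eq_bot_of_normal (hG : U361Data G) {N : Subgroup G} (hN : N.Normal)
    (h : Nat.card N ∣ 3720) : N = ⊥ := by
  have htop : 𝐍(N) = ⊤ := normalizer_eq_top_iff.2 hN
  have hq : ∀ q : ℕ, q.Prime → q ∣ Nat.card N → q ∈ [2, 3, 5, 31] := fun q hq hd => by
    have : q ∈ Nat.primeFactors 3720 := Nat.mem_primeFactors.2 ⟨hq, hd.trans h, by norm_num⟩
    rw [show Nat.primeFactors 3720 = {2, 3, 5, 31} from by simp [Nat.primeFactors]] at this
    simpa using this
  have h7 := modEq_one_of_dvd_normalizer (S := N) (r := 7) (by norm_num)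
    (by rw [htop, hG.card_top']; norm_num) fun q hq' hd => by
      have := hq q hq' hd
      simp only [List.mem_cons, List.not_mem_nil, or_false] at this
      exact ⟨by omega, hG.not_adj_seven q (by simp; omega)⟩
  have h523 := modEq_one_of_dvd_normalizer (S := N) (r := 523) (by norm_num)
    (by rw [htop, hG.card_top']; norm_num) fun q hq' hd => by
      have := hq q hq' hd
      simp only [List.mem_cons, List.not_mem_nil, or_false] at this
      exact ⟨by omega, hG.not_adj_523 q (by simp; omega)⟩
  have h' : Nat.card N ∈ Nat.divisors 3720 := Nat.mem_divisors.2 ⟨h, by norm_num⟩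
  refine card_eq_one.1 ?_
  generalize Nat.card N = c at *
  clear * - h7 h523 h'
  revert h7 h523
  revert c
  decide +kernel

lemma exists_config (hG : U361Data G) : ∃ (P U R : Subgroup G) (l : G),
    Config (Ω := G ⧸ 𝐍(P)) ((1 : G) : G ⧸ 𝐍(P)) (l : G ⧸ 𝐍(P)) P U R := by
  have p31 : Nat.Prime 31 := by norm_num
  have p61 : Nat.Prime 61 := by norm_num
  obtain ⟨R, hR, hL, h15, hconj, hN⟩ := hG.exists_R
  have hB : Base R := ⟨hR, hL, hconj, hN⟩
  obtain ⟨U, hUS⟩ := exists_isSylowIn p61 𝐍(R)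
  have hUL := hUS.1
  have hU : Nat.card U = 61 := by
    rw [hUS.card_eq (k := 1) p61 (by rw [hL, mul_comm, pow_one]) (by norm_num), pow_one]
  have hUR := centralizer_61_of_le hR hU hUL
  obtain ⟨P, hP, hUP, hPC, hCP⟩ := hB.exists_sylow_centralizer hG hU hUL
  have hNP := hB.card_normalizer_P hG hU hUL hP hUP hCP
  have hRP := (le_centralizer_comm.1 hUR).trans hCP
  have hLP := hB.inf_normalizer_eq hU hUL hP hUP hPC (hG.isSylowIn_61 hP hPC) hCP
  have hLU := hB.card_inf_normalizer_U hG hU hUL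
  obtain ⟨l, hl, hlP⟩ : ∃ l ∈ 𝐍(R), l ∉ 𝐍(P) := by
    by_contra! h
    rw [← hLP, inf_eq_left.2 h, hL] at hLU
    norm_num at hLU
  have hlU : l ∉ 𝐍(U) := fun h => hlP (hLP.ge ⟨hl, h⟩).2
  have hlR := conj_smul_eq_iff.2 hl
  have hbot := hB.inf_conj_eq_bot hG hU hUL hP hUP hPC hRP hl hlU
  have hso : ∀ g : G, g • ((1 : G) : G ⧸ 𝐍(P)) = ((1 : G) : G ⧸ 𝐍(P)) ↔ g ∈ 𝐍(P) := fun g => by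
    rw [smul_mk_eq_iff, map_one, one_smul, conj_smul_eq_iff]
  have hsz : ∀ g : G, g • (l : G ⧸ 𝐍(P)) = (l : G ⧸ 𝐍(P)) ↔ g ∈ 𝐍(MulAut.conj l • P) :=
    fun g => by rw [smul_mk_eq_iff, conj_smul_eq_iff]
  have hzo : (l : G ⧸ 𝐍(P)) ≠ ((1 : G) : G ⧸ 𝐍(P)) := fun h => hlP <| by
    refine (hso l).1 ?_
    change ((l * 1 : G) : G ⧸ 𝐍(P)) = _
    rw [mul_one, h]
  have hPz : P ⊓ 𝐍(MulAut.conj l • P) = ⊥ := by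
    rw [eq_bot_iff, ← hbot]
    refine le_inf inf_le_left ((hG.isSylowIn_61 (by rw [card_conj_smul, hP])
      le_normalizer).le_of_normal p61 le_rfl ?_ inf_le_right)
    exact (IsPGroup.of_card hP).to_le inf_le_left
  have hinj : ∀ p ∈ P, ∀ p' ∈ P, p • (l : G ⧸ 𝐍(P)) = p' • (l : G ⧸ 𝐍(P)) → p = p' := by
    intro p hp p' hp' h
    have h1 : p⁻¹ * p' ∈ P ⊓ 𝐍(MulAut.conj l • P) :=
      ⟨P.mul_mem (P.inv_mem hp) hp', (hsz _).1 (by rw [mul_smul, ← h, inv_smul_smul])⟩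
    rw [hPz, mem_bot, inv_mul_eq_one] at h1
    exact h1
  have hPo : ∀ p ∈ P, ∀ ω : G ⧸ 𝐍(P), ω ≠ ((1 : G) : G ⧸ 𝐍(P)) →
      p • ω ≠ ((1 : G) : G ⧸ 𝐍(P)) := fun p hp ω hω h => hω <| by
    rw [← inv_smul_smul p ω, h, hso]
    exact 𝐍(P).inv_mem (le_normalizer hp)
  have hbij : Function.Bijective (fun p : P => (⟨(p : G) • (l : G ⧸ 𝐍(P)), hPo p p.2 _ hzo⟩ :
      {ω : G ⧸ 𝐍(P) // ω ≠ ((1 : G) : G ⧸ 𝐍(P))})) := by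
    rw [Nat.bijective_iff_injective_and_card]
    refine ⟨fun p p' h => Subtype.ext (hinj p p.2 p' p'.2 (Subtype.ext_iff.1 h)), ?_⟩
    have h1 : Nat.card (G ⧸ 𝐍(P)) = 61 ^ 3 + 1 := by
      have h := card_mul_index 𝐍(P)
      rw [hNP, hG.card] at h
      change (𝐍(P)).index = _
      omega
    have := Fintype.ofFinite (G ⧸ 𝐍(P))
    classical
    rw [Nat.card_eq_fintype_card] at h1
    rw [hP, Nat.card_eq_fintype_card, Fintype.card_subtype_compl, h1]
    simp
  have hreg : ∀ ω : G ⧸ 𝐍(P), ω ≠ ((1 : G) : G ⧸ 𝐍(P)) →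
      ∃! p : P, (p : G) • (l : G ⧸ 𝐍(P)) = ω := fun ω hω => by
    obtain ⟨p, hp, hu⟩ := hbij.existsUnique ⟨ω, hω⟩
    exact ⟨p, Subtype.ext_iff.1 hp, fun y hy => hu y (Subtype.ext hy)⟩
  have hK : MulAction.stabilizer G ((1 : G) : G ⧸ 𝐍(P)) ⊓ MulAction.stabilizer G (l : G ⧸ 𝐍(P)) =
      𝐍(P) ⊓ 𝐍(MulAut.conj l • P) := by
    ext g
    simp only [mem_inf, MulAction.mem_stabilizer_iff]
    rw [hso, hsz]
  have hKc : Nat.card (𝐍(P) ⊓ 𝐍(MulAut.conj l • P) : Subgroup G) = 3720 := by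
    let f : P × (𝐍(P) ⊓ 𝐍(MulAut.conj l • P) : Subgroup G) → 𝐍(P) :=
      fun x => ⟨x.1 * x.2, 𝐍(P).mul_mem (le_normalizer x.1.2) x.2.2.1⟩
    have hf : Function.Bijective f := by
      constructor
      · rintro ⟨p, k⟩ ⟨p', k'⟩ h
        have h : (p : G) * k = p' * k' := Subtype.ext_iff.1 h
        have h1 : p = p' := Subtype.ext <| hinj p p.2 p' p'.2 <| by
          have := congrArg (fun x : G => x • (l : G ⧸ 𝐍(P))) h
          simpa only [mul_smul, (hsz k).2 k.2.2, (hsz k').2 k'.2.2] using this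
        subst h1
        rw [Subtype.ext (mul_left_cancel h)]
      · rintro ⟨g, hg⟩
        obtain ⟨p, hp, -⟩ := hreg (g • (l : G ⧸ 𝐍(P))) fun h => hzo <| by
          rw [← inv_smul_smul g (l : G ⧸ 𝐍(P)), h, hso]
          exact 𝐍(P).inv_mem hg
        refine ⟨⟨p, ⟨(p : G)⁻¹ * g, 𝐍(P).mul_mem (𝐍(P).inv_mem (le_normalizer p.2)) hg, (hsz _).1 ?_⟩⟩,
          Subtype.ext (mul_inv_cancel_left _ _)⟩
        rw [mul_smul, ← hp, inv_smul_smul]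
    have := Nat.card_eq_of_bijective f hf
    rw [Nat.card_prod, hP, hNP] at this
    exact Nat.eq_of_mul_eq_mul_left (by norm_num) this
  have hRz : R ≤ 𝐍(MulAut.conj l • P) := by
    rw [normalizer_conj_smul, ← hlR]
    exact conj_smul_mono hRP
  have hKL : 𝐍(P) ⊓ 𝐍(MulAut.conj l • P) ≤ 𝐍(R) := by
    have hS : IsSylowIn 31 R (𝐍(P) ⊓ 𝐍(MulAut.conj l • P)) :=
      isSylowIn_of_card (k := 1) (r := 120) p31 (le_inf hRP hRz) hR (by rw [hKc]; norm_num)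
        (by norm_num)
    refine hS.normal_of_card p31 fun m j hm hj => ?_
    rw [hKc, hR, mul_left_comm] at hj
    have hm' : m ∈ Nat.divisors 120 := Nat.mem_divisors.2 ⟨⟨j, by omega⟩, by norm_num⟩
    clear * - hm hm'
    revert hm
    revert m
    decide +kernel
  refine ⟨P, U, R, l, hG.card, hP, hU, hR, hUP, hPC, hso, hzo, hreg, ?_,
    hB.inf_centralizer_eq hU hUR hUP ⟨3, hP⟩, fun r hr => (hso r).2 (hRP hr),
    fun r hr => (hsz r).2 (hRz hr), fun k h1 h2 => hKL ⟨(hso k).1 h1, (hsz k).1 h2⟩,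
    by rw [hK, hKc], ?_, hL, h15, ?_, hconj⟩
  · intro g hg
    have hker : (MulAction.toPermHom G (G ⧸ 𝐍(P))).ker = ⊥ := by
      refine hG.eq_bot_of_normal inferInstance ?_
      rw [← hKc]
      refine card_dvd_of_le fun x hx => ?_
      have hx : ∀ ω : G ⧸ 𝐍(P), x • ω = ω := fun ω => DFunLike.congr_fun hx ω
      exact ⟨(hso x).1 (hx _), (hsz x).1 (hx _)⟩
    have : g ∈ (MulAction.toPermHom G (G ⧸ 𝐍(P))).ker := Equiv.ext hg
    rwa [hker, mem_bot] at this
  · intro ω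
    obtain ⟨a, rfl⟩ := QuotientGroup.mk_surjective ω
    intro ha
    have hRa : R ≤ 𝐍(MulAut.conj a • P) := fun r hr => by
      rw [← conj_smul_eq_iff, ← smul_mk_eq_iff]
      exact ha r hr
    have hs : ∀ {T : Subgroup G}, Nat.card T = 31 → T ≤ 𝐍(P) → IsSylowIn 31 T 𝐍(P) :=
      fun hT hTP => isSylowIn_of_card (k := 1) (r := 61 ^ 3 * 120) p31 hTP hT
        (by rw [hNP]; norm_num) (by norm_num)
    have hRa' : MulAut.conj a⁻¹ • R ≤ 𝐍(P) := by
      have := conj_smul_mono (g := a⁻¹) hRa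
      rwa [← normalizer_conj_smul, ← conj_smul_mul, inv_mul_cancel, map_one, one_smul] at this
    obtain ⟨h, hh, hc⟩ := (hs (by rw [card_conj_smul, hR]) hRa').exists_conj p31 (hs hR hRP)
    refine ⟨(h * a⁻¹)⁻¹, ?_, ?_⟩
    · rw [← conj_smul_mul, conj_smul_eq_iff] at hc
      exact 𝐍(R).inv_mem hc
    · rw [mul_inv_rev, inv_inv, mul_smul, (hso _).2 (𝐍(P).inv_mem hh)]
      change ((a * 1 : G) : G ⧸ 𝐍(P)) = _
      rw [mul_one]
  · intro q hq g
    exact hG.not_adj_61 q hq g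

end U361Data

/-- The pointwise stabilizer of two points. -/
abbrev stab₂ (G : Type*) {Ω : Type*} [Group G] [MulAction G Ω] (o z : Ω) : Subgroup G :=
  MulAction.stabilizer G o ⊓ MulAction.stabilizer G z

namespace Config
variable {G Ω : Type*} [Group G] [MulAction G Ω] {o z : Ω} {P U R : Subgroup G}
  {k p q u x g : G}

lemma P_o (hC : Config o z P U R) (hp : p ∈ P) : p • o = o := (hC.smul_o p).2 (le_normalizer hp)

lemma smul_z_ne (hC : Config o z P U R) (hp : p ∈ P) : p • z ≠ o := fun h => hC.z_ne <| by
  rw [← inv_smul_smul p z, h, hC.P_o (P.inv_mem hp)]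

lemma smul_z_inj (hC : Config o z P U R) (hp : p ∈ P) (hq : q ∈ P) (h : p • z = q • z) :
    p = q :=
  Subtype.ext_iff.1 ((hC.regular _ (hC.smul_z_ne hq)).unique (y₁ := ⟨p, hp⟩) (y₂ := ⟨q, hq⟩) h rfl)

lemma exists_smul_z (hC : Config o z P U R) {ω : Ω} (hω : ω ≠ o) : ∃ p ∈ P, p • z = ω := by
  obtain ⟨p, hp, -⟩ := hC.regular ω hω
  exact ⟨p, p.2, hp⟩

lemma conj_P (hC : Config o z P U R) (hk : k • o = o) (hp : p ∈ P) : k * p * k⁻¹ ∈ P :=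
  (mem_normalizer_iff.1 ((hC.smul_o k).1 hk) p).1 hp

lemma smul_smul_z (hk : k • z = z) (p : G) :
    k • p • z = (k * p * k⁻¹) • z := by
  rw [mul_smul, mul_smul, inv_smul_eq_iff.2 hk.symm]

lemma conj_U (hC : Config o z P U R) (hk : k ∈ stab₂ G o z) (hu : u ∈ U) : k * u * k⁻¹ ∈ U := by
  rw [← hC.P_inf] at hu ⊢
  refine ⟨hC.conj_P hk.1 hu.1, ?_⟩
  have h1 := conj_smul_eq_iff.2 (hC.K_le k hk.1 hk.2)
  have h2 : k * u * k⁻¹ ∈ 𝐂(MulAut.conj k • R) := by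
    rw [mem_centralizer_conj_smul]
    simpa [mul_assoc] using hu.2
  rwa [h1] at h2

lemma eq_one_of_commute (hC : Config o z P U R) (hk : k ∈ stab₂ G o z)
    (h : ∀ p ∈ P, Commute k p) : k = 1 := by
  refine hC.faithful k fun ω => ?_
  rcases eq_or_ne ω o with rfl | hω
  · exact hk.1
  · obtain ⟨p, hp, rfl⟩ := hC.exists_smul_z hω
    rw [smul_smul_z hk.2, (h p hp).eq, mul_inv_cancel_right]

lemma commute_U (hC : Config o z P U R) (hp : p ∈ P) (hu : u ∈ U) : Commute p u :=
  commute_of_mem_centralizer (hC.P_le hp) hu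

variable [Finite G]

/-- `P / U` is abelian. -/
lemma commutator_mem (hC : Config o z P U R) (hp : p ∈ P) (hq : q ∈ P) :
    p * q * p⁻¹ * q⁻¹ ∈ U := by
  have := Fact.mk (show Nat.Prime 61 by norm_num)
  have hn : (U.subgroupOf P).Normal := ⟨fun n hn g => by
    rw [mem_subgroupOf] at *
    rw [coe_mul, coe_mul, coe_inv, (hC.commute_U g.2 hn).eq, mul_inv_cancel_right]
    exact hn⟩
  have hc : Nat.card (P ⧸ U.subgroupOf P) = 61 ^ 2 := by
    have h := card_mul_index (U.subgroupOf P)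
    rw [card_subgroupOf_of_le hC.U_le, hC.card_U, hC.card_P] at h
    change (U.subgroupOf P).index = _
    omega
  have h := (IsPGroup.isMulCommutative_of_card_eq_prime_sq hc).is_comm.comm
    (QuotientGroup.mk ⟨q, hq⟩⁻¹) (QuotientGroup.mk ⟨p, hp⟩⁻¹)
  rw [← QuotientGroup.mk_mul, ← QuotientGroup.mk_mul, QuotientGroup.eq, mem_subgroupOf] at h
  simpa [mul_assoc] using h

lemma U_commute (hC : Config o z P U R) {v : G} (hu : u ∈ U) (hv : v ∈ U) : Commute u v :=
  hC.commute_U (hC.U_le hu) hv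

lemma card_ne_of_commute (hC : Config o z P U R) (hx : x ∈ stab₂ G o z) (hg : Commute g x)
    (hgo : g • o = z) : Nat.card (P ⊓ centralizer {x} : Subgroup G) ≠ 61 ^ 2 := by
  intro h
  let f : Option (P ⊓ centralizer {x} : Subgroup G) → MulAction.orbit (centralizer {x}) o :=
    fun p => p.elim ⟨o, MulAction.mem_orbit_self _⟩ fun p =>
      ⟨(p : G) • z, ⟨p * g, (centralizer {x}).mul_mem p.2.2
        (mem_centralizer_singleton_iff.2 hg)⟩, by
          change ((p : G) * g) • o = _
          rw [mul_smul, hgo]⟩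
  have hf : Function.Bijective f := by
    constructor
    · rintro (_ | p) (_ | q) hpq
      · rfl
      · exact (hC.smul_z_ne q.2.1 (Subtype.ext_iff.1 hpq).symm).elim
      · exact (hC.smul_z_ne p.2.1 (Subtype.ext_iff.1 hpq)).elim
      · exact congrArg some (Subtype.ext (hC.smul_z_inj p.2.1 q.2.1 (Subtype.ext_iff.1 hpq)))
    · rintro ⟨ω, hω⟩
      have hxω : x • ω = ω := by
        obtain ⟨⟨c, hc⟩, rfl⟩ := hω
        change x • c • o = c • o
        rw [smul_smul, ← mem_centralizer_singleton_iff.1 hc, mul_smul, hx.1]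
      by_cases ho : ω = o
      · exact ⟨none, Subtype.ext ho.symm⟩
      · obtain ⟨p, hp, rfl⟩ := hC.exists_smul_z ho
        rw [smul_smul_z hx.2] at hxω
        have := hC.smul_z_inj (hC.conj_P hx.1 hp) hp hxω
        exact ⟨some ⟨p, hp, mem_centralizer_singleton_iff.2 (mul_inv_eq_iff_eq_mul.1 this).symm⟩, rfl⟩
  have h1 := Nat.card_eq_of_bijective f hf
  rw [Finite.card_option, h] at h1
  have h2 : Nat.card (MulAction.orbit (centralizer {x}) o) ∣ Nat.card G := by
    rw [← Nat.card_congr (MulAction.orbitEquivQuotientStabilizer (centralizer {x}) o).symm]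
    exact (card_quotient_dvd_card _).trans (card_subgroup_dvd_card _)
  rw [← h1, hC.card_G] at h2
  norm_num at h2

end Config

lemma le_normalizer_of_conj_mem {G : Type*} [Group G] {A S : Subgroup G}
    (h : ∀ a ∈ A, ∀ s ∈ S, a * s * a⁻¹ ∈ S) : A ≤ 𝐍(S) := fun a ha =>
  mem_normalizer_iff.2 fun s => ⟨h a ha s, fun hs => by
    simpa [mul_assoc] using h a⁻¹ (A.inv_mem ha) _ hs⟩

namespace Config
variable {G Ω : Type*} [Group G] [MulAction G Ω] {o z : Ω} {P U R : Subgroup G}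
  {k p q u x y g : G}

lemma conj_eq_iff_commute : x * p * x⁻¹ = p ↔ Commute x p := mul_inv_eq_iff_eq_mul

/-- The elements of `P` whose image in `P / U` commutes with `x`. -/
def fixMod (hC : Config o z P U R) (x : G) : Subgroup G where
  carrier := {p | p ∈ P ∧ p⁻¹ * (x * p * x⁻¹) ∈ U}
  one_mem' := by simp [P.one_mem, U.one_mem]
  mul_mem' := by
    rintro p q ⟨hp, hp'⟩ ⟨hq, hq'⟩
    refine ⟨P.mul_mem hp hq, ?_⟩
    have h : (p * q)⁻¹ * (x * (p * q) * x⁻¹) =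
        q⁻¹ * ((p⁻¹ * (x * p * x⁻¹)) * q) * (q⁻¹ * (x * q * x⁻¹)) := by group
    rw [h, ← (hC.commute_U hq hp').eq, inv_mul_cancel_left]
    exact U.mul_mem hp' hq'
  inv_mem' := by
    rintro p ⟨hp, hp'⟩
    refine ⟨P.inv_mem hp, ?_⟩
    have h : p⁻¹⁻¹ * (x * p⁻¹ * x⁻¹) = p * ((p⁻¹ * (x * p * x⁻¹))⁻¹ * p⁻¹) := by group
    rw [h, ← (hC.commute_U (P.inv_mem hp) (U.inv_mem hp')).eq, mul_inv_cancel_left]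
    exact U.inv_mem hp'

lemma fixMod_le (hC : Config o z P U R) : hC.fixMod x ≤ P := fun _ h => h.1

lemma U_le_fixMod (hC : Config o z P U R) (hx : x ∈ stab₂ G o z) : U ≤ hC.fixMod x :=
  fun _ hu => ⟨hC.U_le hu, U.mul_mem (U.inv_mem hu) (hC.conj_U hx hu)⟩

lemma R_le (hC : Config o z P U R) : R ≤ stab₂ G o z := fun r hr => ⟨hC.R_o r hr, hC.R_z r hr⟩

variable [Finite G]

lemma fixMod_eq (hC : Config o z P U R) (hx : x ∈ stab₂ G o z) (hxR : x ∈ 𝐂(R)) :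
    hC.fixMod x = U ∨ hC.fixMod x = P := by
  have hR : R ≤ 𝐍(hC.fixMod x) := le_normalizer_of_conj_mem fun r hr p hp => by
    refine ⟨hC.conj_P (hC.R_o r hr) hp.1, ?_⟩
    have h := (commute_of_mem_centralizer hxR hr).eq
    have h' := (commute_of_mem_centralizer hxR (R.inv_mem hr)).eq
    have : (r * p * r⁻¹)⁻¹ * (x * (r * p * r⁻¹) * x⁻¹) = r * (p⁻¹ * (x * p * x⁻¹)) * r⁻¹ := by
      calc _ = r * p⁻¹ * r⁻¹ * (x * r) * p * (x * r⁻¹⁻¹)⁻¹ := by group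
        _ = _ := by rw [inv_inv, h]; group
    rw [this]
    exact hC.conj_U (hC.R_le hr) hp.2
  have h1 := U361Data.card_modEq_of_le_normalizer hC.card_R hR
  have h2 : hC.fixMod x ⊓ 𝐂(R) = U := by
    apply le_antisymm
    · exact (inf_le_inf_right _ hC.fixMod_le).trans hC.P_inf.le
    · refine le_inf (hC.U_le_fixMod hx) ?_
      rw [← hC.P_inf]
      exact inf_le_right
  rw [h2, hC.card_U] at h1
  have h3 := card_dvd_of_le (hC.fixMod_le (x := x))
  rw [hC.card_P] at h3
  obtain ⟨j, hj, hj'⟩ := (Nat.dvd_prime_pow (by norm_num)).1 h3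
  rw [hj'] at h1
  have h4 : j = 1 ∨ j = 3 := by
    clear * - h1 hj
    revert h1
    revert j
    decide
  rcases h4 with rfl | rfl
  · exact Or.inl (eq_of_le_of_card_eq (hC.U_le_fixMod hx) (by rw [hj', hC.card_U, pow_one])).symm
  · exact Or.inr (eq_of_le_of_card_eq hC.fixMod_le (by rw [hj', hC.card_P]))

/-- An involution acting without fixed points on `P / U` inverts it. -/
lemma inverts_of_fixMod_le (hC : Config o z P U R) (hx : x ∈ stab₂ G o z) (hx2 : x * x = 1)
    (h : hC.fixMod x ≤ U) (hp : p ∈ P) : p * (x * p * x⁻¹) ∈ U := by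
  have hxp := hC.conj_P hx.1 hp
  refine h ⟨P.mul_mem hp hxp, ?_⟩
  have h1 := hC.commutator_mem (P.inv_mem hxp) (P.inv_mem hp)
  have hx' : x⁻¹ = x := inv_eq_of_mul_eq_one_left hx2
  have : (p * (x * p * x⁻¹))⁻¹ * (x * (p * (x * p * x⁻¹)) * x⁻¹) =
      (x * p * x⁻¹)⁻¹ * p⁻¹ * (x * p * x⁻¹)⁻¹⁻¹ * p⁻¹⁻¹ := by
    calc _ = (x * p * x⁻¹)⁻¹ * p⁻¹ * (x * p) * (x * p) * x⁻¹ * x⁻¹ := by group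
      _ = (x * p * x⁻¹)⁻¹ * p⁻¹ * (x * p * x⁻¹) * (x * x) * p * (x * x)⁻¹ := by group
      _ = _ := by rw [hx2]; group
  rw [this]
  exact h1

lemma orderOf_dvd (hC : Config o z P U R) (hx : x ∈ stab₂ G o z) : orderOf x ∣ 3720 := by
  rw [← hC.card_K]
  exact Subgroup.orderOf_dvd_natCard _ hx

lemma pow_U (hC : Config o z P U R) (hu : u ∈ U) : u ^ 61 = 1 := by
  rw [← hC.card_U]
  exact pow_card_eq_one' (G := U) (x := ⟨u, hu⟩) |> congrArg Subtype.val

lemma eq_one_of_pow (hC : Config o z P U R) {n : ℕ} (hn : Nat.Coprime n 61) (hu : u ∈ U)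
    (h : u ^ n = 1) : u = 1 := by
  have h1 := orderOf_dvd_of_pow_eq_one h
  have h2 := orderOf_dvd_of_pow_eq_one (hC.pow_U hu)
  exact orderOf_eq_one_iff.1 (Nat.eq_one_of_dvd_coprimes hn h1 h2)

lemma commute_of_mem_fixMod (hC : Config o z P U R) (hy : y ∈ stab₂ G o z) (hyU : y ∈ 𝐂(U))
    (hp : p ∈ hC.fixMod y) : Commute y p := by
  set u := p⁻¹ * (y * p * y⁻¹) with hu
  have h1 : ∀ n : ℕ, y ^ n * p = p * u ^ n * y ^ n := fun n => by
    induction n with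
    | zero => simp
    | succ n ih =>
      have h2 : Commute y (u ^ n) := (commute_of_mem_centralizer hyU hp.2).pow_right n
      calc y ^ (n + 1) * p = y * (y ^ n * p) := by rw [pow_succ', mul_assoc]
        _ = y * p * u ^ n * y ^ n := by rw [ih]; group
        _ = p * u * (y * u ^ n) * y ^ n := by rw [hu]; group
        _ = _ := by rw [h2.eq, pow_succ' u, pow_succ' y]; group
  have h2 := h1 (orderOf y)
  rw [pow_orderOf_eq_one, one_mul, mul_one, left_eq_mul] at h2
  have h3 := hC.eq_one_of_pow
    (Nat.Coprime.coprime_dvd_left (hC.orderOf_dvd hy) (by norm_num)) hp.2 h2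
  exact conj_eq_iff_commute.1 (inv_mul_eq_one.1 h3).symm

lemma eq_one_of_fixMod (hC : Config o z P U R) (hy : y ∈ stab₂ G o z) (hyU : y ∈ 𝐂(U))
    (h : P ≤ hC.fixMod y) : y = 1 :=
  hC.eq_one_of_commute hy fun _ hp => hC.commute_of_mem_fixMod hy hyU (h hp)

lemma inf_centralizer_eq_bot (hC : Config o z P U R) (hx : x ∉ 𝐂(U)) :
    U ⊓ centralizer {x} = ⊥ := by
  have h := card_dvd_of_le (inf_le_left : U ⊓ centralizer {x} ≤ U)
  rw [hC.card_U] at h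
  rcases (Nat.dvd_prime (by norm_num)).1 h with h | h
  · exact card_eq_one.1 h
  · refine (hx (mem_centralizer_iff.2 fun u hu => ?_)).elim
    exact (mem_centralizer_singleton_iff.1 <|
      inf_eq_left.1 (eq_of_le_of_card_eq inf_le_left (by rw [h, hC.card_U])) hu)

lemma exists_commute (hC : Config o z P U R) (hx : x ∈ stab₂ G o z)
    (hp : p ∈ hC.fixMod x) : ∃ v ∈ U, Commute x (p * v) := by
  by_cases hxU : x ∈ 𝐂(U)
  · exact ⟨1, U.one_mem, by rw [mul_one]; exact hC.commute_of_mem_fixMod hx hxU hp⟩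
  let φ : U → U := fun v => ⟨v * (x * v * x⁻¹)⁻¹, U.mul_mem v.2 (U.inv_mem (hC.conj_U hx v.2))⟩
  have hφ : Function.Injective φ := by
    rintro ⟨v, hv⟩ ⟨w, hw⟩ h
    have h : v * (x * v * x⁻¹)⁻¹ = w * (x * w * x⁻¹)⁻¹ := Subtype.ext_iff.1 h
    have h1 : w⁻¹ * v ∈ U ⊓ centralizer {x} := by
      refine ⟨U.mul_mem (U.inv_mem hw) hv, ?_⟩
      have : x * (w⁻¹ * v) * x⁻¹ = w⁻¹ * v := by
        calc _ = (x * w * x⁻¹)⁻¹ * (x * v * x⁻¹) := by group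
          _ = w⁻¹ * (w * (x * w * x⁻¹)⁻¹) * (x * v * x⁻¹) := by group
          _ = _ := by rw [← h]; group
      exact mem_centralizer_singleton_iff.2 (conj_eq_iff_commute.1 this).symm
    rw [hC.inf_centralizer_eq_bot hxU, mem_bot, inv_mul_eq_one] at h1
    exact Subtype.ext h1.symm
  obtain ⟨v, hv⟩ := Finite.surjective_of_injective hφ ⟨_, hp.2⟩
  have hv : (v : G) * (x * v * x⁻¹)⁻¹ = p⁻¹ * (x * p * x⁻¹) := Subtype.ext_iff.1 hv
  refine ⟨v, v.2, conj_eq_iff_commute.1 ?_⟩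
  calc x * (p * v) * x⁻¹ = p * (p⁻¹ * (x * p * x⁻¹)) * (x * v * x⁻¹) := by group
    _ = _ := by rw [← hv]; group

lemma card_inf_centralizer (hC : Config o z P U R) (hx : x ∈ stab₂ G o z) (hx1 : x ≠ 1)
    (h : P ≤ hC.fixMod x) : Nat.card (P ⊓ centralizer {x} : Subgroup G) = 61 ^ 2 := by
  have h1 := card_dvd_of_le (inf_le_left : P ⊓ centralizer {x} ≤ P)
  rw [hC.card_P] at h1
  obtain ⟨j, hj, hj'⟩ := (Nat.dvd_prime_pow (by norm_num)).1 h1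
  have h3 : j ≠ 3 := by
    rintro rfl
    refine hx1 (hC.eq_one_of_commute hx fun p hp => ?_)
    exact (mem_centralizer_singleton_iff.1 <|
      inf_eq_left.1 (eq_of_le_of_card_eq inf_le_left (by rw [hj', hC.card_P])) hp).symm
  let f : (P ⊓ centralizer {x} : Subgroup G) × U → P :=
    fun a => ⟨a.1 * a.2, P.mul_mem a.1.2.1 (hC.U_le a.2.2)⟩
  have hf : Function.Surjective f := by
    rintro ⟨p, hp⟩
    obtain ⟨v, hv, hc⟩ := hC.exists_commute hx (h hp)
    exact ⟨⟨⟨p * v, P.mul_mem hp (hC.U_le hv), mem_centralizer_singleton_iff.2 hc.eq.symm⟩,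
      ⟨v⁻¹, U.inv_mem hv⟩⟩, Subtype.ext (mul_inv_cancel_right _ _)⟩
  have h4 := Nat.card_le_card_of_surjective f hf
  rw [Nat.card_prod, hC.card_P, hC.card_U, hj'] at h4
  rw [hj']
  interval_cases j <;> simp_all

end Config

namespace Config
variable {G Ω : Type*} [Group G] [MulAction G Ω] {o z : Ω} {P U R : Subgroup G}
  {k p q u x y g l : G} {ω : Ω}

lemma fixed_iff (hC : Config o z P U R) :
    (∀ r ∈ R, r • ω = ω) ↔ ω = o ∨ ∃ u ∈ U, u • z = ω := by
  constructor
  · intro h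
    refine or_iff_not_imp_left.2 fun hω => ?_
    obtain ⟨p, hp, rfl⟩ := hC.exists_smul_z hω
    refine ⟨p, ?_, rfl⟩
    rw [← hC.P_inf]
    refine ⟨hp, mem_centralizer_iff.2 fun r hr => ?_⟩
    have h1 := h r hr
    rw [smul_smul_z (hC.R_z r hr)] at h1
    exact conj_eq_iff_commute.1 (hC.smul_z_inj (hC.conj_P (hC.R_o r hr) hp) hp h1)
  · rintro (rfl | ⟨u, hu, rfl⟩) r hr
    · exact hC.R_o r hr
    · rw [smul_smul_z (hC.R_z r hr)]
      rw [← hC.P_inf] at hu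
      rw [(commute_of_mem_centralizer hu.2 hr).symm.eq, mul_inv_cancel_right]

lemma smul_fixed (hl : l ∈ 𝐍(R)) (hω : ∀ r ∈ R, r • ω = ω) : ∀ r ∈ R, r • l • ω = l • ω := by
  intro r hr
  have h := hω _ ((mem_normalizer_iff''.1 hl r).1 hr)
  rw [mul_smul, mul_smul, inv_smul_eq_iff] at h
  exact h

lemma U_le_centralizer (hC : Config o z P U R) : U ≤ 𝐂(R) := by
  rw [← hC.P_inf]
  exact inf_le_right

lemma exists_swap (hC : Config o z P U R) : ∃ t ∈ 𝐍(R), t • o = z ∧ t • z = o := by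
  obtain ⟨l, hl, hlo⟩ := hC.fix_R z hC.R_z
  rcases hC.fixed_iff.1 (smul_fixed (𝐍(R).inv_mem hl) hC.R_o) with h | ⟨u, hu, h⟩
  · rw [inv_smul_eq_iff, hlo] at h
    exact (hC.z_ne h.symm).elim
  · refine ⟨l * u, 𝐍(R).mul_mem hl (centralizer_le_normalizer _ (hC.U_le_centralizer hu)), ?_, ?_⟩
    · rw [mul_smul, hC.P_o (hC.U_le hu), hlo]
    · rw [mul_smul, h, smul_inv_smul]

lemma mem_stab_inf_iff (hC : Config o z P U R) :
    x ∈ stab₂ G o z ⊓ 𝐂(U) ↔ ∀ ω : Ω, (∀ r ∈ R, r • ω = ω) → x • ω = ω := by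
  constructor
  · rintro ⟨hx, hxU⟩ ω hω
    rcases hC.fixed_iff.1 hω with rfl | ⟨u, hu, rfl⟩
    · exact hx.1
    · rw [smul_smul_z hx.2, (commute_of_mem_centralizer hxU hu).eq, mul_inv_cancel_right]
  · intro h
    have hx : x ∈ stab₂ G o z := ⟨h _ hC.R_o, h _ hC.R_z⟩
    refine ⟨hx, mem_centralizer_iff.2 fun u hu => ?_⟩
    have h1 := h (u • z) (hC.fixed_iff.2 (Or.inr ⟨u, hu, rfl⟩))
    rw [smul_smul_z hx.2] at h1
    exact (conj_eq_iff_commute.1 (hC.smul_z_inj (hC.conj_P hx.1 (hC.U_le hu))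
      (hC.U_le hu) h1)).eq.symm

lemma conj_mem_stab_inf (hC : Config o z P U R) (hl : l ∈ 𝐍(R))
    (hx : x ∈ stab₂ G o z ⊓ 𝐂(U)) : l * x * l⁻¹ ∈ stab₂ G o z ⊓ 𝐂(U) := by
  rw [hC.mem_stab_inf_iff] at *
  intro ω hω
  rw [mul_smul, mul_smul, hx _ (smul_fixed (𝐍(R).inv_mem hl) hω), smul_inv_smul]

lemma le_fixMod_mul (hC : Config o z P U R) (hx : x ∈ stab₂ G o z)
    (hxi : ∀ p ∈ P, p * (x * p * x⁻¹) ∈ U) (hyi : ∀ p ∈ P, p * (y * p * y⁻¹) ∈ U) :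
    P ≤ hC.fixMod (x * y) := by
  refine fun p hp => ⟨hp, ?_⟩
  have h1 := hxi p hp
  have h2 := hC.conj_U hx (hyi p hp)
  have h3 : p⁻¹ * (x * y * p * (x * y)⁻¹) =
      p⁻¹ * ((p * (x * p * x⁻¹))⁻¹ * p) * (x * (p * (y * p * y⁻¹)) * x⁻¹) := by group
  rw [h3, ← (hC.commute_U hp (U.inv_mem h1)).eq, inv_mul_cancel_left]
  exact U.mul_mem (U.inv_mem h1) h2

variable [Finite G]

lemma R_le_stab_inf (hC : Config o z P U R) : R ≤ stab₂ G o z ⊓ 𝐂(U) :=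
  le_inf hC.R_le (le_centralizer_comm.1 hC.U_le_centralizer)

lemma not_commute (hC : Config o z P U R) (hq : orderOf x ∈ [3, 5]) (hy : orderOf y = 61) :
    ¬ Commute x y := fun h => by
  refine hC.orderOf_ne _ hq (y * x) ?_
  have : (orderOf x).Prime ∧ orderOf x ≠ 61 := by
    generalize orderOf x = q at hq
    revert q
    norm_num
  exact orderOf_mul_of_commute (by norm_num) this.1 this.2.symm hy rfl h.symm

lemma exists_orderOf_U (hC : Config o z P U R) : ∃ u ∈ U, orderOf u = 61 :=
  exists_mem_orderOf (by norm_num) (by rw [hC.card_U])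

lemma stab_le_normalizer (hC : Config o z P U R) : stab₂ G o z ≤ 𝐍(U) :=
  le_normalizer_of_conj_mem fun _ hk _ hu => hC.conj_U hk hu

lemma card_stab_inf (hC : Config o z P U R) : ∃ f ∈ [1, 2, 4],
    Nat.card (stab₂ G o z ⊓ 𝐂(U) : Subgroup G) = 62 * f := by
  obtain ⟨e, he, h⟩ := card_eq_card_inf_centralizer_mul (by rw [hC.card_U]; norm_num)
    hC.stab_le_normalizer
  rw [hC.card_K] at h
  rw [hC.card_U] at he
  obtain ⟨f, hf⟩ := he
  have he0 : 0 < e := by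
    rw [pos_iff_ne_zero]
    rintro rfl
    omega
  have h1 : Nat.card (stab₂ G o z ⊓ 𝐂(U) : Subgroup G) = 62 * f := by
    refine Nat.eq_of_mul_eq_mul_right he0 ?_
    rw [← h, mul_assoc, mul_comm f, ← hf]
    rfl
  refine ⟨f, ?_, h1⟩
  obtain ⟨u, hu, hu'⟩ := hC.exists_orderOf_U
  have h2 : ∀ q ∈ [3, 5], ¬ q ∣ f := fun q hq hd => by
    have hqp : q.Prime := by
      clear hd
      revert q
      norm_num
    obtain ⟨x, hx, hxq⟩ := exists_mem_orderOf hqp (h1 ▸ hd.mul_left 62)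
    exact hC.not_commute (hxq ▸ hq) hu' (commute_of_mem_centralizer hx.2 hu)
  have h3 : f ∈ Nat.divisors 60 := Nat.mem_divisors.2 ⟨Dvd.intro_left _ hf.symm, by norm_num⟩
  have h3' := h2 3 (by simp)
  have h5' := h2 5 (by simp)
  clear * - h3 h3' h5'
  revert h3' h5'
  revert f
  decide

lemma R_le_centralizer (hC : Config o z P U R) : R ≤ 𝐂(R) :=
  le_centralizer_of_card_prime (by rw [hC.card_R]; norm_num)

lemma two_dvd_card (hC : Config o z P U R) :
    2 ∣ Nat.card (stab₂ G o z ⊓ 𝐂(U) ⊓ 𝐂(R) : Subgroup G) := by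
  by_contra h2
  set W := stab₂ G o z ⊓ 𝐂(U) with hW
  have hRW : R ≤ W := hC.R_le_stab_inf
  obtain ⟨f, hf, hWc⟩ := hC.card_stab_inf
  obtain ⟨e, he, hWe⟩ := card_eq_card_inf_centralizer_mul (A := R) (H := W)
    (by rw [hC.card_R]; norm_num)
    (le_normalizer_of_conj_mem fun w hw r hr => (mem_normalizer_iff.1 (hC.K_le w hw.1.1 hw.1.2) r).1 hr)
  have hRd := card_dvd_of_le (le_inf hRW hC.R_le_centralizer)
  rw [hC.card_R] at hRd he
  rw [← hW, hWe] at hWc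
  have hWc : Nat.card W = 62 := by
    rw [hWe]
    obtain ⟨j, hj⟩ := hRd
    rw [hj] at hWc h2 ⊢
    have h3 : j * e = 2 * f := by
      rw [mul_assoc] at hWc
      omega
    have h4 : j ∣ 2 * f := Dvd.intro _ h3
    have h5 : j = 1 := by
      have h8 : j ∣ 2 ^ 3 := h4.trans (by clear * - hf; revert f; decide)
      obtain ⟨w, -, rfl⟩ := (Nat.dvd_prime_pow Nat.prime_two).1 h8
      rcases Nat.eq_zero_or_pos w with rfl | hw
      · rfl
      · exact (h2 ((dvd_pow_self 2 hw.ne').mul_left _)).elim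
    subst h5
    rw [one_mul] at h3
    subst h3
    have : f = 1 := by
      clear * - hf he
      revert he
      revert f
      decide
    rw [this]
  obtain ⟨i, hiW, hi⟩ := exists_mem_orderOf Nat.prime_two (show 2 ∣ Nat.card W by rw [hWc]; norm_num)
  have hi2 : i * i = 1 := by rw [← pow_two, ← hi, pow_orderOf_eq_one]
  have hi1 : i ≠ 1 := by
    rintro rfl
    simp at hi
  have hi' : i⁻¹ = i := inv_eq_of_mul_eq_one_left hi2
  have hiR : i ∉ 𝐂(R) := fun h => h2 <| by
    rw [← hi]
    exact Subgroup.orderOf_dvd_natCard _ ⟨hiW, h⟩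
  have hRi : R ⊓ centralizer {i} = ⊥ := by
    have h := card_dvd_of_le (inf_le_left : R ⊓ centralizer {i} ≤ R)
    rw [hC.card_R] at h
    rcases (Nat.dvd_prime (by norm_num)).1 h with h | h
    · exact card_eq_one.1 h
    · refine (hiR (mem_centralizer_iff.2 fun u hu => ?_)).elim
      exact (mem_centralizer_singleton_iff.1 <|
        inf_eq_left.1 (eq_of_le_of_card_eq inf_le_left (by rw [h, hC.card_R])) hu)
  have hinv : ∀ r ∈ R, i * r * i⁻¹ = r⁻¹ := fun r hr => by
    have h1 : i * r * i⁻¹ ∈ R := (mem_normalizer_iff.1 (hC.K_le i hiW.1.1 hiW.1.2) r).1 hr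
    have h2 : r * (i * r * i⁻¹) ∈ R ⊓ centralizer {i} := by
      refine ⟨R.mul_mem hr h1, mem_centralizer_singleton_iff.2 ?_⟩
      have h3 := (commute_of_mem_centralizer (hC.R_le_centralizer hr) h1).eq
      have h4 : i * (r * (i * r * i⁻¹)) * i⁻¹ = r * (i * r * i⁻¹) := by
        rw [h3]
        calc _ = i * i * r * i⁻¹ * r * i⁻¹ := by group
          _ = _ := by rw [hi2, one_mul, ← h3, hi']; group
      exact (conj_eq_iff_commute.1 h4).eq.symm
    rw [hRi, mem_bot] at h2
    exact eq_inv_of_mul_eq_one_right h2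
  have hind : (R.subgroupOf W).index = 2 := by
    have := card_mul_index (R.subgroupOf W)
    rw [card_subgroupOf_of_le hRW, hC.card_R, hWc] at this
    omega
  have hiR' : i ∉ R := fun h => hiR (hC.R_le_centralizer h)
  have hconj : ∀ w ∈ W, w ∉ R → ∃ r ∈ R, w = r * i * r⁻¹ := fun w hw hwR => by
    have h1 : w * i ∈ R := by
      have := (mul_mem_iff_of_index_two hind (a := ⟨w, hw⟩) (b := ⟨i, hiW⟩)).2
        (by simp only [mem_subgroupOf, hwR, hiR'])
      simpa [mem_subgroupOf] using this
    refine ⟨(w * i) ^ 16, R.pow_mem h1 _, ?_⟩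
    have h2 := hinv _ (R.pow_mem h1 16)
    have h3 : (w * i) ^ 31 = 1 := by
      rw [← hC.card_R]
      exact pow_card_eq_one' (G := R) (x := ⟨_, h1⟩) |> congrArg Subtype.val
    rw [← h2, hi', ← mul_assoc, ← mul_assoc, mul_assoc ((w * i) ^ 16), hi2, mul_one, ← pow_add,
      pow_succ, h3, one_mul, mul_assoc, hi2, mul_one]
  obtain ⟨t, ht, hto, -⟩ := hC.exists_swap
  have htR : t * i * t⁻¹ ∉ R := fun h => hiR' ((mem_normalizer_iff.1 ht i).2 h)
  obtain ⟨r, hr, hrt⟩ := hconj _ (hC.conj_mem_stab_inf ht hiW) htR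
  have hgc : Commute (r⁻¹ * t) i := by
    refine conj_eq_iff_commute.1 ?_
    calc _ = r⁻¹ * (t * i * t⁻¹) * r := by group
      _ = _ := by rw [hrt]; group
  have h61 := hC.card_ne_of_commute hiW.1 hgc (by
    rw [mul_smul, hto, inv_smul_eq_iff, hC.R_z r hr])
  have hfix : hC.fixMod i ≤ U := by
    have h1 : U ≤ P ⊓ centralizer {i} := le_inf hC.U_le fun u hu =>
      mem_centralizer_singleton_iff.2 (commute_of_mem_centralizer hiW.2 hu).eq.symm
    have h3 := card_dvd_of_le (inf_le_left : P ⊓ centralizer {i} ≤ P)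
    have h4 := card_dvd_of_le h1
    rw [hC.card_P] at h3
    rw [hC.card_U] at h4
    obtain ⟨j, hj, hj'⟩ := (Nat.dvd_prime_pow (by norm_num)).1 h3
    have hj3 : j ≠ 3 := by
      rintro rfl
      refine hi1 (hC.eq_one_of_commute hiW.1 fun p hp => ?_)
      exact (mem_centralizer_singleton_iff.1 <|
        inf_eq_left.1 (eq_of_le_of_card_eq inf_le_left (by rw [hj', hC.card_P])) hp).symm
    have hj1 : j = 1 := by
      rw [hj'] at h61 h4
      interval_cases j <;> simp_all
    intro p hp
    rw [eq_of_le_of_card_eq h1 (by rw [hj', hj1, hC.card_U, pow_one])]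
    exact ⟨hp.1, mem_centralizer_singleton_iff.2
      (hC.commute_of_mem_fixMod hiW.1 hiW.2 hp).eq.symm⟩
  have hii := fun p (hp : p ∈ P) => hC.inverts_of_fixMod_le hiW.1 hi2 hfix hp
  refine hiR (mem_centralizer_iff.2 fun r hr => ?_)
  have hrW : r * i * r⁻¹ ∈ W := W.mul_mem (W.mul_mem (hRW hr) hiW) (W.inv_mem (hRW hr))
  have h1 : r * i * r⁻¹ * i = 1 := by
    have hm := W.mul_mem hrW hiW
    refine hC.eq_one_of_fixMod hm.1 hm.2 (hC.le_fixMod_mul hrW.1 (fun p hp => ?_) hii)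
    have h1 := hii (r⁻¹ * p * r) (by simpa using hC.conj_P (hC.R_o _ (R.inv_mem hr)) hp)
    have h2 := hC.conj_U (hC.R_le hr) h1
    have h3 : r * (r⁻¹ * p * r * (i * (r⁻¹ * p * r) * i⁻¹)) * r⁻¹ =
      p * (r * i * r⁻¹ * p * (r * i * r⁻¹)⁻¹) := by group
    rwa [h3] at h2
  rw [mul_eq_one_iff_eq_inv, hi'] at h1
  exact mul_inv_eq_iff_eq_mul.1 h1

/-- The central involution of `𝐍(R)`. -/
lemma exists_involution (hC : Config o z P U R) : ∃ i ∈ stab₂ G o z ⊓ 𝐂(U), i * i = 1 ∧ i ≠ 1 ∧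
    (∀ l ∈ 𝐍(R), Commute l i) ∧ (∀ p ∈ P, p * (i * p * i⁻¹) ∈ U) ∧
    (∀ ω : Ω, i • ω = ω → ∀ r ∈ R, r • ω = ω) := by
  have key : ∀ j ∈ stab₂ G o z ⊓ 𝐂(U) ⊓ 𝐂(R), j * j = 1 → j ≠ 1 → hC.fixMod j = U := by
    intro j hj hj2 hj1
    refine (hC.fixMod_eq hj.1.1 hj.2).resolve_right fun h => hj1 ?_
    exact hC.eq_one_of_fixMod hj.1.1 hj.1.2 h.ge
  obtain ⟨i, hi, hio⟩ := exists_mem_orderOf Nat.prime_two hC.two_dvd_card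
  have hi2 : i * i = 1 := by rw [← pow_two, ← hio, pow_orderOf_eq_one]
  have hi1 : i ≠ 1 := by
    rintro rfl
    simp at hio
  have hii : ∀ p ∈ P, p * (i * p * i⁻¹) ∈ U := fun p hp =>
    hC.inverts_of_fixMod_le hi.1.1 hi2 (key i hi hi2 hi1).le hp
  refine ⟨i, hi.1, hi2, hi1, fun l hl => ?_, hii, fun ω hω => ?_⟩
  · have hl' := conj_smul_eq_iff.2 hl
    have hj : l * i * l⁻¹ ∈ stab₂ G o z ⊓ 𝐂(U) ⊓ 𝐂(R) := by
      refine ⟨hC.conj_mem_stab_inf hl hi.1, ?_⟩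
      have : l * i * l⁻¹ ∈ 𝐂(MulAut.conj l • R) := by
        rw [mem_centralizer_conj_smul]
        simpa [mul_assoc] using hi.2
      rwa [hl'] at this
    have hj2 : l * i * l⁻¹ * (l * i * l⁻¹) = 1 := by
      calc _ = l * (i * i) * l⁻¹ := by group
        _ = 1 := by rw [hi2]; group
    have hj1 : l * i * l⁻¹ ≠ 1 := by simpa using hi1
    have hm := mul_mem hj.1 hi.1
    have h1 := hC.eq_one_of_fixMod hm.1 hm.2 (hC.le_fixMod_mul hj.1.1 (fun p hp =>
      hC.inverts_of_fixMod_le hj.1.1 hj2 (key _ hj hj2 hj1).le hp) hii)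
    rw [mul_eq_one_iff_eq_inv, inv_eq_of_mul_eq_one_left hi2] at h1
    exact conj_eq_iff_commute.1 h1
  · by_cases ho : ω = o
    · rw [ho]
      exact hC.R_o
    · obtain ⟨p, hp, rfl⟩ := hC.exists_smul_z ho
      rw [smul_smul_z hi.1.1.2] at hω
      have h1 := hC.smul_z_inj (hC.conj_P hi.1.1.1 hp) hp hω
      refine hC.fixed_iff.2 (Or.inr ⟨p, ?_, rfl⟩)
      rw [← key i hi hi2 hi1]
      exact ⟨hp, by rw [h1, inv_mul_cancel]; exact U.one_mem⟩

end Config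

/-- The points fixed by `R`. -/
def fixedSub (Ω : Type*) {G : Type*} [Group G] [MulAction G Ω] (R : Subgroup G) :
    SubMulAction 𝐍(R) Ω where
  carrier := {ω | ∀ r ∈ R, r • ω = ω}
  smul_mem' l _ hω := Config.smul_fixed l.2 hω

namespace Config
variable {G Ω : Type*} [Group G] [MulAction G Ω] {o z : Ω} {P U R : Subgroup G}
  {k p q u x y g l : G} {ω : Ω}

lemma U_le_normalizer (hC : Config o z P U R) : U ≤ 𝐍(R) :=
  hC.U_le_centralizer.trans (centralizer_le_normalizer _)

noncomputable def fixedEquiv (hC : Config o z P U R) : Option U ≃ fixedSub Ω R :=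
  Equiv.ofBijective (fun u => u.elim ⟨o, hC.R_o⟩ fun u => ⟨(u : G) • z, hC.fixed_iff.2
    (Or.inr ⟨u, u.2, rfl⟩)⟩) <| by
  constructor
  · rintro (_ | p) (_ | q) hpq
    · rfl
    · exact (hC.smul_z_ne (hC.U_le q.2) (Subtype.ext_iff.1 hpq).symm).elim
    · exact (hC.smul_z_ne (hC.U_le p.2) (Subtype.ext_iff.1 hpq)).elim
    · exact congrArg some (Subtype.ext (hC.smul_z_inj (hC.U_le p.2) (hC.U_le q.2)
        (Subtype.ext_iff.1 hpq)))
  · rintro ⟨ω, hω⟩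
    rcases hC.fixed_iff.1 hω with rfl | ⟨u, hu, rfl⟩
    · exact ⟨none, rfl⟩
    · exact ⟨some ⟨u, hu⟩, rfl⟩

variable [Finite G]

lemma finite_fixedSub (hC : Config o z P U R) : Finite (fixedSub Ω R) :=
  Finite.of_equiv _ hC.fixedEquiv

lemma card_fixedSub (hC : Config o z P U R) : Nat.card (fixedSub Ω R) = 62 := by
  rw [← Nat.card_congr hC.fixedEquiv, Finite.card_option, hC.card_U]

/-- A point fixed by `R` is not fixed by a second conjugate of `R` commuting with `R`. -/
lemma not_fixed (hC : Config o z P U R) {S : Subgroup G} (hS : Nat.card S = 31) (hne : S ≠ R)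
    (hSR : S ≤ 𝐂(R)) (hω : ∀ r ∈ R, r • ω = ω) : ¬ ∀ s ∈ S, s • ω = ω := by
  wlog ho : ω = o generalizing S ω
  · intro h
    obtain ⟨l, hl, rfl⟩ := hC.fix_R ω hω
    have hl' := conj_smul_eq_iff.2 (inv_mem hl)
    refine this (S := MulAut.conj l⁻¹ • S) (ω := o) (by rw [card_conj_smul, hS]) (fun h => hne ?_) ?_
      hC.R_o rfl fun s hs => ?_
    · have h1 := conj_smul_eq_comm h
      rw [inv_inv, conj_smul_eq_iff.2 hl] at h1
      exact h1.symm
    · have h1 := conj_smul_mono (g := l⁻¹) hSR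
      rwa [← centralizer_conj_smul, hl'] at h1
    · rw [mem_conj_smul, inv_inv] at hs
      have h1 := h _ hs
      rwa [mul_smul, mul_smul, inv_smul_smul, smul_left_cancel_iff] at h1
  subst ho
  intro h
  have := Fact.mk (show Nat.Prime 31 by norm_num)
  let A : SubMulAction S Ω :=
    { carrier := {ω' | ∃ u ∈ U, u • z = ω'}
      smul_mem' := by
        rintro ⟨s, hs⟩ ω' ⟨u, hu, rfl⟩
        have h1 := smul_fixed (centralizer_le_normalizer _ (hSR hs))
          (hC.fixed_iff.2 (Or.inr ⟨u, hu, rfl⟩))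
        refine (hC.fixed_iff.1 h1).resolve_left fun h2 => ?_
        rw [← eq_inv_smul_iff, h _ (S.inv_mem hs)] at h2
        exact hC.smul_z_ne (hC.U_le hu) h2 }
  have hA : Nat.card A = 61 := by
    rw [← hC.card_U]
    refine (Nat.card_eq_of_bijective (fun u : U => (⟨(u : G) • z, u, u.2, rfl⟩ : A)) ⟨?_, ?_⟩).symm
    · intro p q hpq
      exact Subtype.ext (hC.smul_z_inj (hC.U_le p.2) (hC.U_le q.2) (Subtype.ext_iff.1 hpq))
    · rintro ⟨_, u, hu, rfl⟩
      exact ⟨⟨u, hu⟩, rfl⟩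
  obtain ⟨⟨_, u, hu, rfl⟩, hfix⟩ := (IsPGroup.of_card (p := 31) (n := 1)
    (by rw [hS, pow_one]) : IsPGroup 31 S).nonempty_fixed_point_of_prime_not_dvd_card A
    (by rw [hA]; norm_num)
  have huC := hC.U_le_centralizer hu
  have h1 : MulAut.conj u⁻¹ • S ≤ stab₂ G ω z := by
    intro s hs
    rw [mem_conj_smul, inv_inv] at hs
    have h2 := hC.P_o (hC.U_le hu)
    constructor
    · have h1 := h _ hs
      rw [mul_smul, mul_smul, inv_smul_eq_iff.2 h2.symm, smul_eq_iff_eq_inv_smul,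
        inv_smul_eq_iff.2 h2.symm] at h1
      exact h1
    · have h1 : (u * s * u⁻¹) • u • z = u • z := Subtype.ext_iff.1 (hfix ⟨_, hs⟩)
      rw [mul_smul, mul_smul, inv_smul_smul, smul_left_cancel_iff] at h1
      exact h1
  have h31 : Nat.Prime 31 := by norm_num
  have h2 : IsSylowIn 31 R (stab₂ G ω z) := isSylowIn_of_card h31 (k := 1) (r := 120) hC.R_le
    (by rw [hC.card_R, pow_one]) (by rw [hC.card_K]; norm_num) (by norm_num)
  have h3 := h2.le_of_normal h31 (fun k hk => hC.K_le k hk.1 hk.2)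
    (IsPGroup.of_card (n := 1) (by rw [card_conj_smul, hS, pow_one])) h1
  have h4 := conj_smul_eq_comm (g := u⁻¹) (eq_of_le_of_card_eq h3 (by rw [card_conj_smul, hS, hC.card_R]))
  rw [inv_inv, conj_smul_eq_iff.2 (centralizer_le_normalizer _ huC)] at h4
  exact hne h4.symm

open Classical in
/-- Some involution centralizing `R` has no fixed point among the points fixed by `R`. -/
lemma exists_involution_centralizer (hC : Config o z P U R) :
    ∃ j ∈ 𝐂(R), j * j = 1 ∧ ∀ ω : Ω, (∀ r ∈ R, r • ω = ω) → j • ω ≠ ω := by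
  obtain ⟨i, hiW, hi2, hi1, hiL, -, hfix⟩ := hC.exists_involution
  obtain ⟨g, hg, hgR⟩ := hC.exists_conj
  refine ⟨g * i * g⁻¹, ?_, ?_, fun ω hω h => ?_⟩
  · have h1 : R ≤ 𝐂(MulAut.conj g • R) := le_centralizer_comm.1 hgR
    refine mem_centralizer_iff.2 fun r hr => ?_
    have h2 := (centralizer_le_normalizer _) (h1 hr)
    rw [normalizer_conj_smul, mem_conj_smul] at h2
    have h3 := (hiL _ h2).eq
    calc r * (g * i * g⁻¹) = g * (g⁻¹ * r * g * i) * g⁻¹ := by group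
      _ = _ := by rw [h3]; group
  · calc _ = g * (i * i) * g⁻¹ := by group
      _ = 1 := by rw [hi2]; group
  · refine hC.not_fixed (by rw [card_conj_smul, hC.card_R]) hg hgR hω fun s hs => ?_
    rw [mem_conj_smul] at hs
    rw [mul_smul, mul_smul, smul_eq_iff_eq_inv_smul] at h
    have h1 := hfix _ h _ hs
    rwa [mul_smul, mul_smul, smul_inv_smul, smul_left_cancel_iff] at h1

open Classical in
/-- The sign of the action of an element of `𝐍(R)` on the points fixed by `R`. -/
noncomputable def sgn (hC : Config o z P U R) : 𝐍(R) →* ℤˣ :=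
  letI := hC.finite_fixedSub
  letI := Fintype.ofFinite (fixedSub Ω R)
  Equiv.Perm.sign.comp (MulAction.toPermHom 𝐍(R) (fixedSub Ω R))

open Classical in
lemma sgn_apply (hC : Config o z P U R) [Fintype (fixedSub Ω R)] (l : 𝐍(R)) :
    hC.sgn l = Equiv.Perm.sign (MulAction.toPermHom 𝐍(R) (fixedSub Ω R) l) := by
  unfold sgn
  simp only [MonoidHom.comp_apply]
  congr!

open Classical in
lemma sgn_of_fixedPointFree (hC : Config o z P U R) {l : 𝐍(R)} (hl : l * l = 1)
    (h : ∀ ω : Ω, (∀ r ∈ R, r • ω = ω) → (l : G) • ω ≠ ω) : hC.sgn l = -1 := by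
  have := hC.finite_fixedSub
  have := Fintype.ofFinite (fixedSub Ω R)
  rw [sgn_apply, Equiv.Perm.sign_of_pow_two_eq_one (by rw [← map_pow, pow_two, hl, map_one])]
  have : IsEmpty (Function.fixedPoints (MulAction.toPermHom 𝐍(R) (fixedSub Ω R) l)) :=
    ⟨fun ⟨⟨ω, hω⟩, hfix⟩ => h ω hω (Subtype.ext_iff.1 hfix)⟩
  rw [Fintype.card_eq_zero (α := Function.fixedPoints _), ← Nat.card_eq_fintype_card, hC.card_fixedSub]
  decide

lemma sgn_of_U (hC : Config o z P U R) {l : 𝐍(R)} (hl : (l : G) ∈ U) : hC.sgn l = 1 := by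
  have h1 : hC.sgn l ^ 61 = 1 := by
    rw [← map_pow, show l ^ 61 = 1 from Subtype.ext (hC.pow_U hl), map_one]
  rcases Int.units_eq_one_or (hC.sgn l) with h | h
  · exact h
  · rw [h] at h1
    exact absurd h1 (by decide)

open Classical in
lemma sgn_of_square (hC : Config o z P U R) {l : 𝐍(R)} (hl : (l : G) ∈ stab₂ G o z) (b : MulAut U)
    (h : ∀ u : U, (b (b u) : G) = l * u * (l : G)⁻¹) : hC.sgn l = 1 := by
  have := hC.finite_fixedSub
  have := Fintype.ofFinite (fixedSub Ω R)
  have := Fintype.ofFinite U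
  rw [sgn_apply, Equiv.Perm.sign_eq_sign_of_equiv _ (Equiv.optionCongr (b * b).toEquiv)
    hC.fixedEquiv.symm, Equiv.optionCongr_sign]
  · have : (b * b).toEquiv = MulAut.toPerm U b * MulAut.toPerm U b := rfl
    rw [this, map_mul, Int.units_mul_self]
  · intro x
    obtain ⟨x, rfl⟩ := hC.fixedEquiv.surjective x
    rw [Equiv.symm_apply_apply, Equiv.symm_apply_eq]
    rcases x with _ | u
    · exact Subtype.ext hl.1
    · refine Subtype.ext ?_
      change (l : G) • (u : G) • z = (b (b u) : G) • z
      rw [h, smul_smul_z hl.2]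

/-- The action of the two-point stabilizer on `U` by conjugation. -/
noncomputable def conjHom (hC : Config o z P U R) : stab₂ G o z →* MulAut U :=
  U.normalizerMonoidHom.comp (inclusion hC.stab_le_normalizer)

lemma conjHom_apply (hC : Config o z P U R) (k : stab₂ G o z) (u : U) :
    (hC.conjHom k u : G) = k * u * (k : G)⁻¹ := rfl

lemma conjHom_ker (hC : Config o z P U R) :
    hC.conjHom.ker = (stab₂ G o z ⊓ 𝐂(U)).subgroupOf (stab₂ G o z) := by
  ext k
  rw [MonoidHom.mem_ker, mem_subgroupOf]
  refine ⟨fun h => ⟨k.2, mem_centralizer_iff.2 fun u hu => ?_⟩, fun h => ?_⟩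
  · have h1 := hC.conjHom_apply k ⟨u, hu⟩
    rw [h] at h1
    exact (mul_inv_eq_iff_eq_mul.1 h1.symm).symm
  · ext u
    rw [conjHom_apply, (commute_of_mem_centralizer h.2 u.2).eq, mul_inv_cancel_right]
    rfl

lemma isCyclic_mulAut (hC : Config o z P U R) : IsCyclic (MulAut U) := by
  have := Fact.mk (show Nat.Prime 61 by norm_num)
  have : IsCyclic U := isCyclic_of_prime_card hC.card_U
  have h := IsCyclic.mulAutMulEquiv U
  rw [hC.card_U] at h
  exact isCyclic_of_injective h.toMonoidHom h.injective

lemma card_mulAut (hC : Config o z P U R) : Nat.card (MulAut U) = 60 := by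
  have := Fact.mk (show Nat.Prime 61 by norm_num)
  have : IsCyclic U := isCyclic_of_prime_card hC.card_U
  rw [IsCyclic.card_mulAut, hC.card_U]
  decide +kernel

lemma exists_smul_o (hC : Config o z P U R) {ω' : Ω} (h : ∀ r ∈ R, r • ω = ω) (h' : ∀ r ∈ R, r • ω' = ω')
    (ho : ω ≠ o) (ho' : ω' ≠ o) : ∃ u ∈ U, u • ω = ω' := by
  obtain ⟨u, hu, rfl⟩ := (hC.fixed_iff.1 h).resolve_left ho
  obtain ⟨v, hv, rfl⟩ := (hC.fixed_iff.1 h').resolve_left ho'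
  exact ⟨v * u⁻¹, U.mul_mem hv (U.inv_mem hu), by rw [mul_smul, inv_smul_smul]⟩

/-- Some element of `𝐂(R)` fixing `o` and `z` induces an odd permutation. -/
lemma exists_sgn_ne (hC : Config o z P U R) :
    ∃ a : 𝐍(R), (a : G) ∈ stab₂ G o z ⊓ 𝐂(R) ∧ hC.sgn a ≠ 1 := by
  by_contra! hA
  obtain ⟨y, hyC, hy2, hy⟩ := hC.exists_involution_centralizer
  set y' : 𝐍(R) := ⟨y, centralizer_le_normalizer _ hyC⟩ with hy'
  have hyN := y'.2
  have hodd : hC.sgn y' = -1 := hC.sgn_of_fixedPointFree (Subtype.ext hy2) hy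
  have hyo := hy o hC.R_o
  have hi : y⁻¹ = y := inv_eq_of_mul_eq_one_left hy2
  have hst : ∀ c : 𝐍(R), (c : G) ∈ 𝐂(R) → (c : G) • o = o → hC.sgn c = 1 := fun c hc hco => by
    have h1 : (c : G) • z ≠ o := fun h => hC.z_ne <| by
      rw [← hco] at h
      exact smul_left_cancel _ h
    obtain ⟨u, hu, h⟩ := hC.exists_smul_o (smul_fixed c.2 hC.R_z) hC.R_z h1 hC.z_ne
    have h3 : (u * (c : G)) • o = o := by rw [mul_smul, hco, hC.P_o (hC.U_le hu)]
    have h4 : (u * (c : G)) • z = z := by rw [mul_smul, h]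
    have h5 : u * (c : G) ∈ stab₂ G o z ⊓ 𝐂(R) :=
      ⟨⟨h3, h4⟩, (𝐂(R)).mul_mem (hC.U_le_centralizer hu) hc⟩
    have h2 := hA (⟨u, hC.U_le_normalizer hu⟩ * c) h5
    rwa [map_mul, hC.sgn_of_U hu, one_mul] at h2
  obtain ⟨u, hu, hu61⟩ := hC.exists_orderOf_U
  have h1 : u • y • o ≠ y • o := fun h => by
    have hfix := smul_fixed hyN hC.R_o
    obtain ⟨v, hv, hv'⟩ := hC.exists_smul_o hC.R_z hfix hC.z_ne hyo
    rw [← hv', ← mul_smul] at h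
    have := hC.smul_z_inj (P.mul_mem (hC.U_le hu) (hC.U_le hv)) (hC.U_le hv) h
    rw [mul_eq_right] at this
    rw [this] at hu61
    simp at hu61
  have hyy := smul_fixed hyN hC.R_o
  have huN := hC.U_le_normalizer hu
  have h2 : y • u • y • o ≠ o := fun h => h1 <| by
    rw [smul_eq_iff_eq_inv_smul, hi] at h
    exact h
  obtain ⟨v, hv, hv'⟩ := hC.exists_smul_o (smul_fixed hyN (smul_fixed huN hyy))
    hyy h2 hyo
  have hvN := hC.U_le_normalizer hv
  have h3 := hst (y' * ⟨v, hvN⟩ * y' * ⟨u, huN⟩ * y') (mul_mem (mul_mem (mul_mem (mul_mem hyC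
    (hC.U_le_centralizer hv)) hyC) (hC.U_le_centralizer hu)) hyC) (by
      change (y * v * y * u * y) • o = o
      rw [mul_smul, mul_smul, mul_smul, mul_smul, hv', smul_smul, hy2, one_smul])
  rw [map_mul, map_mul, map_mul, map_mul, hC.sgn_of_U (l := ⟨u, huN⟩) hu,
    hC.sgn_of_U (l := ⟨v, hvN⟩) hv, hodd] at h3
  exact absurd h3 (by decide)

end Config

lemma card_eq_card_orbit_mul {G Ω : Type*} [Group G] [MulAction G Ω] [Finite G]
    (H : Subgroup G) (ω : Ω) :
    Nat.card H = Nat.card (MulAction.orbit H ω) *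
      Nat.card (H ⊓ MulAction.stabilizer G ω : Subgroup G) := by
  have h : MulAction.stabilizer H ω = (H ⊓ MulAction.stabilizer G ω).subgroupOf H := by
    ext x
    simp [mem_subgroupOf, MulAction.mem_stabilizer_iff, Subgroup.smul_def]
  rw [Nat.card_congr (MulAction.orbitEquivQuotientStabilizer H ω),
    ← card_subgroupOf_of_le (inf_le_left : H ⊓ MulAction.stabilizer G ω ≤ H), ← h]
  exact card_eq_card_quotient_mul_card_subgroup _

lemma exists_sq_of_isCyclic {C : Type*} [Group C] [IsCyclic C] {n : ℕ} (hC : Nat.card C = 2 * n)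
    (hn : n ≠ 0) {x : C} (hx : x ^ n = 1) : ∃ b, b * b = x := by
  obtain ⟨g, hg⟩ := IsCyclic.exists_generator (α := C)
  obtain ⟨k, rfl⟩ := mem_zpowers_iff.1 (hg x)
  rw [← zpow_natCast, ← zpow_mul, ← orderOf_dvd_iff_zpow_eq_one,
    orderOf_eq_card_of_forall_mem_zpowers hg, hC, Nat.cast_mul,
    Int.mul_dvd_mul_iff_right (by exact_mod_cast hn)] at hx
  obtain ⟨j, rfl⟩ := hx
  exact ⟨g ^ j, by rw [← zpow_add]; congr 1; push_cast; ring⟩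

namespace Config
variable {G Ω : Type*} [Group G] [MulAction G Ω] {o z : Ω} {P U R : Subgroup G}
  {k p q u x y g l : G} {ω : Ω} [Finite G]

lemma exists_centralizer_smul (hC : Config o z P U R) (hω : ∀ r ∈ R, r • ω = ω) :
    ∃ c ∈ 𝐂(R), c • o = ω := by
  by_cases ho : ω = o
  · exact ⟨1, one_mem _, by rw [one_smul, ho]⟩
  · obtain ⟨y, hyC, -, hy⟩ := hC.exists_involution_centralizer
    obtain ⟨u, hu, h⟩ := hC.exists_smul_o
      (smul_fixed (centralizer_le_normalizer _ hyC) hC.R_o) hω (hy o hC.R_o) ho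
    exact ⟨u * y, mul_mem (hC.U_le_centralizer hu) hyC, by rw [mul_smul, h]⟩

lemma card_centralizer (hC : Config o z P U R) :
    Nat.card 𝐂(R) = 62 * (61 * Nat.card (stab₂ G o z ⊓ 𝐂(R) : Subgroup G)) := by
  have h1 : MulAction.orbit 𝐂(R) o = (fixedSub Ω R : Set Ω) := by
    ext ω
    constructor
    · rintro ⟨⟨c, hc⟩, rfl⟩
      exact smul_fixed (centralizer_le_normalizer _ hc) hC.R_o
    · intro h
      obtain ⟨c, hc, hco⟩ := hC.exists_centralizer_smul h
      exact ⟨⟨c, hc⟩, hco⟩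
  have h2 : Nat.card (MulAction.orbit (𝐂(R) ⊓ MulAction.stabilizer G o : Subgroup G) z) = 61 := by
    rw [← hC.card_U]
    refine (Nat.card_eq_of_bijective (fun u : U => (⟨(u : G) • z,
      ⟨u, hC.U_le_centralizer u.2, hC.P_o (hC.U_le u.2)⟩, rfl⟩ :
      MulAction.orbit (𝐂(R) ⊓ MulAction.stabilizer G o : Subgroup G) z)) ⟨?_, ?_⟩).symm
    · intro p q hpq
      exact Subtype.ext (hC.smul_z_inj (hC.U_le p.2) (hC.U_le q.2) (Subtype.ext_iff.1 hpq))
    · rintro ⟨_, ⟨c, hc⟩, rfl⟩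
      have h3 : c • z ≠ o := fun h => hC.z_ne <| by
        have h4 : c • o = o := hc.2
        rw [← h4] at h
        exact smul_left_cancel _ h
      obtain ⟨u, hu, h⟩ := (hC.fixed_iff.1 (smul_fixed (centralizer_le_normalizer _ hc.1)
        hC.R_z)).resolve_left h3
      exact ⟨⟨u, hu⟩, Subtype.ext h⟩
  rw [card_eq_card_orbit_mul _ o, h1, card_eq_card_orbit_mul (𝐂(R) ⊓ _) z, h2, inf_assoc, inf_comm]
  exact congrArg (· * _) hC.card_fixedSub

lemma stab_le_centralizer_and_card (hC : Config o z P U R) :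
    stab₂ G o z ≤ 𝐂(R) ∧ Nat.card (stab₂ G o z ⊓ 𝐂(U) : Subgroup G) = 62 := by
  obtain ⟨a, haA, ha⟩ := hC.exists_sgn_ne
  obtain ⟨f, hf, hW⟩ := hC.card_stab_inf
  set A := stab₂ G o z ⊓ 𝐂(R) with hA
  set W := stab₂ G o z ⊓ 𝐂(U) with hWdef
  set φ := hC.conjHom.comp (inclusion (inf_le_left : A ≤ stab₂ G o z)) with hφ
  have h15 : 15 ∣ Nat.card A := by
    have h := hC.dvd_card_C
    rw [hC.card_centralizer] at h
    exact Nat.Coprime.dvd_of_dvd_mul_left (by norm_num)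
      (Nat.Coprime.dvd_of_dvd_mul_left (by norm_num) h)
  have hker : φ.ker = (A ⊓ W).subgroupOf A := by
    rw [hφ, ← MonoidHom.comap_ker, conjHom_ker]
    ext x
    simp only [mem_comap, mem_subgroupOf, mem_inf, coe_inclusion, SetLike.coe_mem, true_and]
    rfl
  have hcard : Nat.card A = Nat.card φ.range * Nat.card (A ⊓ W : Subgroup G) := by
    rw [← card_subgroupOf_of_le (inf_le_left : A ⊓ W ≤ A), ← hker, ← card_mul_index φ.ker,
      index_ker, mul_comm]
  have h60 := card_subgroup_dvd_card φ.range
  rw [hC.card_mulAut] at h60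
  have hm : Nat.card (A ⊓ W : Subgroup G) ∣ 62 * f := hW ▸ card_dvd_of_le inf_le_right
  have h30 : ¬ Nat.card φ.range ∣ 30 := fun h => ha <| by
    have h1 : (φ ⟨a, haA⟩) ^ 30 = 1 := by
      obtain ⟨j, hj⟩ := h
      have := pow_card_eq_one' (x := (⟨φ ⟨a, haA⟩, _, rfl⟩ : φ.range))
      have h2 : φ ⟨a, haA⟩ ^ Nat.card φ.range = 1 := Subtype.ext_iff.1 this
      rw [hj, pow_mul, h2]
      exact one_pow _
    have := hC.isCyclic_mulAut
    obtain ⟨b, hb⟩ := exists_sq_of_isCyclic (n := 30) hC.card_mulAut (by norm_num) h1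
    refine hC.sgn_of_square haA.1 b fun u => ?_
    rw [← MulAut.mul_apply, hb]
    rfl
  have h15' : 15 ∣ Nat.card φ.range := by
    rw [hcard] at h15
    refine Nat.Coprime.dvd_of_dvd_mul_right (Nat.Coprime.of_dvd_right hm ?_) h15
    clear * - hf
    revert f
    decide
  have hn : Nat.card φ.range = 60 := by
    have h := Nat.mem_divisors.2 ⟨h60, by norm_num⟩
    revert h h15' h30
    generalize Nat.card φ.range = n
    intro h30 h15 h
    revert h30 h15
    revert n
    decide
  have h62 : 62 ∣ Nat.card (A ⊓ W : Subgroup G) := by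
    refine Nat.Coprime.mul_dvd_of_dvd_of_dvd (m := 2) (n := 31) (by norm_num) ?_ ?_
    · refine hC.two_dvd_card.trans (card_dvd_of_le ?_)
      exact fun x hx => ⟨⟨hx.1.1, hx.2⟩, hx.1⟩
    · rw [← hC.card_R]
      exact card_dvd_of_le (le_inf (le_inf hC.R_le hC.R_le_centralizer) hC.R_le_stab_inf)
  have hAK := card_dvd_of_le (inf_le_left : A ≤ stab₂ G o z)
  obtain ⟨j, hj⟩ := h62
  rw [hC.card_K] at hAK
  rw [hn, hj] at hcard
  have hj1 : j = 1 := by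
    rw [hcard, show 3720 = 60 * 62 * 1 by rfl, ← mul_assoc] at hAK
    exact Nat.dvd_one.1 (Nat.dvd_of_mul_dvd_mul_left (by norm_num) hAK)
  subst hj1
  have hAeq : A = stab₂ G o z := eq_of_le_of_card_eq inf_le_left (by rw [hcard, hC.card_K])
  have hWA : W ≤ A := hAeq ▸ inf_le_left
  rw [inf_eq_right.2 hWA] at hj
  exact ⟨inf_eq_left.1 hAeq, hj⟩

lemma stab_le_centralizer (hC : Config o z P U R) : stab₂ G o z ≤ 𝐂(R) :=
  hC.stab_le_centralizer_and_card.1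

lemma normalizer_le_centralizer (hC : Config o z P U R) : 𝐍(R) ≤ 𝐂(R) := by
  intro l hl
  obtain ⟨c, hc, hco⟩ := hC.exists_centralizer_smul (smul_fixed hl hC.R_o)
  have hc' := mul_mem (inv_mem (centralizer_le_normalizer _ hc)) hl
  have h1 : (c⁻¹ * l) • o = o := by rw [mul_smul, ← hco, inv_smul_smul]
  have h2 : (c⁻¹ * l) • z ≠ o := fun h =>
    hC.z_ne (smul_left_cancel _ (h.trans h1.symm))
  obtain ⟨u, hu, h⟩ := hC.exists_smul_o (smul_fixed hc' hC.R_z) hC.R_z h2 hC.z_ne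
  have h3 : u * (c⁻¹ * l) ∈ stab₂ G o z := by
    constructor
    · change (u * (c⁻¹ * l)) • o = o
      rw [mul_smul, h1, hC.P_o (hC.U_le hu)]
    · change (u * (c⁻¹ * l)) • z = z
      rw [mul_smul, h]
  have h4 := hC.stab_le_centralizer h3
  rwa [(𝐂(R)).mul_mem_cancel_left (hC.U_le_centralizer hu),
    (𝐂(R)).mul_mem_cancel_left (inv_mem hc)] at h4

lemma stab_inf_le (hC : Config o z P U R) : stab₂ G o z ⊓ 𝐂(U) ≤ 𝐂(𝐍(R)) := by
  obtain ⟨i, hiW, hi2, hi1, hiL, -⟩ := hC.exists_involution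
  rw [← inf_eq_left]
  refine eq_of_le_of_card_eq inf_le_left ?_
  rw [hC.stab_le_centralizer_and_card.2]
  refine Nat.dvd_antisymm ?_ (Nat.Coprime.mul_dvd_of_dvd_of_dvd (m := 2) (n := 31) (by norm_num)
    ?_ ?_)
  · rw [← hC.stab_le_centralizer_and_card.2]
    exact card_dvd_of_le inf_le_left
  · have h2 : orderOf i = 2 := orderOf_eq_prime (by rw [pow_two, hi2]) hi1
    have h := Subgroup.orderOf_dvd_natCard (stab₂ G o z ⊓ 𝐂(U) ⊓ 𝐂(𝐍(R)))
      ⟨hiW, mem_centralizer_iff.2 fun l hl => (hiL l hl).eq⟩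
    rwa [h2] at h
  · rw [← hC.card_R]
    exact card_dvd_of_le (le_inf hC.R_le_stab_inf
      (le_centralizer_comm.1 hC.normalizer_le_centralizer))

lemma commute_of_mem_normalizer (hC : Config o z P U R) (hx : x ∈ stab₂ G o z ⊓ 𝐂(U))
    (hl : l ∈ 𝐍(R)) : Commute l x :=
  (commute_of_mem_centralizer (hC.stab_inf_le hx) hl).symm

lemma stab_commute (hC : Config o z P U R) (hx : x ∈ stab₂ G o z) (hy : y ∈ stab₂ G o z) :
    Commute x y := by
  have := hC.isCyclic_mulAut
  have h := (hC.conjHom.isMulCommutative_of_isCyclic_of_ker_le_center fun k hk => by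
    rw [conjHom_ker, mem_subgroupOf] at hk
    refine mem_center_iff.2 fun g => Subtype.ext ?_
    exact hC.commute_of_mem_normalizer hk (hC.K_le g g.2.1 g.2.2)).is_comm.comm
    ⟨x, hx⟩ ⟨y, hy⟩
  exact Subtype.ext_iff.1 h

end Config

/-- The finite commutative ring of order `n` acting regularly is a field: a commutative group of
automorphisms that is regular on the nontrivial elements of a commutative group `V`. -/
theorem exists_field_mulEquiv {V K : Type*} [CommGroup V] [Finite V] [CommGroup K] {E : Type*}
    [Field E] [Finite E] (α : K →* MulAut V) (hE : Nat.card E = Nat.card V)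
    (hK : Nat.card K + 1 = Nat.card V) (hfree : ∀ k v, v ≠ 1 → α k v = v → k = 1) :
    ∃ (e : Multiplicative E ≃* V) (χ : K ≃* Eˣ),
      ∀ k (a : E), α k (e (.ofAdd a)) = e (.ofAdd ((χ k : E) * a)) := by
  have hV : 1 < Nat.card V := by
    rw [← hE]
    exact Finite.one_lt_card
  have : Finite K := Nat.finite_of_card_ne_zero (by omega)
  have := Finite.one_lt_card_iff_nontrivial.1 hV
  obtain ⟨v, hv⟩ := exists_ne (1 : V)
  let f : WithZero K → V := fun k => k.recZeroCoe 1 fun k => α k v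
  have f0 : f 0 = 1 := rfl
  have fc : ∀ k : K, f k = α k v := fun _ => rfl
  have hf : Function.Bijective f := by
    refine (Nat.bijective_iff_injective_and_card f).2 ⟨?_, ?_⟩
    · intro a b hab
      induction a with
      | zero =>
        induction b with
        | zero => rfl
        | coe b => exact (hv ((map_eq_one_iff _ (α b).injective).1 hab.symm)).elim
      | coe a =>
        induction b with
        | zero => exact (hv ((map_eq_one_iff _ (α a).injective).1 hab)).elim
        | coe b =>
          rw [fc, fc] at hab
          have h := hfree (b⁻¹ * a) v hv (by
            rw [map_mul, MulAut.mul_apply, hab, map_inv, MulAut.inv_apply_self])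
          rw [inv_mul_eq_one.1 h]
    · rw [← hK]
      exact Finite.card_option
  let φ := Equiv.ofBijective f hf
  have hmul : ∀ (k : K) (a : WithZero K), f (k * a) = α k (f a) := fun k a => by
    induction a with
    | zero => rw [mul_zero, f0, map_one]
    | coe a => rw [← WithZero.coe_mul, fc, fc, map_mul, MulAut.mul_apply]
  let plus : WithZero K → WithZero K → WithZero K := fun a b => φ.symm (f a * f b)
  have hadd : ∀ a b, f (plus a b) = f a * f b := fun a b => φ.apply_symm_apply _
  let neg : WithZero K → WithZero K := fun a => φ.symm (f a)⁻¹
  have hneg : ∀ a, f (neg a) = (f a)⁻¹ := fun a => φ.apply_symm_apply _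
  have hdist : ∀ a b c : WithZero K, a * plus b c = plus (a * b) (a * c) := fun a b c => by
    refine hf.1 ?_
    rw [hadd]
    induction a with
    | zero => simp only [zero_mul, f0, mul_one]
    | coe a => rw [hmul, hmul, hmul, hadd, map_mul]
  obtain ⟨ρ, hρ⟩ : ∃ ρ : WithZero K ≃* E,
      ∀ a b, ρ.symm (a + b) = plus (ρ.symm a) (ρ.symm b) := by
    let F : Field (WithZero K) :=
      { (inferInstance : CommGroupWithZero (WithZero K)) with
        add := plus
        neg := neg
        add_assoc := fun a b c => hf.1 (by
          change f (plus (plus a b) c) = f (plus a (plus b c))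
          rw [hadd, hadd, hadd, hadd, mul_assoc])
        zero_add := fun a => hf.1 (by
          change f (plus 0 a) = _
          rw [hadd, f0, one_mul])
        add_zero := fun a => hf.1 (by
          change f (plus a 0) = _
          rw [hadd, f0, mul_one])
        add_comm := fun a b => hf.1 (by
          change f (plus a b) = f (plus b a)
          rw [hadd, hadd, mul_comm])
        neg_add_cancel := fun a => hf.1 (by
          change f (plus (neg a) a) = f 0
          rw [hadd, hneg, inv_mul_cancel, f0])
        left_distrib := hdist
        right_distrib := fun a b c => by
          change plus a b * c = plus (a * c) (b * c)
          rw [mul_comm, hdist, mul_comm c, mul_comm c]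
        nsmul := @nsmulRec _ ⟨0⟩ ⟨plus⟩
        zsmul := @zsmulRec _ ⟨0⟩ ⟨plus⟩ ⟨neg⟩ (@nsmulRec _ ⟨0⟩ ⟨plus⟩)
        nnqsmul := _
        nnqsmul_def := fun _ _ => rfl
        qsmul := _
        qsmul_def := fun _ _ => rfl }
    have := Fintype.ofFinite E
    have := Finite.of_equiv V φ.symm
    have := Fintype.ofFinite (WithZero K)
    have hcard : Fintype.card (WithZero K) = Fintype.card E := by
      rw [← Nat.card_eq_fintype_card, ← Nat.card_eq_fintype_card, hE, Nat.card_congr φ]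
    obtain ⟨ρ⟩ : Nonempty (WithZero K ≃+* E) := ⟨FiniteField.ringEquivOfCardEq hcard⟩
    exact ⟨ρ.toMulEquiv, fun a b => map_add ρ.symm a b⟩
  refine ⟨⟨(Multiplicative.toAdd.trans ρ.symm.toEquiv).trans φ, fun a b => ?_⟩,
    WithZero.unitsWithZeroEquiv.symm.trans (Units.mapEquiv ρ), fun k a => ?_⟩
  · change f (ρ.symm (a.toAdd + b.toAdd)) = f (ρ.symm a.toAdd) * f (ρ.symm b.toAdd)
    rw [hρ, hadd]
  · change α k (f (ρ.symm a)) = f (ρ.symm (ρ (k : WithZero K) * a))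
    rw [map_mul, MulEquiv.symm_apply_apply, hmul]

/-- The field with `61 ^ 2` elements. -/
abbrev F3721 := QuadraticAlgebra (ZMod 61) 2 0

instance fact_prime_sixtyOne : Fact (Nat.Prime 61) := ⟨by norm_num⟩

instance fact_two_nonsquare : Fact (∀ r : ZMod 61, r ^ 2 ≠ 2 + 0 * r) := ⟨by decide +kernel⟩

lemma card_F3721 : Nat.card F3721 = 3721 := by
  rw [Nat.card_congr (QuadraticAlgebra.equivProd _ _), Nat.card_prod, Nat.card_zmod]

instance finite_F3721 : Finite F3721 := Nat.finite_of_card_ne_zero (by rw [card_F3721]; norm_num)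

namespace Config
variable {G Ω : Type*} [Group G] [MulAction G Ω] {o z : Ω} {P U R : Subgroup G}
  {k p q u x y g l : G} {ω : Ω}

lemma le_fixMod_mul' (hC : Config o z P U R) (hx : x ∈ stab₂ G o z)
    (hxi : P ≤ hC.fixMod x) (hyi : P ≤ hC.fixMod y) : P ≤ hC.fixMod (x * y) := by
  refine fun p hp => ⟨hp, ?_⟩
  have h3 : p⁻¹ * (x * y * p * (x * y)⁻¹) =
      p⁻¹ * (x * p * x⁻¹) * (x * (p⁻¹ * (y * p * y⁻¹)) * x⁻¹) := by group
  rw [h3]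
  exact U.mul_mem (hxi hp).2 (hC.conj_U hx (hyi hp).2)

lemma le_fixMod_pow (hC : Config o z P U R) (hx : x ∈ stab₂ G o z) (h : P ≤ hC.fixMod x) (n : ℕ) :
    P ≤ hC.fixMod (x ^ n) := by
  induction n with
  | zero => exact fun p hp => ⟨hp, by simp⟩
  | succ n ih =>
    rw [pow_succ']
    exact hC.le_fixMod_mul' hx h ih

variable [Finite G]

lemma inverts_U (hC : Config o z P U R) (hx : x ∈ stab₂ G o z) (hx2 : x * x = 1)
    (h : x ∉ 𝐂(U)) (hu : u ∈ U) : x * u * x⁻¹ = u⁻¹ := by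
  have h1 := hC.conj_U hx hu
  have hx' : x⁻¹ = x := inv_eq_of_mul_eq_one_left hx2
  refine eq_inv_of_mul_eq_one_right ?_
  have h2 : u * (x * u * x⁻¹) ∈ U ⊓ centralizer {x} := by
    refine ⟨U.mul_mem hu h1, mem_centralizer_singleton_iff.2 ?_⟩
    have h4 : x * (u * (x * u * x⁻¹)) * x⁻¹ = u * (x * u * x⁻¹) := by
      rw [(hC.U_commute hu h1).eq]
      calc _ = x * x * u * x⁻¹ * u * x⁻¹ := by group
        _ = _ := by rw [hx2, one_mul, ← (hC.U_commute hu h1).eq, hx']; group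
    exact (conj_eq_iff_commute.1 h4).eq.symm
  rwa [hC.inf_centralizer_eq_bot h, mem_bot] at h2

lemma not_le_fixMod_of_prime (hC : Config o z P U R) (hx : x ∈ stab₂ G o z)
    (hx' : (orderOf x).Prime) : ¬ P ≤ hC.fixMod x := fun h => by
  have hx1 : x ≠ 1 := by
    rintro rfl
    rw [orderOf_one] at hx'
    exact Nat.not_prime_one hx'
  have hcard := hC.card_inf_centralizer hx hx1 h
  have hd : orderOf x ∣ 2 ^ 3 * 3 * 5 * 31 := hC.orderOf_dvd hx
  have h2 : orderOf x = 2 ∨ orderOf x ∈ [3, 5] ∨ orderOf x = 31 := by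
    rw [hx'.dvd_mul, hx'.dvd_mul, hx'.dvd_mul] at hd
    rcases hd with ((hd | hd) | hd) | hd
    · exact Or.inl ((Nat.prime_dvd_prime_iff_eq hx' Nat.prime_two).1 (hx'.dvd_of_dvd_pow hd))
    · simp [(Nat.prime_dvd_prime_iff_eq hx' (by norm_num)).1 hd]
    · simp [(Nat.prime_dvd_prime_iff_eq hx' (by norm_num)).1 hd]
    · simp [(Nat.prime_dvd_prime_iff_eq hx' (by norm_num)).1 hd]
  rcases h2 with h2 | h2 | h2
  · obtain ⟨t, ht, hto, htz⟩ := hC.exists_swap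
    have hx2 : x * x = 1 := by rw [← pow_two, ← h2, pow_orderOf_eq_one]
    have hto' : t⁻¹ • o = z := by rw [inv_smul_eq_iff, htz]
    have htz' : t⁻¹ • z = o := by rw [inv_smul_eq_iff, hto]
    set y := t * x * t⁻¹ with hy
    have hyK : y ∈ stab₂ G o z := by
      constructor
      · change y • o = o
        rw [hy, mul_smul, mul_smul, hto', hx.2, htz]
      · change y • z = z
        rw [hy, mul_smul, mul_smul, htz', hx.1, hto]
    have hy2 : y * y = 1 := by
      calc _ = t * (x * x) * t⁻¹ := by rw [hy]; group
        _ = 1 := by rw [hx2]; group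
    have hxU : x ∉ 𝐂(U) := fun hxU => hx1 (hC.eq_one_of_fixMod hx hxU h)
    have hyU : y ∉ 𝐂(U) := fun hyU => hxU <| by
      have h3 := (hC.conj_mem_stab_inf (inv_mem ht) ⟨hyK, hyU⟩).2
      rwa [hy, inv_inv, show t⁻¹ * (t * x * t⁻¹) * t = x by group] at h3
    have hfix : P ≤ hC.fixMod y := by
      refine ((hC.fixMod_eq hyK (hC.stab_le_centralizer hyK)).resolve_left fun hyf => ?_).ge
      obtain ⟨p, hp, hp61⟩ := exists_mem_orderOf (p := 61) (by norm_num)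
        (H := P ⊓ centralizer {x}) (by rw [hcard]; norm_num)
      have hp1 : p ≠ 1 := by
        rintro rfl
        simp at hp61
      have h3 : x • p • z = p • z := by
        rw [smul_smul_z hx.2, ← mem_centralizer_singleton_iff.1 hp.2, mul_inv_cancel_right]
      have h4 : y • t • p • z = t • p • z := by
        rw [hy, mul_smul, mul_smul, inv_smul_smul, h3]
      have h5 : t • p • z ≠ o := fun h5 => by
        rw [smul_eq_iff_eq_inv_smul, hto'] at h5
        exact hp1 (hC.smul_z_inj hp.1 P.one_mem (by rw [h5, one_smul]))
      obtain ⟨q, hq, hqz⟩ := hC.exists_smul_z h5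
      rw [← hqz, smul_smul_z hyK.2] at h4
      have h6 := hC.smul_z_inj (hC.conj_P hyK.1 hq) hq h4
      have h7 : q ∈ U := hyf ▸ ⟨hq, by rw [h6, inv_mul_cancel]; exact U.one_mem⟩
      have h8 : q = 1 := by
        have h9 : q ∈ U ⊓ centralizer {y} := ⟨h7, mem_centralizer_singleton_iff.2
          (conj_eq_iff_commute.1 h6).eq.symm⟩
        rwa [hC.inf_centralizer_eq_bot hyU, mem_bot] at h9
      rw [h8, one_smul, eq_comm, smul_eq_iff_eq_inv_smul, htz'] at hqz
      exact hC.smul_z_ne hp.1 hqz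
    have hw : y * x = 1 := by
      refine hC.eq_one_of_fixMod (mul_mem hyK hx) (mem_centralizer_iff.2 fun u hu => ?_)
        (hC.le_fixMod_mul' hyK hfix h)
      have h3 : y * x * u * (y * x)⁻¹ = u := by
        calc _ = y * (x * u * x⁻¹) * y⁻¹ := by group
          _ = u := by
            rw [hC.inverts_U hx hx2 hxU hu, hC.inverts_U hyK hy2 hyU (U.inv_mem hu), inv_inv]
      exact (conj_eq_iff_commute.1 h3).eq.symm
    rw [mul_eq_one_iff_eq_inv, inv_eq_of_mul_eq_one_left hx2] at hw
    exact hC.card_ne_of_commute hx (conj_eq_iff_commute.1 hw) hto hcard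
  · obtain ⟨p, hp, hp61⟩ := exists_mem_orderOf (p := 61) (by norm_num)
      (H := P ⊓ centralizer {x}) (by rw [hcard]; norm_num)
    exact hC.not_commute h2 hp61 (mem_centralizer_singleton_iff.1 hp.2).symm
  · have h31 : Nat.Prime 31 := by norm_num
    have h3 : IsSylowIn 31 R (stab₂ G o z) := isSylowIn_of_card h31 (k := 1) (r := 120) hC.R_le
      (by rw [hC.card_R, pow_one]) (by rw [hC.card_K]; norm_num) (by norm_num)
    have hc : Nat.card (zpowers x) = 31 := by rw [Nat.card_zpowers, h2]
    have h4 := h3.le_of_normal h31 (fun k hk => hC.K_le k hk.1 hk.2)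
      (IsPGroup.of_card (n := 1) (by rw [hc, pow_one])) ((zpowers_le).2 hx)
    have h5 := eq_of_le_of_card_eq h4 (by rw [hc, hC.card_R])
    have h6 : P ⊓ centralizer {x} ≤ P ⊓ 𝐂(R) := inf_le_inf_left _ fun p hp => by
      rw [← h5]
      refine mem_centralizer_iff.2 ?_
      rintro _ ⟨n, rfl⟩
      exact ((show Commute x p from (mem_centralizer_singleton_iff.1 hp).symm).zpow_left n).eq
    have h7 := card_dvd_of_le h6
    rw [hcard, hC.P_inf, hC.card_U] at h7
    norm_num at h7

/-- The two-point stabilizer acts freely on the nontrivial elements of `P / U`. -/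
lemma eq_one_of_mem_fixMod (hC : Config o z P U R) (hk : k ∈ stab₂ G o z) (hp : p ∈ hC.fixMod k)
    (hpU : p ∉ U) : k = 1 := by
  have h := (hC.fixMod_eq hk (hC.stab_le_centralizer hk)).resolve_left fun h => hpU (h ▸ hp)
  by_contra hk1
  obtain ⟨q, hq, n, hn⟩ := Nat.exists_prime_and_dvd (mt orderOf_eq_one_iff.1 hk1)
  refine hC.not_le_fixMod_of_prime (x := k ^ n) (pow_mem hk n) ?_ (hC.le_fixMod_pow hk h.ge n)
  have hn0 : n ≠ 0 := by
    rintro rfl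
    exact (orderOf_pos k).ne' hn
  rw [orderOf_pow_of_dvd hn0 (hn ▸ Dvd.intro_left _ rfl), hn,
    Nat.mul_div_cancel _ (Nat.pos_of_ne_zero hn0)]
  exact hq

end Config

namespace Config
variable {G Ω : Type*} [Group G] [MulAction G Ω] {o z : Ω} {P U R : Subgroup G}
  {k p q u x y g l : G} {ω : Ω} [Finite G]

/-- The quotient `P / U` is a one-dimensional vector space over the field with `61 ^ 2` elements,
on which the two-point stabilizer acts as the multiplicative group. -/
lemma exists_field (hC : Config o z P U R) : ∃ (c : G → F3721) (χ : stab₂ G o z ≃* F3721ˣ),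
    (∀ p ∈ P, ∀ q ∈ P, c (p * q) = c p + c q) ∧ (∀ p ∈ P, c p = 0 ↔ p ∈ U) ∧
    (∀ a, ∃ p ∈ P, c p = a) ∧
    ∀ (k : stab₂ G o z), ∀ p ∈ P, c (k * p * (k : G)⁻¹) = χ k * c p := by
  set N := U.subgroupOf P with hN
  have hn : N.Normal := ⟨fun n hn g => by
    rw [hN, mem_subgroupOf] at hn ⊢
    have h := (hC.commute_U g.2 hn).eq
    rw [coe_mul, coe_mul, h, coe_inv, mul_inv_cancel_right]
    exact hn⟩
  let : CommGroup (P ⧸ N) :=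
    { (inferInstance : Group (P ⧸ N)) with
      mul_comm := fun a b => by
        induction a using QuotientGroup.induction_on with | _ a
        induction b using QuotientGroup.induction_on with | _ b
        rw [← QuotientGroup.mk_mul, ← QuotientGroup.mk_mul, QuotientGroup.eq, hN, mem_subgroupOf]
        have h := hC.commutator_mem (P.inv_mem b.2) (P.inv_mem a.2)
        convert h using 1
        push_cast
        group }
  let : CommGroup (stab₂ G o z) :=
    { (inferInstance : Group (stab₂ G o z)) with
      mul_comm := fun a b => Subtype.ext (hC.stab_commute a.2 b.2).eq }
  have hP : stab₂ G o z ≤ 𝐍(P) := fun k hk => (hC.smul_o k).1 hk.1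
  let φ : stab₂ G o z →* MulAut P := P.normalizerMonoidHom.comp (inclusion hP)
  have hφ : ∀ k p, ((φ k p : P) : G) = k * p * (k : G)⁻¹ := fun _ _ => rfl
  have hφN : ∀ k, N.map (φ k : P →* P) = N := fun k => by
    have h1 : ∀ k, N.map (φ k : P →* P) ≤ N := fun k => by
      rintro _ ⟨n, hn, rfl⟩
      exact hC.conj_U k.2 hn
    refine le_antisymm (h1 k) fun n hn => ⟨φ k⁻¹ n, h1 k⁻¹ ⟨n, hn, rfl⟩, ?_⟩
    change φ k (φ k⁻¹ n) = n
    rw [← MulAut.mul_apply, ← map_mul, mul_inv_cancel, map_one, MulAut.one_apply]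
  let α : stab₂ G o z →* MulAut (P ⧸ N) :=
    { toFun := fun k => QuotientGroup.congr N N (φ k) (hφN k)
      map_one' := by
        ext v
        induction v using QuotientGroup.induction_on with | _ v
        rw [QuotientGroup.congr_mk, map_one]
        rfl
      map_mul' := fun a b => by
        ext v
        induction v using QuotientGroup.induction_on with | _ v
        rw [QuotientGroup.congr_mk, map_mul]
        rfl }
  have hα : ∀ k p, α k (QuotientGroup.mk p) = QuotientGroup.mk (φ k p) := fun _ _ => rfl
  have hcard : Nat.card (P ⧸ N) = 3721 := by
    have h := card_eq_card_quotient_mul_card_subgroup N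
    rw [hN, card_subgroupOf_of_le hC.U_le, hC.card_P, hC.card_U] at h
    rw [hN]
    omega
  obtain ⟨e, χ, he⟩ := exists_field_mulEquiv (E := F3721) α (by rw [card_F3721, hcard])
    (by rw [hC.card_K, hcard]) (fun k v => by
      induction v using QuotientGroup.induction_on with | _ v
      intro hv h
      refine Subtype.ext (hC.eq_one_of_mem_fixMod (p := v) k.2 ⟨v.2, ?_⟩ fun h' => hv ?_)
      · rw [hα, eq_comm, QuotientGroup.eq] at h
        exact h
      · rw [QuotientGroup.eq_one_iff]
        exact h')
  classical
  let c : G → F3721 := fun g => if h : g ∈ P then (e.symm (QuotientGroup.mk ⟨g, h⟩)).toAdd else 0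
  have hc : ∀ p : P, c p = (e.symm (QuotientGroup.mk p)).toAdd := fun p => dif_pos p.2
  refine ⟨c, χ, fun p hp q hq => ?_, fun p hp => ?_, fun a => ?_, fun k p hp => ?_⟩
  · rw [hc ⟨p, hp⟩, hc ⟨q, hq⟩, ← toAdd_mul, ← map_mul]
    exact hc ⟨p * q, P.mul_mem hp hq⟩
  · rw [hc ⟨p, hp⟩, toAdd_eq_zero, map_eq_one_iff _ e.symm.injective, QuotientGroup.eq_one_iff]
    rfl
  · obtain ⟨p, hp⟩ := QuotientGroup.mk_surjective (e (.ofAdd a))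
    exact ⟨p, p.2, by rw [hc, hp, MulEquiv.symm_apply_apply, toAdd_ofAdd]⟩
  · have h1 := he k (c p)
    rw [hc ⟨p, hp⟩, ofAdd_toAdd, MulEquiv.apply_symm_apply, hα] at h1
    rw [hc ⟨p, hp⟩, ← hφ k ⟨p, hp⟩, hc, h1, MulEquiv.symm_apply_apply, toAdd_ofAdd]

/-- A parametrization of `U` by the prime field. -/
lemma exists_param (hC : Config o z P U R) : ∃ v : ZMod 61 → G, (∀ a, v a ∈ U) ∧
    (∀ a b, v (a + b) = v a * v b) ∧ Function.Injective v ∧ ∀ u ∈ U, ∃ a, v a = u := by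
  have hU : IsCyclic U := isCyclic_of_prime_card hC.card_U
  have e := zmodCyclicMulEquiv hU
  rw [hC.card_U] at e
  refine ⟨fun a => e (.ofAdd a), fun a => (e _).2, fun a b => ?_, fun a b h => ?_, fun u hu => ?_⟩
  · beta_reduce
    rw [ofAdd_add, map_mul, coe_mul]
  · exact Multiplicative.ofAdd.injective (e.injective (Subtype.ext h))
  · exact ⟨(e.symm ⟨u, hu⟩).toAdd, by beta_reduce; rw [ofAdd_toAdd, MulEquiv.apply_symm_apply]⟩

end Config

lemma ZMod.map_eq_mul_of_add {n : ℕ} (f : ZMod n → ZMod n) (hf : ∀ a b, f (a + b) = f a + f b)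
    (a : ZMod n) : f a = a * f 1 := by
  have h := ZMod.map_smul (AddMonoidHom.mk' f hf) a 1
  rwa [smul_eq_mul, smul_eq_mul, mul_one] at h

/-- An alternating form on the field with `61 ^ 2` elements is a multiple of the determinant. -/
lemma exists_eq_mul_det (F : F3721 → F3721 → ZMod 61) (hF : ∀ a b, F b a = -F a b)
    (hadd : ∀ a b b', F a (b + b') = F a b + F a b') :
    ∃ t, ∀ a b, F a b = t * (a.re * b.im - a.im * b.re) := by
  have h1 : ∀ a b, F a b = b.re * F a ⟨1, 0⟩ + b.im * F a ⟨0, 1⟩ := fun a b => by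
    have hb : b = ⟨b.re, 0⟩ + ⟨0, b.im⟩ := by ext <;> simp
    have h2 := ZMod.map_eq_mul_of_add (fun r => F a ⟨r, 0⟩) (fun r s => by
      rw [← hadd]; congr 1) b.re
    have h3 := ZMod.map_eq_mul_of_add (fun r => F a ⟨0, r⟩) (fun r s => by
      rw [← hadd]; congr 1) b.im
    rw [← h2, ← h3, ← hadd, ← hb]
  have h0 : ∀ a, F a a = 0 := fun a => by
    have h : ∀ c : ZMod 61, c = -c → c = 0 := by decide
    exact h _ (hF a a)
  refine ⟨F ⟨1, 0⟩ ⟨0, 1⟩, fun a b => ?_⟩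
  rw [h1 a b, hF ⟨1, 0⟩ a, hF ⟨0, 1⟩ a, h1 _ a, h1 _ a, h0, h0, hF ⟨1, 0⟩ ⟨0, 1⟩]
  ring

/-- Coordinates for a group acting on a set `Ω` with two base points `o` and `z`, such that the
stabilizer of `o` has a normal Heisenberg subgroup acting regularly on the other points, and the
stabilizer of both points is the multiplicative group of the field with `61 ^ 2` elements. -/
structure Coord (G Ω : Type*) [Group G] [MulAction G Ω] (o z : Ω) where
  /-- representatives of the Heisenberg group modulo its center -/
  d : F3721 → G
  /-- the center of the Heisenberg group -/
  u : ZMod 61 → G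
  /-- the two-point stabilizer -/
  κ : F3721ˣ →* G
  /-- the action of the two-point stabilizer on the center -/
  ψ : F3721ˣ →* (ZMod 61)ˣ
  /-- the coefficient of the commutator form -/
  θ : ZMod 61
  u_add : ∀ b c, u (b + c) = u b * u c
  d_mul : ∀ a b, d a * d b = d (a + b) * u (θ * (a.re * b.im - a.im * b.re))
  u_d : ∀ c a, u c * d a = d a * u c
  κ_d : ∀ k a, κ k * d a = d (k * a) * κ k
  κ_u : ∀ k c, κ k * u c = u (ψ k * c) * κ k
  ψ_surj : Function.Surjective ψ
  ψ_neg_one : ψ (-1) = 1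
  d_o : ∀ a, d a • o = o
  u_o : ∀ c, u c • o = o
  κ_o : ∀ k, κ k • o = o
  κ_z : ∀ k, κ k • z = z
  z_ne : z ≠ o
  exists_smul_z : ∀ ω, ω ≠ o → ∃ a c, (d a * u c) • z = ω
  smul_z_inj : ∀ a c a' c', (d a * u c) • z = (d a' * u c') • z → a = a' ∧ c = c'
  exists_κ : ∀ g : G, g • o = o → g • z = z → ∃ k, κ k = g
  faithful : ∀ g : G, (∀ ω : Ω, g • ω = ω) → g = 1
  exists_swap : ∃ t : G, t • o = z ∧ t • z = o ∧ ∀ k, ψ k = 1 → Commute t (κ k)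
  exists_conj : ∃ g : G, g • o ≠ o ∧ (∀ c, g • o ≠ u c • z) ∧
    ∀ k l, ψ k = 1 → ψ l = 1 → Commute (g * κ k * g⁻¹) (κ l)

namespace Config
variable {G Ω : Type*} [Group G] [MulAction G Ω] {o z : Ω} {P U R : Subgroup G}
  {k p q u x y g l : G} {ω : Ω} [Finite G]

/-- The map `d` of `Coord`. -/
lemma exists_section (hC : Config o z P U R) {i : G} (hiU : i ∈ 𝐂(U))
    (hiP : ∀ p ∈ P, p * (i * p * i⁻¹) ∈ U) {c : G → F3721}
    (hc : ∀ p ∈ P, ∀ q ∈ P, c (p * q) = c p + c q) (hc0 : ∀ p ∈ P, c p = 0 ↔ p ∈ U)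
    (hcs : ∀ a, ∃ p ∈ P, c p = a) :
    ∃ d : F3721 → G, ∀ a g, g = d a ↔ g ∈ P ∧ c g = a ∧ i * g * i⁻¹ = g⁻¹ := by
  have key : ∀ a, ∃ d, ∀ g, g = d ↔ g ∈ P ∧ c g = a ∧ i * g * i⁻¹ = g⁻¹ := fun a => by
    have hiU' : ∀ u ∈ U, i * u * i⁻¹ = u := fun u hu =>
      conj_eq_iff_commute.2 (commute_of_mem_centralizer hiU hu)
    obtain ⟨p, hp, rfl⟩ := hcs a
    set w := p * (i * p * i⁻¹) with hw
    have hwU : w ∈ U := hiP p hp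
    have hpw : i * p * i⁻¹ = p⁻¹ * w := by rw [hw, inv_mul_cancel_left]
    have hmem := U.pow_mem hwU 30
    have hc1 : ∀ u ∈ U, c (p * u) = c p := fun u hu => by
      rw [hc p hp u (hC.U_le hu), (hc0 u (hC.U_le hu)).2 hu, add_zero]
    have hinv : ∀ u ∈ U, i * (p * u) * i⁻¹ = (p * u)⁻¹ ↔ w * (u * u) = 1 := fun u hu => by
      have h1 : i * (p * u) * i⁻¹ = p⁻¹ * w * u := by
        rw [← hpw]
        conv_rhs => rw [← hiU' u hu]
        group
      have h2 : (p * u)⁻¹ = p⁻¹ * u⁻¹ := by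
        rw [← mul_inv_rev, (hC.commute_U hp hu).eq]
      rw [h1, h2, mul_assoc, mul_right_inj, eq_inv_iff_mul_eq_one, mul_assoc]
    have h30 : w * (w ^ 30 * w ^ 30) = 1 := by
      rw [← pow_add, ← pow_succ']
      exact hC.pow_U hwU
    refine ⟨p * w ^ 30, fun g => ⟨?_, ?_⟩⟩
    · rintro rfl
      exact ⟨P.mul_mem hp (hC.U_le hmem), hc1 _ hmem, (hinv _ hmem).2 h30⟩
    · rintro ⟨hg, hgc, hgi⟩
      obtain ⟨v, rfl⟩ : ∃ v, g = p * v := ⟨p⁻¹ * g, by rw [mul_inv_cancel_left]⟩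
      have hvP : v ∈ P := (P.mul_mem_cancel_left hp).1 hg
      have hvU : v ∈ U := by
        rw [hc p hp v hvP, add_eq_left] at hgc
        exact (hc0 v hvP).1 hgc
      have h1 := (hinv v hvU).1 hgi
      have h2 : (v * (w ^ 30)⁻¹) ^ 2 = 1 := by
        have h3 := mul_left_cancel (h1.trans h30.symm)
        rw [((hC.U_commute hvU hmem).inv_right).mul_pow, pow_two, h3, inv_pow, ← pow_two,
          mul_inv_cancel]
      have h4 := hC.eq_one_of_pow (n := 2) (by norm_num) (U.mul_mem hvU (U.inv_mem hmem)) h2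
      rw [mul_inv_eq_one.1 h4]
  choose d hd using key
  exact ⟨d, hd⟩

lemma exists_character (hC : Config o z P U R) (χ : stab₂ G o z ≃* F3721ˣ) {v : ZMod 61 → G}
    (hvU : ∀ a, v a ∈ U) (hv : ∀ a b, v (a + b) = v a * v b) (hvi : Function.Injective v)
    (hvs : ∀ u ∈ U, ∃ a, v a = u) : ∃ ψ : F3721ˣ →* (ZMod 61)ˣ, Function.Surjective ψ ∧
      (∀ k a, (χ.symm k : G) * v a * (χ.symm k : G)⁻¹ = v (ψ k * a)) ∧
      ∀ k, ψ k = 1 ↔ (χ.symm k : G) ∈ stab₂ G o z ⊓ 𝐂(U) := by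
  have key : ∀ k a, ∃ b, v b = (χ.symm k : G) * v a * (χ.symm k : G)⁻¹ := fun k a =>
    hvs _ (hC.conj_U (χ.symm k).2 (hvU a))
  choose f hf using key
  have hadd : ∀ k a b, f k (a + b) = f k a + f k b := fun k a b => hvi <| by
    rw [hf, hv, hv, hf, hf]
    group
  have hmul : ∀ k a, f k a = f k 1 * a := fun k a => by
    rw [ZMod.map_eq_mul_of_add (f k) (hadd k), mul_comm]
  let ψ' : F3721ˣ →* ZMod 61 :=
    { toFun := fun k => f k 1
      map_one' := hvi <| by rw [hf, map_one, coe_one, one_mul, inv_one, mul_one]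
      map_mul' := fun k l => hvi <| by
        rw [← hmul k, hf, hf, hf, map_mul, coe_mul]
        group }
  let ψ := ψ'.toHomUnits
  have hψ : ∀ k, (ψ k : ZMod 61) = f k 1 := fun _ => rfl
  have hker : ∀ k, ψ k = 1 ↔ (χ.symm k : G) ∈ stab₂ G o z ⊓ 𝐂(U) := fun k => by
    rw [Units.ext_iff, hψ, Units.val_one]
    refine ⟨fun h => ⟨(χ.symm k).2, mem_centralizer_iff.2 fun u hu => ?_⟩, fun h => hvi ?_⟩
    · obtain ⟨a, rfl⟩ := hvs u hu
      have h1 := hf k a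
      rw [hmul, h, one_mul] at h1
      exact (conj_eq_iff_commute.1 h1.symm).eq.symm
    · rw [hf, (commute_of_mem_centralizer h.2 (hvU 1)).eq, mul_inv_cancel_right]
  refine ⟨ψ, ?_, fun k a => by rw [hψ, ← hmul, hf], hker⟩
  have h1 : (ψ.comp χ.toMonoidHom).ker = (stab₂ G o z ⊓ 𝐂(U)).subgroupOf (stab₂ G o z) := by
    ext k
    rw [MonoidHom.mem_ker, mem_subgroupOf, MonoidHom.comp_apply]
    have h := hker (χ k)
    rwa [MulEquiv.symm_apply_apply] at h
  have h2 := card_mul_index (ψ.comp χ.toMonoidHom).ker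
  rw [index_ker, h1, card_subgroupOf_of_le inf_le_left, hC.stab_le_centralizer_and_card.2,
    hC.card_K] at h2
  have h3 : (ψ.comp χ.toMonoidHom).range = ⊤ := by
    refine eq_top_of_card_eq _ ?_
    rw [Nat.card_eq_fintype_card (α := (ZMod 61)ˣ), ZMod.card_units]
    omega
  have h4 := MonoidHom.range_eq_top.1 h3
  rw [MonoidHom.coe_comp] at h4
  exact h4.of_comp

lemma nonempty_coord (hC : Config o z P U R) : Nonempty (Coord G Ω o z) := by
  obtain ⟨i, hi, hi2, hi1, hiL, hiP, hfix⟩ := hC.exists_involution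
  obtain ⟨c, χ, hc, hc0, hcs, hck⟩ := hC.exists_field
  obtain ⟨v, hvU, hv, hvi, hvs⟩ := hC.exists_param
  obtain ⟨d, hd⟩ := hC.exists_section hi.2 hiP hc hc0 hcs
  obtain ⟨ψ, hψs, hψ, hψ1⟩ := hC.exists_character χ hvU hv hvi hvs
  have hdP : ∀ a, d a ∈ P := fun a => ((hd a _).1 rfl).1
  have hdc : ∀ a, c (d a) = a := fun a => ((hd a _).1 rfl).2.1
  have hdi : ∀ a, i * d a * i⁻¹ = (d a)⁻¹ := fun a => ((hd a _).1 rfl).2.2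
  have hvP : ∀ a, v a ∈ P := fun a => hC.U_le (hvU a)
  have hvd : ∀ a b, Commute (d a) (v b) := fun a b => hC.commute_U (hdP a) (hvU b)
  have hv0 : v 0 = 1 := by
    have h := hv 0 0
    rwa [add_zero, eq_comm, mul_eq_left] at h
  have hvn : ∀ a, v (-a) = (v a)⁻¹ := fun a => by
    rw [eq_inv_iff_mul_eq_one, ← hv, neg_add_cancel, hv0]
  have hvi' : ∀ a, i * v a * i⁻¹ = v a := fun a =>
    conj_eq_iff_commute.2 (commute_of_mem_centralizer hi.2 (hvU a))
  have hdv : ∀ p ∈ P, ∃ b, p = d (c p) * v b := fun p hp => by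
    have hn := P.inv_mem (hdP (c p))
    have h := hc _ (hdP (c p)) ((d (c p))⁻¹ * p) (P.mul_mem hn hp)
    rw [mul_inv_cancel_left, hdc, eq_comm, add_eq_left, hc0 _ (P.mul_mem hn hp)] at h
    obtain ⟨b, hb⟩ := hvs _ h
    exact ⟨b, by rw [hb, mul_inv_cancel_left]⟩
  have hcv : ∀ a b, c (d a * v b) = a := fun a b => by
    rw [hc _ (hdP a) _ (hvP b), hdc, (hc0 _ (hvP b)).2 (hvU b), add_zero]
  have hF : ∀ a b, ∃ e, d a * d b = d (a + b) * v e := fun a b => by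
    obtain ⟨e, he⟩ := hdv _ (P.mul_mem (hdP a) (hdP b))
    rw [hc _ (hdP a) _ (hdP b), hdc, hdc] at he
    exact ⟨e, he⟩
  choose F hF using hF
  have hanti : ∀ a b, F b a = -F a b := fun a b => by
    have h1 : (d a)⁻¹ * (d b)⁻¹ = (d (a + b))⁻¹ * v (F a b) := by
      rw [← hdi, ← hdi, ← hdi, ← hvi' (F a b)]
      calc _ = i * (d a * d b) * i⁻¹ := by group
        _ = _ := by rw [hF]; group
    rw [← mul_inv_rev, hF, inv_eq_iff_eq_inv, mul_inv_rev, inv_inv, ← hvn, add_comm b a,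
      ← (hvd _ _).eq, mul_right_inj] at h1
    exact hvi h1
  have hswap : ∀ a b, d a * d b = d b * d a * v (2 * F a b) := fun a b => by
    rw [hF b a, hF a b, hanti a b, add_comm b a, mul_assoc, ← hv]
    congr 2
    ring
  have hadd : ∀ a b b', F a (b + b') = F a b + F a b' := fun a b b' => by
    have h1 : d a * (d b * d b') = d b * d b' * d a * v (2 * (F a b + F a b')) := by
      rw [mul_add, hv, ← mul_assoc, hswap a b, mul_assoc (d b * d a), ← (hvd b' _).eq,
        mul_assoc (d b), ← mul_assoc (d a), hswap a b', mul_assoc (d b' * d a), ← hv, ← hv,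
        add_comm (2 * F a b')]
      simp only [mul_assoc]
    rw [hF b b', (hvd _ _).eq, ← mul_assoc, (hvd _ _).eq, mul_assoc, mul_assoc, mul_assoc,
      mul_right_inj, hswap, mul_assoc, mul_right_inj, mul_right_inj] at h1
    have h2 := hvi h1
    exact mul_left_cancel₀ (by decide) h2
  obtain ⟨θ, hθ⟩ := exists_eq_mul_det F hanti hadd
  have hχi : χ ⟨i, hi.1⟩ = -1 := by
    have h1 := hck ⟨i, hi.1⟩ (d 1) (hdP 1)
    have h2 := hc _ (hdP 1) _ (P.inv_mem (hdP 1))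
    rw [mul_inv_cancel, (hc0 1 P.one_mem).2 U.one_mem, hdc] at h2
    rw [hdi, hdc, mul_one, eq_neg_of_add_eq_zero_right h2.symm] at h1
    exact Units.ext h1.symm
  obtain ⟨t, ht, hto, htz⟩ := hC.exists_swap
  obtain ⟨g, hg, hgR⟩ := hC.exists_conj
  have hRg : R ≤ 𝐂(MulAut.conj g • R) := le_centralizer_comm.1 hgR
  have hW1 : ∀ w ∈ stab₂ G o z ⊓ 𝐂(U), g * w * g⁻¹ ∈ 𝐍(R) := fun w hw => by
    refine centralizer_le_normalizer _ (mem_centralizer_iff.2 fun r hr => ?_)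
    have h2 := (centralizer_le_normalizer _) (hRg hr)
    rw [normalizer_conj_smul, mem_conj_smul] at h2
    have h3 := (hC.commute_of_mem_normalizer hw h2).eq
    calc r * (g * w * g⁻¹) = g * (g⁻¹ * r * g * w) * g⁻¹ := by group
      _ = _ := by rw [h3]; group
  have hgo : ¬ ∀ r ∈ R, r • g • o = g • o := fun h => by
    refine hC.not_fixed (by rw [card_conj_smul, hC.card_R]) hg hgR h fun s hs => ?_
    rw [mem_conj_smul] at hs
    rw [← inv_smul_eq_iff, ← mul_smul, ← mul_smul]
    exact hC.R_o _ hs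
  have hκ : ∀ k, (χ.symm k : G) ∈ stab₂ G o z := fun k => (χ.symm k).2
  exact ⟨{
    d := d
    u := v
    κ := (stab₂ G o z).subtype.comp χ.symm.toMonoidHom
    ψ := ψ
    θ := θ
    u_add := hv
    d_mul := fun a b => by rw [← hθ, hF]
    u_d := fun a b => (hvd b a).eq.symm
    κ_d := fun k a => by
      refine mul_inv_eq_iff_eq_mul.1 ((hd _ _).2 ⟨hC.conj_P (hκ k).1 (hdP a), ?_, ?_⟩)
      · have h := hck (χ.symm k) (d a) (hdP a)
        rwa [MulEquiv.apply_symm_apply, hdc] at h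
      · have h := (hC.stab_commute hi.1 (hκ k)).eq
        have h' := (hC.stab_commute hi.1 (inv_mem (hκ k))).inv_left.eq
        change i * (χ.symm k * d a * (χ.symm k : G)⁻¹) * i⁻¹ =
          (χ.symm k * d a * (χ.symm k : G)⁻¹)⁻¹
        calc _ = i * χ.symm k * d a * ((χ.symm k : G)⁻¹ * i⁻¹) := by group
          _ = χ.symm k * (i * d a * i⁻¹) * (χ.symm k : G)⁻¹ := by rw [h, ← h']; group
          _ = _ := by rw [hdi]; group
    κ_u := fun k a => mul_inv_eq_iff_eq_mul.1 (hψ k a)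
    ψ_surj := hψs
    ψ_neg_one := by
      rw [hψ1, ← hχi, MulEquiv.symm_apply_apply]
      exact hi
    d_o := fun a => hC.P_o (hdP a)
    u_o := fun a => hC.P_o (hvP a)
    κ_o := fun k => (hκ k).1
    κ_z := fun k => (hκ k).2
    z_ne := hC.z_ne
    exists_smul_z := fun ω hω => by
      obtain ⟨p, hp, rfl⟩ := hC.exists_smul_z hω
      obtain ⟨b, hb⟩ := hdv p hp
      exact ⟨c p, b, by rw [← hb]⟩
    smul_z_inj := fun a b a' b' h => by
      have h1 := hC.smul_z_inj (P.mul_mem (hdP a) (hvP b)) (P.mul_mem (hdP a') (hvP b')) h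
      have h2 := congrArg c h1
      rw [hcv, hcv] at h2
      subst h2
      exact ⟨rfl, hvi (mul_left_cancel h1)⟩
    exists_κ := fun g hgo hgz => ⟨χ ⟨g, hgo, hgz⟩, by
      change ((χ.symm (χ ⟨g, hgo, hgz⟩) : stab₂ G o z) : G) = g
      rw [MulEquiv.symm_apply_apply]⟩
    faithful := hC.faithful
    exists_swap := ⟨t, hto, htz, fun k hk => hC.commute_of_mem_normalizer ((hψ1 k).1 hk) ht⟩
    exists_conj := ⟨g, fun h => hgo (hC.fixed_iff.2 (Or.inl h)),
      fun a h => hgo (hC.fixed_iff.2 (Or.inr ⟨v a, hvU a, h.symm⟩)),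
      fun k l hk hl => hC.commute_of_mem_normalizer ((hψ1 l).1 hl) (hW1 _ ((hψ1 k).1 hk))⟩ }⟩

end Config

namespace Coord
variable {G Ω : Type*} [Group G] [MulAction G Ω] {o z : Ω} (C : Coord G Ω o z) {g h l : G} {ω : Ω}

/-- The point with coordinates `(a, c)`. -/
def pt (a : F3721) (c : ZMod 61) : Ω := (C.d a * C.u c) • z

lemma u_zero : C.u 0 = 1 := by
  have h := C.u_add 0 0
  rwa [add_zero, eq_comm, mul_eq_left] at h

lemma d_zero : C.d 0 = 1 := by
  have h := C.d_mul 0 0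
  rw [add_zero, QuadraticAlgebra.re_zero, zero_mul, mul_zero, sub_zero, mul_zero, u_zero, mul_one,
    mul_eq_left] at h
  exact h

lemma pt_zero_zero : C.pt 0 0 = z := by rw [pt, d_zero, u_zero, one_mul, one_smul]

lemma u_pt (b : ZMod 61) (a c) : C.u b • C.pt a c = C.pt a (b + c) := by
  rw [pt, smul_smul, ← mul_assoc, C.u_d, mul_assoc, ← C.u_add, pt]

lemma d_pt (b a : F3721) (c) :
    C.d b • C.pt a c = C.pt (b + a) (C.θ * (b.re * a.im - b.im * a.re) + c) := by
  rw [pt, smul_smul, ← mul_assoc, C.d_mul, mul_assoc, ← C.u_add, pt]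

lemma κ_pt (k : F3721ˣ) (a c) : C.κ k • C.pt a c = C.pt (k * a) (C.ψ k * c) := by
  rw [pt, smul_smul, ← mul_assoc, C.κ_d, mul_assoc, C.κ_u, ← mul_assoc, mul_smul, C.κ_z, pt]

lemma pt_inj {a c a' c'} (h : C.pt a c = C.pt a' c') : a = a' ∧ c = c' := C.smul_z_inj _ _ _ _ h

lemma pt_ne (a c) : C.pt a c ≠ o := fun h => C.z_ne <| by
  rwa [pt, smul_eq_iff_eq_inv_smul, mul_inv_rev, mul_smul, inv_smul_eq_iff.2 (C.d_o a).symm,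
    inv_smul_eq_iff.2 (C.u_o c).symm] at h

lemma eq_or_exists_pt (ω : Ω) : ω = o ∨ ∃ a c, ω = C.pt a c := by
  refine or_iff_not_imp_left.2 fun h => ?_
  obtain ⟨a, c, h⟩ := C.exists_smul_z ω h
  exact ⟨a, c, h.symm⟩

lemma κ_eq_one {k : F3721ˣ} {a c} (ha : a ≠ 0) (h : C.κ k • C.pt a c = C.pt a c) : k = 1 := by
  rw [κ_pt] at h
  exact Units.ext (mul_right_cancel₀ ha ((C.pt_inj h).1.trans (one_mul a).symm))

lemma κ_injective : Function.Injective C.κ := by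
  refine (injective_iff_map_eq_one _).2 fun k hk => C.κ_eq_one one_ne_zero (c := 0) ?_
  rw [hk, one_smul]

/-- The subgroup of elements commuting with the kernel of `ψ`. -/
def lin : Subgroup G := 𝐂((C.ψ.ker.map C.κ))

lemma mem_lin : g ∈ C.lin ↔ ∀ k, C.ψ k = 1 → Commute g (C.κ k) := by
  refine mem_centralizer_iff.trans ⟨fun h k hk => (h _ ⟨k, hk, rfl⟩).symm, ?_⟩
  rintro h _ ⟨k, hk, rfl⟩
  exact (h k hk).eq.symm

lemma κ_mem_lin (k) : C.κ k ∈ C.lin := C.mem_lin.2 fun l _ => (Commute.all k l).map C.κ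

lemma u_mem_lin (c) : C.u c ∈ C.lin := C.mem_lin.2 fun k hk => by
  have h := C.κ_u k c
  rw [hk, Units.val_one, one_mul] at h
  exact h.symm

/-- The points fixed by the kernel of `ψ`. -/
def IsLin (ω : Ω) : Prop := ω = o ∨ ∃ c, ω = C.pt 0 c

lemma isLin_iff : C.IsLin ω ↔ C.κ (-1) • ω = ω := by
  constructor
  · rintro (rfl | ⟨c, rfl⟩)
    · exact C.κ_o _
    · rw [κ_pt, mul_zero, C.ψ_neg_one, Units.val_one, one_mul]
  · intro h
    refine (C.eq_or_exists_pt ω).imp id ?_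
    rintro ⟨a, c, rfl⟩
    by_cases ha : a = 0
    · exact ⟨c, by rw [ha]⟩
    · exact absurd (C.κ_eq_one ha h) (by decide +kernel)

lemma isLin_smul (hg : g ∈ C.lin) : C.IsLin (g • ω) ↔ C.IsLin ω := by
  rw [isLin_iff, isLin_iff, smul_smul, ← (C.mem_lin.1 hg _ C.ψ_neg_one).eq, mul_smul,
    smul_left_cancel_iff]

lemma isLin_o : C.IsLin o := Or.inl rfl

lemma isLin_pt (c) : C.IsLin (C.pt 0 c) := Or.inr ⟨c, rfl⟩

lemma exists_pt_of_ne (hg : g ∈ C.lin) (hω : C.IsLin ω) (h : g • ω ≠ o) :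
    ∃ c, g • ω = C.pt 0 c := ((C.isLin_smul hg).2 hω).resolve_left h

lemma not_isLin_pt {a c} (ha : a ≠ 0) : ¬ C.IsLin (C.pt a c) := by
  rintro (h | ⟨b, h⟩)
  · exact C.pt_ne _ _ h
  · exact ha (C.pt_inj h).1

lemma exists_swap_lin : ∃ t ∈ C.lin, t • o = z ∧ t • z = o ∧ ∀ s : ZMod 61, s ≠ 0 →
    t • C.pt 0 s = C.pt 0 s⁻¹ := by
  obtain ⟨t, hto, htz, ht⟩ : ∃ t : G, t • o = z ∧ t • z = o ∧ t ∈ C.lin := by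
    obtain ⟨t, h1, h2, h3⟩ := C.exists_swap
    exact ⟨t, h1, h2, C.mem_lin.2 h3⟩
  obtain ⟨t, hto, htz, ht, ht1⟩ : ∃ t : G, t • o = z ∧ t • z = o ∧ t ∈ C.lin ∧
      t • C.pt 0 1 = C.pt 0 1 := by
    obtain ⟨c, hc⟩ := C.exists_pt_of_ne ht (C.isLin_pt 1) fun h => by
      have h' := (smul_left_cancel t (h.trans htz.symm)).trans C.pt_zero_zero.symm
      exact absurd (C.pt_inj h').2 (by decide)
    have hc0 : c ≠ 0 := by
      rintro rfl
      exact C.pt_ne _ _ (smul_left_cancel t ((hc.trans C.pt_zero_zero).trans hto.symm))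
    obtain ⟨k, hk⟩ := C.ψ_surj (Units.mk0 c hc0)⁻¹
    refine ⟨C.κ k * t, ?_, ?_, mul_mem (C.κ_mem_lin k) ht, ?_⟩
    · rw [mul_smul, hto, C.κ_z]
    · rw [mul_smul, htz, C.κ_o]
    · rw [mul_smul, hc, κ_pt, mul_zero, hk, Units.val_inv_eq_inv_val, Units.val_mk0,
        inv_mul_cancel₀ hc0]
  refine ⟨t, ht, hto, htz, ?_⟩
  have hto' : t⁻¹ • o = z := by rw [inv_smul_eq_iff, htz]
  have htz' : t⁻¹ • z = o := by rw [inv_smul_eq_iff, hto]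
  have hconj : ∀ k, ∃ k', C.κ k' = t * C.κ k * t⁻¹ := fun k => C.exists_κ _
    (by rw [mul_smul, mul_smul, hto', C.κ_z, htz]) (by rw [mul_smul, mul_smul, htz', C.κ_o, hto])
  choose f hf using hconj
  let f' : F3721ˣ →* F3721ˣ :=
    { toFun := f
      map_one' := C.κ_injective (by rw [hf, map_one, mul_one, mul_inv_cancel])
      map_mul' := fun a b => C.κ_injective (by rw [hf, map_mul, map_mul, hf, hf]; group) }
  obtain ⟨γ, hγ⟩ : ∃ γ : (ZMod 61)ˣ →* (ZMod 61)ˣ, ∀ k, γ (C.ψ k) = C.ψ (f k) := by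
    refine ⟨C.ψ.liftOfRightInverse _ (Function.rightInverse_surjInv C.ψ_surj)
      ⟨C.ψ.comp f', fun k hk => ?_⟩, fun k => ?_⟩
    · have h : f k = k := C.κ_injective <| by
        rw [hf, (C.mem_lin.1 ht k hk).eq, mul_inv_cancel_right]
      exact (congrArg C.ψ h).trans hk
    · exact MonoidHom.liftOfRightInverse_comp_apply _ _ _ _ _
  obtain ⟨m, hm⟩ := MonoidHom.map_cyclic γ
  obtain ⟨e, he, hpow⟩ : ∃ e < 60, ∀ x : (ZMod 61)ˣ, γ x = x ^ e := by
    refine ⟨(m % 60).toNat, by omega, fun x => ?_⟩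
    have h60 : x ^ (60 : ℤ) = 1 := by
      have h := ZMod.units_pow_card_sub_one_eq_one 61 x
      exact_mod_cast h
    rw [hm, ← zpow_natCast, Int.toNat_of_nonneg (by omega)]
    conv_lhs => rw [← Int.emod_add_mul_ediv m 60, zpow_add, zpow_mul, h60, one_zpow, mul_one]
  have hts : ∀ s : ZMod 61, s ≠ 0 → t • C.pt 0 s = C.pt 0 (s ^ e) := fun s hs => by
    obtain ⟨k, hk⟩ := C.ψ_surj (Units.mk0 s hs)
    have h1 : C.κ k • C.pt 0 1 = C.pt 0 s := by
      rw [κ_pt, mul_zero, mul_one, hk, Units.val_mk0]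
    calc t • C.pt 0 s = (t * C.κ k * t⁻¹) • t • C.pt 0 1 := by
          rw [← h1]; simp only [smul_smul]; congr 1; group
      _ = C.pt 0 (s ^ e) := by
          rw [ht1, ← hf, κ_pt, mul_zero, mul_one, ← hγ, hpow, hk, Units.val_pow_eq_pow_val,
            Units.val_mk0]
  have hinj : ∀ s : ZMod 61, s ≠ 0 → s ≠ 1 → s ^ e ≠ 1 := fun s hs hs1 h => by
    have h' := hts s hs
    rw [h] at h'
    exact hs1 (C.pt_inj (smul_left_cancel t (h'.trans ht1.symm))).2
  obtain ⟨k₀, hk₀⟩ := C.ψ_surj (-1)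
  have hJ : ∀ s, (C.u 1 * C.κ k₀) • C.pt 0 s = C.pt 0 (1 - s) := fun s => by
    rw [mul_smul, κ_pt, u_pt, hk₀, mul_zero, Units.val_neg, Units.val_one, neg_one_mul,
      sub_eq_add_neg]
  set J := C.u 1 * C.κ k₀ with hJdef
  have hJo : J • o = o := by rw [hJdef, mul_smul, C.κ_o, C.u_o]
  have hXs : ∀ s, s ≠ 1 → (t * J) • C.pt 0 s = C.pt 0 ((1 - s) ^ e) := fun s hs => by
    rw [mul_smul, hJ, hts _ (sub_ne_zero.2 hs.symm)]
  have hXo : (t * J) • o = z := by rw [mul_smul, hJo, hto]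
  have hXz : (t * J) • C.pt 0 0 = C.pt 0 1 := by rw [mul_smul, hJ, sub_zero, ht1]
  have hX1 : (t * J) • C.pt 0 1 = o := by rw [mul_smul, hJ, sub_self, C.pt_zero_zero, htz]
  obtain ⟨l, hl⟩ := C.exists_κ (t * J * (t * J) * (t * J))
    (by rw [mul_smul, mul_smul, hXo]; exact (congrArg _ (congrArg _ C.pt_zero_zero.symm)).trans
          ((congrArg _ hXz).trans hX1))
    (by
      refine (congrArg _ C.pt_zero_zero.symm).trans ?_
      rw [mul_smul, mul_smul, hXz, hX1, hXo])
  have hl1 : C.ψ l = 1 := by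
    have h : C.κ l • C.pt 0 1 = C.pt 0 1 := by
      rw [hl, mul_smul, mul_smul, hX1, hXo]
      exact (congrArg _ C.pt_zero_zero.symm).trans hXz
    rw [κ_pt, mul_one] at h
    exact Units.ext (C.pt_inj h).2
  have key : ∀ s : ZMod 61, s ≠ 0 → s ≠ 1 → (1 - (1 - (1 - s) ^ e) ^ e) ^ e = s := by
    intro s hs hs1
    have h1 : (1 - s) ^ e ≠ 1 := hinj _ (sub_ne_zero.2 hs1.symm) (by simpa using hs)
    have h2 : (1 - (1 - s) ^ e) ^ e ≠ 1 := hinj _ (sub_ne_zero.2 h1.symm)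
      (by rw [Ne, sub_eq_self]; exact pow_ne_zero _ (sub_ne_zero.2 hs1.symm))
    have h : C.κ l • C.pt 0 s = C.pt 0 s := by
      rw [κ_pt, hl1, mul_zero, Units.val_one, one_mul]
    rw [hl, mul_smul, mul_smul, hXs _ hs1, hXs _ h1, hXs _ h2] at h
    exact (C.pt_inj h).2
  have he59 : e = 59 := by
    clear * - he key
    revert e
    decide +kernel
  intro s hs
  rw [hts s hs, he59]
  clear * - hs
  congr 1
  revert s
  decide +kernel

end Coord

namespace Coord
variable {G Ω : Type*} [Group G] [MulAction G Ω] {o z : Ω} (C : Coord G Ω o z) {g h l m : G} {ω ω' : Ω}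

lemma exists_mobius {a p} (hp : g • C.pt 0 p = o) (ho : g • o = C.pt 0 a) :
    ∃ b : ZMod 61, b ≠ 0 ∧ ∀ s, s ≠ p → g • C.pt 0 s = C.pt 0 (a + b / (s - p)) := by
  obtain ⟨t, -, hto, htz, ht⟩ := C.exists_swap_lin
  obtain ⟨k, hk⟩ := C.exists_κ (t * (C.u (-a) * g * C.u p))
    (by rw [mul_smul, mul_smul, C.u_o, mul_smul, ho, u_pt, neg_add_cancel]
        exact (congrArg _ C.pt_zero_zero).trans htz)
    (by refine (congrArg _ C.pt_zero_zero.symm).trans ?_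
        rw [mul_smul, mul_smul, u_pt, add_zero, mul_smul, hp, C.u_o, hto])
  refine ⟨(C.ψ k : ZMod 61)⁻¹, inv_ne_zero (Units.ne_zero _), fun s hs => ?_⟩
  have hs' : C.ψ k * (s - p) ≠ 0 := mul_ne_zero (Units.ne_zero _) (sub_ne_zero.2 hs)
  have h1 : C.κ k • C.pt 0 (s - p) = t • C.pt 0 ((C.ψ k : ZMod 61)⁻¹ / (s - p)) := by
    rw [ht _ (div_ne_zero (inv_ne_zero (Units.ne_zero _)) (sub_ne_zero.2 hs)), κ_pt, mul_zero]
    congr 1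
    field_simp
  rw [hk, mul_smul, mul_smul, u_pt, add_sub_cancel, smul_left_cancel_iff, mul_smul] at h1
  rw [← C.u_pt, ← h1, smul_smul, ← C.u_add, add_neg_cancel, u_zero, one_smul]

lemma eq_one_of_mem_lin_of_fix_o (hg : g ∈ C.lin) (ho : g • o = o) {a c} (ha : a ≠ 0)
    (h : g • C.pt a c = C.pt a c) : g = 1 := by
  obtain ⟨s, hs⟩ := C.exists_pt_of_ne hg (C.isLin_pt 0) fun h' =>
    C.pt_ne _ _ (smul_left_cancel g (h'.trans ho.symm))
  obtain ⟨k, hk⟩ := C.exists_κ (C.u (-s) * g) (by rw [mul_smul, ho, C.u_o])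
    (by refine (congrArg _ C.pt_zero_zero.symm).trans ?_
        rw [mul_smul, hs, u_pt, neg_add_cancel, pt_zero_zero])
  have h1 : C.κ k • C.pt a c = C.pt a (-s + c) := by rw [hk, mul_smul, h, u_pt]
  have hk1 : k = 1 := by
    rw [κ_pt] at h1
    exact Units.ext (mul_right_cancel₀ ha ((C.pt_inj h1).1.trans (one_mul a).symm))
  rw [hk1, map_one, one_smul] at h1
  have hs0 : -s = 0 := by simpa using (C.pt_inj h1).2
  rwa [hk1, map_one, hs0, u_zero, one_mul, eq_comm] at hk

lemma exists_pt_of_not_isLin (h : ¬ C.IsLin ω) : ∃ a c, a ≠ 0 ∧ ω = C.pt a c := by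
  obtain ⟨a, c, rfl⟩ := (C.eq_or_exists_pt ω).resolve_left fun h' => h (Or.inl h')
  exact ⟨a, c, fun ha => h (Or.inr ⟨c, by rw [ha]⟩), rfl⟩

lemma eq_one_of_mem_lin (hg : g ∈ C.lin) (hω : C.IsLin ω) (hω' : ¬ C.IsLin ω')
    (h : g • ω = ω) (h' : g • ω' = ω') : g = 1 := by
  obtain ⟨m, hm, hmo⟩ : ∃ m ∈ C.lin, m • ω = o := by
    rcases hω with rfl | ⟨s, rfl⟩
    · exact ⟨1, one_mem _, one_smul _ _⟩
    · obtain ⟨t, ht, -, htz, -⟩ := C.exists_swap_lin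
      refine ⟨t * C.u (-s), mul_mem ht (C.u_mem_lin _), ?_⟩
      rw [mul_smul, u_pt, neg_add_cancel]
      exact (congrArg _ C.pt_zero_zero).trans htz
  obtain ⟨a, c, ha, hac⟩ := C.exists_pt_of_not_isLin (ω := m • ω') (by rwa [C.isLin_smul hm])
  have h1 := C.eq_one_of_mem_lin_of_fix_o (mul_mem (mul_mem hm hg) (inv_mem hm)) (a := a) (c := c)
    (by rw [mul_smul, inv_smul_eq_iff.2 hmo.symm, mul_smul, h, hmo]) ha
    (by rw [← hac, mul_smul, inv_smul_smul, mul_smul, h'])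
  rwa [mul_inv_eq_one, mul_eq_left] at h1

lemma card_ker_ψ : Nat.card C.ψ.ker = 62 := by
  have h := C.ψ.ker.card_mul_index
  rw [index_ker, MonoidHom.range_eq_top.2 C.ψ_surj, Subgroup.card_top, Nat.card_units,
    Nat.card_units, card_F3721, Nat.card_zmod] at h
  omega

instance : Finite {ω // C.IsLin ω} :=
  Finite.of_surjective (fun c : Option (ZMod 61) => (⟨c.elim o (C.pt 0), by
    rcases c with _ | c
    exacts [C.isLin_o, C.isLin_pt c]⟩ : {ω // C.IsLin ω})) (by
    rintro ⟨ω, rfl | ⟨c, rfl⟩⟩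
    exacts [⟨none, rfl⟩, ⟨some c, rfl⟩])

lemma card_isLin : Nat.card {ω // C.IsLin ω} ≤ 62 := by
  have h := Nat.card_le_card_of_surjective
    (fun c : Option (ZMod 61) => (⟨c.elim o (C.pt 0), by
    rcases c with _ | c
    exacts [C.isLin_o, C.isLin_pt c]⟩ : {ω // C.IsLin ω})) (by
    rintro ⟨ω, rfl | ⟨c, rfl⟩⟩
    exacts [⟨none, rfl⟩, ⟨some c, rfl⟩])
  simpa using h

lemma conj_eq_one_of_fix {k} (hg : g * C.κ k * g⁻¹ ∈ C.lin) (hgo : ¬ C.IsLin (g • o))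
    (hω : C.IsLin ω) (h : (g * C.κ k * g⁻¹) • ω = ω) : k = 1 := by
  have h1 := C.eq_one_of_mem_lin hg hω hgo h (by rw [smul_smul, inv_mul_cancel_right, mul_smul, C.κ_o])
  rw [mul_inv_eq_one, mul_eq_left] at h1
  exact C.κ_injective (h1.trans (map_one _).symm)

lemma exists_conj_smul_o (hg : ∀ k, C.ψ k = 1 → g * C.κ k * g⁻¹ ∈ C.lin)
    (hgo : ¬ C.IsLin (g • o)) (hω : C.IsLin ω) :
    ∃ k, C.ψ k = 1 ∧ (g * C.κ k * g⁻¹) • o = ω := by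
  let f : C.ψ.ker → {ω // C.IsLin ω} := fun k => ⟨(g * C.κ k * g⁻¹) • o,
    (C.isLin_smul (hg k k.2)).2 C.isLin_o⟩
  have hf : Function.Injective f := fun k l hkl => by
    have h1 : (g * C.κ k * g⁻¹) • o = (g * C.κ l * g⁻¹) • o := congrArg Subtype.val hkl
    have h2 := C.conj_eq_one_of_fix (k := (l : F3721ˣ)⁻¹ * k) (hg _ (mul_mem (inv_mem l.2) k.2)) hgo
      C.isLin_o (by
        have h3 : g * C.κ ((l : F3721ˣ)⁻¹ * k) * g⁻¹ = (g * C.κ l * g⁻¹)⁻¹ * (g * C.κ k * g⁻¹) := by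
          rw [map_mul, map_inv]; group
        rw [h3, mul_smul, h1, inv_smul_smul])
    exact Subtype.ext (inv_mul_eq_one.1 h2).symm
  obtain ⟨k, hk⟩ := (hf.bijective_of_nat_card_le (by rw [C.card_ker_ψ]; exact C.card_isLin)).2 ⟨ω, hω⟩
  exact ⟨k, k.2, congrArg Subtype.val hk⟩

lemma exists_conj_lin : ∃ (g : G) (e : ZMod 61), g • o = C.pt 1 e ∧
    (∀ k, C.ψ k = 1 → g * C.κ k * g⁻¹ ∈ C.lin) ∧ (g * C.κ (-1) * g⁻¹) • o = z := by
  obtain ⟨g, hgo, hgz, hg⟩ := C.exists_conj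
  have hg' : ∀ k, C.ψ k = 1 → g * C.κ k * g⁻¹ ∈ C.lin := fun k hk =>
    C.mem_lin.2 fun l hl => hg k l hk hl
  have hl : ¬ C.IsLin (g • o) := by
    rintro (h | ⟨c, h⟩)
    · exact hgo h
    · exact hgz c (by rw [h, pt, d_zero, one_mul])
  obtain ⟨s, hs⟩ := C.exists_pt_of_ne (hg' _ C.ψ_neg_one) C.isLin_o fun h =>
    absurd (C.conj_eq_one_of_fix (hg' _ C.ψ_neg_one) hl C.isLin_o h) (by decide +kernel)
  obtain ⟨a, c, ha, hac⟩ := C.exists_pt_of_not_isLin hl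
  set m := C.κ (Units.mk0 a ha)⁻¹ * C.u (-s) with hm
  have hml : m ∈ C.lin := mul_mem (C.κ_mem_lin _) (C.u_mem_lin _)
  have hmo : m⁻¹ • o = o := by rw [inv_smul_eq_iff, hm, mul_smul, C.u_o, C.κ_o]
  have hconj : ∀ k, m * g * C.κ k * (m * g)⁻¹ = m * (g * C.κ k * g⁻¹) * m⁻¹ := fun k => by group
  refine ⟨m * g, C.ψ (Units.mk0 a ha)⁻¹ * (-s + c), ?_, fun k hk => ?_, ?_⟩
  · rw [mul_smul, hac, hm, mul_smul, u_pt, κ_pt, Units.val_inv_eq_inv_val, Units.val_mk0,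
      inv_mul_cancel₀ ha]
  · rw [hconj]
    exact mul_mem (mul_mem hml (hg' k hk)) (inv_mem hml)
  · rw [hconj, mul_smul, hmo, mul_smul, hs, hm, mul_smul, u_pt, neg_add_cancel]
    exact (congrArg _ C.pt_zero_zero).trans (C.κ_z _)

end Coord

namespace Coord
variable {G Ω : Type*} [Group G] [MulAction G Ω] {o z : Ω} (C : Coord G Ω o z) {σ : G}

/-- An involution `σ` swapping `o` and `z`, with part of its action. -/
structure IsWeyl (σ : G) (ν e : ZMod 61) : Prop where
  mem_lin : σ ∈ C.lin
  smul_o : σ • o = z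
  smul_z : σ • z = o
  mul_self : σ * σ = 1
  smul_pt_zero : ∀ s, s ≠ 0 → σ • C.pt 0 s = C.pt 0 (ν / s)
  ne_sq : ∀ s, ν ≠ s ^ 2
  smul_pt_one : ∀ r, ∃ k, (C.ψ k : ZMod 61) = ν / (ν - r ^ 2) ∧
    σ • C.pt 1 (r + e) = C.pt k (C.ψ k * e - r * (ν / (ν - r ^ 2)))
  fix : σ • C.pt 1 e = C.pt 1 e

lemma exists_weyl : ∃ (σ : G) (ν e : ZMod 61), C.IsWeyl σ ν e := by
  obtain ⟨g₀, e, hg₀, hlin, hz⟩ := C.exists_conj_lin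
  have hl : ¬ C.IsLin (g₀ • o) := by rw [hg₀]; exact C.not_isLin_pt one_ne_zero
  have hg₀fix : ∀ k, (g₀ * C.κ k * g₀⁻¹) • C.pt 1 e = C.pt 1 e := fun k => by
    rw [← hg₀, smul_smul, inv_mul_cancel_right, mul_smul, C.κ_o]
  have hcomm : ∀ k l, Commute (g₀ * C.κ k * g₀⁻¹) (g₀ * C.κ l * g₀⁻¹) := fun k l => by
    have h : Commute (C.κ k) (C.κ l) := (Commute.all k l).map C.κ
    exact Commute.conj_iff g₀ |>.2 h
  set σ := g₀ * C.κ (-1) * g₀⁻¹ with hσdef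
  have hσl : σ ∈ C.lin := hlin _ C.ψ_neg_one
  have hσσ : σ * σ = 1 := by
    have h : C.κ (-1) * C.κ (-1) = 1 := by rw [← map_mul, neg_mul_neg, one_mul, map_one]
    calc σ * σ = g₀ * (C.κ (-1) * C.κ (-1)) * g₀⁻¹ := by rw [hσdef]; group
      _ = 1 := by rw [h, mul_one, mul_inv_cancel]
  have hσ2 : ∀ ω : Ω, σ • σ • ω = ω := fun ω => by rw [smul_smul, hσσ, one_smul]
  have hzo : σ • z = o := (congrArg _ hz.symm).trans (hσ2 o)
  have hσ0 : σ • C.pt 0 0 = o := (congrArg _ C.pt_zero_zero).trans hzo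
  obtain ⟨ν, hν, hσs⟩ := C.exists_mobius hσ0 (hz.trans C.pt_zero_zero.symm)
  simp only [sub_zero, zero_add] at hσs
  have hνs : ∀ s, ν ≠ s ^ 2 := fun s hs => by
    by_cases h0 : s = 0
    · exact hν (by rw [hs, h0]; rfl)
    · refine absurd (C.conj_eq_one_of_fix (ω := C.pt 0 s) hσl hl (C.isLin_pt s) ?_) (by decide +kernel)
      rw [← hσdef, hσs s h0, hs, sq, mul_div_cancel_right₀ _ h0]
  refine ⟨σ, ν, e, hσl, hz, hzo, hσσ, hσs, hνs, fun r => ?_, hg₀fix _⟩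
  have hνr : ν - r ^ 2 ≠ 0 := sub_ne_zero.2 (hνs r)
  by_cases hr : r = 0
  · refine ⟨1, ?_, ?_⟩
    · rw [hr, map_one, Units.val_one, zero_pow two_ne_zero, sub_zero, div_self hν]
    · rw [hr, map_one, Units.val_one, zero_mul, sub_zero, Units.val_one, one_mul, zero_add]
      exact hg₀fix _
  obtain ⟨k, hk, hko⟩ := C.exists_conj_smul_o hlin hl (C.isLin_pt (-r))
  have hgl := hlin k hk
  have hgσ := hcomm k (-1)
  have hge := hg₀fix k
  have hk1 : k ≠ 1 := by
    rintro rfl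
    rw [map_one, mul_one, mul_inv_cancel, one_smul] at hko
    exact C.pt_ne _ _ hko.symm
  have hkm : k ≠ -1 := by
    rintro rfl
    have h := (C.pt_inj ((C.pt_zero_zero.trans hz.symm).trans hko)).2
    exact hr (neg_eq_zero.1 h.symm)
  have hgg : ∀ ω, C.IsLin ω →
      (g₀ * C.κ k * g₀⁻¹) • (g₀ * C.κ k * g₀⁻¹) • ω ≠ ω := fun ω hω h => by
    have h1 : g₀ * C.κ k * g₀⁻¹ * (g₀ * C.κ k * g₀⁻¹) = g₀ * C.κ (k * k) * g₀⁻¹ := by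
      rw [map_mul]; group
    rw [smul_smul, h1] at h
    have h2 := C.conj_eq_one_of_fix (hlin (k * k) (by rw [map_mul, hk, mul_one])) hl hω h
    rcases mul_self_eq_one_iff.1 (congrArg Units.val h2) with h3 | h3
    · exact hk1 (Units.ext h3)
    · exact hkm (Units.ext h3)
  rw [← hσdef] at hgσ
  set g := g₀ * C.κ k * g₀⁻¹
  clear_value σ g
  obtain ⟨p, hp⟩ : ∃ p, g • C.pt 0 p = o := by
    obtain ⟨p, hp⟩ := C.exists_pt_of_ne (g := g⁻¹) (inv_mem hgl) C.isLin_o fun h => by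
      rw [inv_smul_eq_iff, hko] at h
      exact C.pt_ne _ _ h.symm
    exact ⟨p, by rw [← hp, smul_inv_smul]⟩
  have hgσω : ∀ ω : Ω, g • σ • ω = σ • g • ω := fun ω => by rw [smul_smul, hgσ.eq, mul_smul]
  have hp0 : p ≠ 0 := by
    rintro rfl
    have h1 := hgσω o
    rw [hz, hko] at h1
    have h2 : σ • C.pt 0 (-r) = σ • z := by
      rw [← h1, hzo]
      exact (congrArg _ C.pt_zero_zero.symm).trans hp
    have h3 := (smul_left_cancel σ h2).trans C.pt_zero_zero.symm
    exact hr (neg_eq_zero.1 (C.pt_inj h3).2)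
  obtain ⟨b, hb, hgs⟩ := C.exists_mobius hp hko
  have hgz : g • z = C.pt 0 (-r + b / (0 - p)) :=
    (congrArg _ C.pt_zero_zero.symm).trans (hgs 0 hp0.symm)
  have e1 : -r + b / (0 - p) = ν / -r := by
    have h1 := hgσω o
    rw [hz, hgz, hko, hσs _ (neg_ne_zero.2 hr)] at h1
    exact (C.pt_inj h1).2
  have hνp : ν / p ≠ p := fun h => hνs p (by rw [sq]; exact (div_eq_iff hp0).1 h)
  have e2 : -r + b / (ν / p - p) = 0 := by
    have h1 := hgσω (C.pt 0 p)
    rw [hp, hz, hσs _ hp0, hgs _ hνp] at h1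
    exact (C.pt_inj (h1.trans C.pt_zero_zero.symm)).2
  have hνp' : ν - p ^ 2 ≠ 0 := sub_ne_zero.2 (hνs p)
  have e3 : b = p * (ν / r - r) := by
    field_simp at e1 ⊢
    linear_combination e1
  have e4 : b * p = r * (ν - p ^ 2) := by
    have h : ν / p - p = (ν - p ^ 2) / p := by field_simp
    rw [h] at e2
    field_simp at e2
    linear_combination e2
  have hpr : p = r := by
    have h : (p - r) * (p + r) * ν = 0 := by
      rw [e3] at e4
      field_simp at e4
      linear_combination e4
    rcases mul_eq_zero.1 ((mul_eq_zero.1 h).resolve_right hν) with h | h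
    · exact sub_eq_zero.1 h
    · refine absurd ?_ (hgg o C.isLin_o)
      rw [hko, ← eq_neg_of_add_eq_zero_left h, hp]
  subst hpr
  set c := -(p * (ν / (ν - p ^ 2))) with hc
  have hhz : (σ * (C.u p * g)) • z = C.pt 0 c := by
    rw [mul_smul, mul_smul, hgz, e1, u_pt]
    have h : p + ν / -p = -((ν - p ^ 2) / p) := by field_simp; ring
    rw [h, hσs _ (neg_ne_zero.2 (div_ne_zero hνr hr)), hc]
    congr 1
    field_simp
  obtain ⟨k', hk'⟩ := C.exists_κ (C.u (-c) * (σ * (C.u p * g)))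
    (by rw [mul_smul, mul_smul, mul_smul, hko, u_pt, add_neg_cancel, hσ0, C.u_o])
    (by rw [mul_smul, hhz, u_pt, neg_add_cancel, pt_zero_zero])
  have hh : ∀ ω : Ω, σ • C.u p • g • ω = C.u c • C.κ k' • ω := fun ω => by
    rw [hk', smul_smul, smul_smul, smul_smul, ← mul_assoc (C.u c), ← C.u_add, add_neg_cancel,
      u_zero, one_mul, mul_assoc]
  have hk'' : (C.ψ k' : ZMod 61) = ν / (ν - p ^ 2) := by
    have h := hh (C.pt 0 p)
    rw [hp, C.u_o, hz, κ_pt, u_pt] at h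
    have h1 := (C.pt_inj (C.pt_zero_zero.trans h)).2
    rw [hc] at h1
    exact mul_right_cancel₀ hr (by linear_combination -h1)
  refine ⟨k', hk'', ?_⟩
  have h := hh (C.pt 1 e)
  rw [hge, u_pt, κ_pt, u_pt, mul_one] at h
  rw [h, hc]
  congr 1
  ring

end Coord

lemma re_one_F3721 : (1 : F3721).re = 1 := rfl

lemma im_one_F3721 : (1 : F3721).im = 0 := rfl

namespace Coord
variable {G Ω : Type*} [Group G] [MulAction G Ω] {o z : Ω} {C : Coord G Ω o z} {σ : G}
  {ν e : ZMod 61}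

lemma eq_one_of_fix_pt_one {g : G} {b c : ZMod 61} (ho : g • o = o) (hz : g • z = z)
    (h : g • C.pt 1 b = C.pt 1 c) : g = 1 ∧ b = c := by
  obtain ⟨k, rfl⟩ := C.exists_κ g ho hz
  rw [κ_pt] at h
  have h1 := C.pt_inj h
  have hk : k = 1 := Units.ext ((mul_one _).symm.trans h1.1)
  subst hk
  refine ⟨map_one _, ?_⟩
  have h2 := h1.2
  rwa [map_one, Units.val_one, one_mul] at h2

namespace IsWeyl

lemma eq_zero (h : C.IsWeyl σ ν e) : e = 0 := by
  have hA : ∀ ρ, ∃ A : G, A • o = z ∧ A • z = o ∧ A • C.pt 1 ρ = C.pt 1 (2 * e - ρ) := fun ρ => by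
    obtain ⟨k, hk, hk'⟩ := h.smul_pt_one (ρ - e)
    refine ⟨C.κ k⁻¹ * σ, ?_, ?_, ?_⟩
    · rw [mul_smul, h.smul_o, C.κ_z]
    · rw [mul_smul, h.smul_z, C.κ_o]
    · rw [sub_add_cancel] at hk'
      rw [mul_smul, hk', map_inv, inv_smul_eq_iff, κ_pt, mul_one, ← hk]
      congr 1
      ring
  have hJ : ∀ ρ, ∃ J : G, J • o = o ∧ J • z = C.pt 1 (-ρ) ∧ J • C.pt 1 ρ = z := fun ρ => by
    refine ⟨C.κ (-1) * (C.d (-1) * C.u (-ρ)), ?_, ?_, ?_⟩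
    · rw [mul_smul, mul_smul, C.u_o, C.d_o, C.κ_o]
    · rw [mul_smul]
      refine (C.κ_pt _ _ _).trans ?_
      rw [C.ψ_neg_one]
      simp
    · rw [mul_smul, mul_smul, u_pt, d_pt, κ_pt]
      refine Eq.trans ?_ C.pt_zero_zero
      congr 1
      simp [re_one_F3721, im_one_F3721]
  obtain ⟨J₁, a1, a2, a3⟩ := hJ e
  obtain ⟨A₁, b1, b2, b3⟩ := hA (-e)
  obtain ⟨J₂, c1, c2, c3⟩ := hJ (2 * e - -e)
  obtain ⟨A₂, d1, d2, d3⟩ := hA (-(2 * e - -e))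
  obtain ⟨J₃, e1, e2, e3⟩ := hJ (2 * e - -(2 * e - -e))
  have key := (C.eq_one_of_fix_pt_one (g := J₃ * (A₂ * (J₂ * (A₁ * (J₁ * σ)))))
    (b := e) (c := -(2 * e - -(2 * e - -e)))
    (by simp only [mul_smul]; rw [h.smul_o, a2, b3, c3, d2, e1])
    (by simp only [mul_smul]; rw [h.smul_z, a1, b1, c2, d3, e3])
    (by simp only [mul_smul]; rw [h.fix, a3, b2, c1, d1, e2])).2
  have h6 : 6 * e = 0 := by linear_combination key
  exact (mul_eq_zero.1 h6).resolve_left (by decide)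

lemma exists_smul_pt (h : C.IsWeyl σ ν 0) : ∃ F : ZMod 61 → F3721ˣ,
    (∀ s, (C.ψ (F s) : ZMod 61) = ν / (ν - s ^ 2)) ∧
    (∀ s, σ • C.pt 1 s = C.pt (F s) (-(s * (ν / (ν - s ^ 2))))) ∧
    ∀ s, s ≠ 0 → (F (ν / s) : F3721) = 1 - F s ∧
      C.θ * (F s : F3721).im = -2 * (s * (ν / (ν - s ^ 2))) := by
  have h1 := h.smul_pt_one
  simp only [add_zero, mul_zero, zero_sub] at h1
  choose F hF hF' using h1
  refine ⟨F, hF, hF', fun s hs => ?_⟩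
  set J := C.κ (-1) * C.d (-1) with hJ
  have hJo : J • o = o := by rw [mul_smul, C.d_o, C.κ_o]
  have hJp : ∀ a c, J • C.pt a c = C.pt (1 - a) (c - C.θ * a.im) := fun a c => by
    rw [mul_smul, d_pt, κ_pt, C.ψ_neg_one]
    congr 1 <;> simp [re_one_F3721, im_one_F3721] <;> ring
  clear_value J
  have hJz : J • z = C.pt 1 0 := (congrArg _ C.pt_zero_zero.symm).trans
    ((hJp 0 0).trans (by simp))
  have hJ1 : J • C.pt 1 0 = z := by
    rw [hJp, im_one_F3721, mul_zero, sub_zero, sub_self, C.pt_zero_zero]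
  have hJJ : J * J = 1 := (C.eq_one_of_fix_pt_one (b := 0) (c := 0) (by rw [mul_smul, hJo, hJo])
    (by rw [mul_smul, hJz, hJ1]) (by rw [mul_smul, hJ1, hJz])).1
  have hbr : (J * σ) * ((J * σ) * (J * σ)) = 1 :=
    (C.eq_one_of_fix_pt_one (b := 0) (c := 0)
      (by simp only [mul_smul]; rw [h.smul_o, hJz, h.fix, hJ1, h.smul_z, hJo])
      (by simp only [mul_smul]; rw [h.smul_z, hJo, h.smul_o, hJz, h.fix, hJ1])
      (by simp only [mul_smul]; rw [h.fix, hJ1, h.smul_z, hJo, h.smul_o, hJz])).1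
  have hbr' : σ * (J * σ) = J * (σ * J) := by
    have h2 : σ⁻¹ = σ := inv_eq_of_mul_eq_one_right h.mul_self
    have h3 : J⁻¹ = J := inv_eq_of_mul_eq_one_right hJJ
    have h4 := eq_inv_of_mul_eq_one_left hbr
    rw [mul_inv_rev, mul_inv_rev, h2, h3] at h4
    have h5 : J * (J * σ) = J * (σ * J * (σ * J)) := congrArg _ h4
    rw [← mul_assoc, hJJ, one_mul] at h5
    calc σ * (J * σ) = J * (σ * J * (σ * J)) * (J * σ) := by rw [← h5]
      _ = J * (σ * J) * σ * (J * J) * σ := by group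
      _ = J * (σ * J) * (σ * σ) := by rw [hJJ]; group
      _ = _ := by rw [h.mul_self, mul_one]
  have hs' : ν / s ≠ 0 := div_ne_zero (fun h0 => h.ne_sq 0 (by rw [h0]; rfl)) hs
  have h2 : σ • J • σ • C.pt 0 s = J • σ • J • C.pt 0 s := by
    simp only [← mul_smul]
    rw [hbr']
  rw [h.smul_pt_zero s hs, hJp, hJp, QuadraticAlgebra.im_zero, mul_zero, sub_zero, sub_zero,
    hF', sub_zero, hF', hJp] at h2
  obtain ⟨h3, h4⟩ := C.pt_inj h2
  refine ⟨h3, ?_⟩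
  have h5 : ν - s ^ 2 ≠ 0 := sub_ne_zero.2 (h.ne_sq s)
  have h6 : ν - (ν / s) ^ 2 ≠ 0 := sub_ne_zero.2 (h.ne_sq _)
  have h7 : ν / s * (ν / (ν - (ν / s) ^ 2)) = -(s * (ν / (ν - s ^ 2))) := by
    have h8 : ν ≠ 0 := fun h0 => h.ne_sq 0 (by rw [h0]; rfl)
    have h9 : ν - (ν / s) ^ 2 = - (ν * (ν - s ^ 2) / s ^ 2) := by field_simp; ring
    rw [h9]
    field_simp
  rw [h7] at h4
  linear_combination h4

end IsWeyl

lemma θ_ne_zero (C : Coord G Ω o z) : C.θ ≠ 0 := by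
  obtain ⟨σ, ν, e, h⟩ := C.exists_weyl
  have he := h.eq_zero
  subst he
  obtain ⟨F, -, -, hF⟩ := h.exists_smul_pt
  have h1 := (hF 1 one_ne_zero).2
  have h5 : ν - 1 ^ 2 ≠ 0 := sub_ne_zero.2 (h.ne_sq _)
  have h8 : ν ≠ 0 := fun h0 => h.ne_sq 0 (by rw [h0]; rfl)
  intro h0
  rw [h0, zero_mul, one_mul] at h1
  exact mul_ne_zero (by decide) (div_ne_zero h8 h5) h1.symm

lemma exists_θ_eq_one (C : Coord G Ω o z) : ∃ C' : Coord G Ω o z, C'.θ = 1 := by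
  have hθ := C.θ_ne_zero
  refine ⟨{ C with
    u := fun c => C.u (C.θ * c)
    θ := 1
    u_add := fun b c => by rw [mul_add, C.u_add]
    d_mul := fun a b => by rw [one_mul, C.d_mul]
    u_d := fun c a => C.u_d _ _
    κ_u := fun k c => by rw [C.κ_u, mul_left_comm]
    u_o := fun c => C.u_o _
    exists_smul_z := fun ω hω => by
      obtain ⟨a, c, h⟩ := C.exists_smul_z ω hω
      exact ⟨a, c / C.θ, by rw [mul_div_cancel₀ _ hθ, h]⟩
    smul_z_inj := fun a c a' c' h => by
      obtain ⟨h1, h2⟩ := C.smul_z_inj _ _ _ _ h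
      exact ⟨h1, mul_left_cancel₀ hθ h2⟩
    exists_conj := by
      obtain ⟨g, h1, h2, h3⟩ := C.exists_conj
      exact ⟨g, h1, fun c => h2 _, h3⟩ }, rfl⟩

end Coord

/-- The norm of `F3721`. -/
def normF (a : F3721) : ZMod 61 := a.re ^ 2 - 2 * a.im ^ 2

/-- The map describing the action of an involution of the Weyl group on coordinates. -/
noncomputable def weylMap : Option (F3721 × ZMod 61) → Option (F3721 × ZMod 61)
  | none => some (0, 0)
  | some (a, c) => if a = 0 then if c = 0 then none else some (0, 23 / c) else
      some ((star a)⁻¹ * ⟨(1 - 8 * (c / normF a) ^ 2)⁻¹,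
        -2 * (c / normF a * (1 - 8 * (c / normF a) ^ 2)⁻¹)⟩,
        (normF a)⁻¹ * -(c / normF a * (1 - 8 * (c / normF a) ^ 2)⁻¹))

namespace Coord
variable {G Ω : Type*} [Group G] [MulAction G Ω] {o z : Ω} {C : Coord G Ω o z} {σ : G}
  {ν e : ZMod 61}

lemma u_injective : Function.Injective C.u := fun a b h =>
  (C.smul_z_inj 0 a 0 b (by rw [h])).2

lemma ψ_eq (hθ : C.θ = 1) (k : F3721ˣ) : (C.ψ k : ZMod 61) = normF k := by
  let w : F3721 := ⟨0, 1⟩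
  have h1 : C.κ k * (C.d 1 * C.d w) = C.d (k * (1 + w)) * C.u (C.ψ k) * C.κ k := by
    rw [C.d_mul, ← mul_assoc, C.κ_d, mul_assoc, C.κ_u, ← mul_assoc, hθ]
    congr 3
    simp [w, re_one_F3721, im_one_F3721]
  have h2 : C.κ k * (C.d 1 * C.d w) = C.d (k * (1 + w)) * C.u (normF k) * C.κ k := by
    rw [← mul_assoc, C.κ_d, mul_assoc, C.κ_d, ← mul_assoc, C.d_mul, hθ, mul_add, mul_one (k : F3721)]
    congr 3
    rw [QuadraticAlgebra.re_mul, QuadraticAlgebra.im_mul]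
    simp only [normF, w]
    ring
  exact C.u_injective (mul_left_cancel (mul_right_cancel (h1.symm.trans h2)))

namespace IsWeyl

lemma eq_twentythree (h : C.IsWeyl σ ν 0) (hθ : C.θ = 1) : ν = 23 ∧
    ∃ F : ZMod 61 → F3721ˣ, (∀ s, (F s : F3721) = ⟨(1 - 8 * s ^ 2)⁻¹, -2 * (s * (1 - 8 * s ^ 2)⁻¹)⟩) ∧
    ∀ s, σ • C.pt 1 s = C.pt (F s) (-(s * (1 - 8 * s ^ 2)⁻¹)) := by
  obtain ⟨F, hF, hσF, hFJ⟩ := h.exists_smul_pt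
  have hν : ν ≠ 0 := fun h0 => h.ne_sq 0 (by rw [h0]; rfl)
  have him : ∀ s, s ≠ 0 → (F s : F3721).im = -2 * (s * (ν / (ν - s ^ 2))) := fun s hs => by
    have h1 := (hFJ s hs).2
    rwa [hθ, one_mul] at h1
  have hre : ∀ s, s ≠ 0 → (F s : F3721).re = ν / (ν - s ^ 2) := fun s hs => by
    have h1 := hF (ν / s)
    rw [ψ_eq hθ, (hFJ s hs).1] at h1
    have h2 := hF s
    rw [ψ_eq hθ] at h2
    simp only [normF, QuadraticAlgebra.re_sub, QuadraticAlgebra.im_sub, re_one_F3721, im_one_F3721] at h1 h2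
    have h3 : ν / (ν - (ν / s) ^ 2) = - (s ^ 2 / (ν - s ^ 2)) := by
      have h5 : ν - s ^ 2 ≠ 0 := sub_ne_zero.2 (h.ne_sq s)
      have h9 : ν - (ν / s) ^ 2 = - (ν * (ν - s ^ 2) / s ^ 2) := by field_simp; ring
      rw [h9]
      field_simp
    have h4 : ν / (ν - s ^ 2) + s ^ 2 / (ν - s ^ 2) = 1 + 2 * (s ^ 2 / (ν - s ^ 2)) := by
      have h5 : ν - s ^ 2 ≠ 0 := sub_ne_zero.2 (h.ne_sq s)
      field_simp
      ring
    rw [h3] at h1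
    have h5 : 2 * (F s : F3721).re = 2 * (ν / (ν - s ^ 2)) := by
      linear_combination h2 - h1 - h4
    exact mul_left_cancel₀ (by decide) h5
  have hν23 : ν = 23 := by
    have h1 := hF 1
    have h5 := sub_ne_zero.2 (h.ne_sq 1)
    rw [ψ_eq hθ, normF, him 1 one_ne_zero, hre 1 one_ne_zero] at h1
    rw [one_pow] at h1 h5
    field_simp at h1
    have h61 : (184 : ZMod 61) = 1 := by decide
    linear_combination -23 * h1 - ν * h61
  subst hν23
  have hq : ∀ s : ZMod 61, 23 / (23 - s ^ 2) = (1 - 8 * s ^ 2)⁻¹ := by decide +kernel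
  refine ⟨rfl, F, fun s => ?_, fun s => by rw [hσF, hq]⟩
  by_cases hs : s = 0
  · have h1 := (C.pt_inj ((hσF 0).symm.trans h.fix)).1
    rw [hs, h1]
    exact QuadraticAlgebra.ext (by rw [re_one_F3721]; simp) (by rw [im_one_F3721]; simp)
  · exact QuadraticAlgebra.ext (by rw [hre s hs, hq]) (by rw [him s hs, hq])

end IsWeyl

end Coord

lemma mul_star_eq {l : F3721} (h : normF l = 1) : l * star l = 1 := by
  refine QuadraticAlgebra.ext ?_ ?_
  · rw [QuadraticAlgebra.re_mul, re_one_F3721, ← h, normF, QuadraticAlgebra.re_star, QuadraticAlgebra.im_star]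
    ring
  · rw [QuadraticAlgebra.im_mul, im_one_F3721, QuadraticAlgebra.re_star, QuadraticAlgebra.im_star]
    ring

lemma normF_star (a : F3721) : normF (star a) = normF a := by
  rw [normF, normF, QuadraticAlgebra.re_star, QuadraticAlgebra.im_star]
  ring

namespace Coord
variable {G Ω : Type*} [Group G] [MulAction G Ω] {o z : Ω} {C : Coord G Ω o z} {σ : G}
  {ν e : ZMod 61}

namespace IsWeyl

lemma conj_κ (h : C.IsWeyl σ ν 0) (hθ : C.θ = 1) (k : F3721ˣ) :
    σ * C.κ k = C.κ (star k)⁻¹ * σ := by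
  obtain ⟨rfl, F, hF, hσF⟩ := h.eq_twentythree hθ
  have hinv : σ⁻¹ = σ := inv_eq_of_mul_eq_one_right h.mul_self
  have hconj : ∀ k, ∃ k', C.κ k' = σ * C.κ k * σ⁻¹ := fun k => C.exists_κ _
    (by rw [hinv, mul_smul, mul_smul, h.smul_o, C.κ_z, h.smul_z])
    (by rw [hinv, mul_smul, mul_smul, h.smul_z, C.κ_o, h.smul_o])
  choose f hf using hconj
  let η : F3721ˣ →* F3721ˣ :=
    { toFun k := f k * star k
      map_one' := by
        rw [star_one, mul_one]
        exact C.κ_injective (by rw [hf, map_one, mul_one, mul_inv_cancel])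
      map_mul' a b := by
        have h1 : f (a * b) = f a * f b :=
          C.κ_injective (by rw [hf, map_mul, map_mul, hf, hf]; group)
        rw [h1, star_mul', mul_mul_mul_comm] }
  have hη : ∀ l, C.ψ l = 1 → η l = 1 := fun l hl => by
    have h1 : f l = l := C.κ_injective <| by
      rw [hf, (C.mem_lin.1 h.mem_lin l hl).eq, mul_inv_cancel_right]
    change f l * star l = 1
    rw [h1]
    refine Units.ext (mul_star_eq ?_)
    rw [← ψ_eq hθ, hl, Units.val_one]
  have hψ1 : (C.ψ (F 1) : ZMod 61) = 26 := by
    rw [ψ_eq hθ, hF]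
    decide +kernel
  have hη1 : η (F 1) = 1 := by
    have h1 : σ • C.κ (F 1) • C.pt 1 (-1) = C.pt 1 1 := by
      have h2 : C.κ (F 1) • C.pt 1 (-1) = σ • C.pt 1 1 := by
        rw [κ_pt, hσF, hψ1, mul_one]
        congr 1
        decide +kernel
      rw [h2, smul_smul, h.mul_self, one_smul]
    have h2 : σ • C.κ (F 1) • C.pt 1 (-1) = C.κ (f (F 1)) • σ • C.pt 1 (-1) := by
      rw [hf, smul_smul, smul_smul, inv_mul_cancel_right]
    rw [h1, hσF, κ_pt] at h2
    have h3 : star (F 1 : F3721) = F (-1) := by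
      rw [hF, hF, QuadraticAlgebra.star_mk]
      refine QuadraticAlgebra.ext ?_ ?_ <;> decide +kernel
    refine Units.ext ?_
    change (f (F 1) : F3721) * star (F 1 : F3721) = 1
    rw [h3]
    exact (C.pt_inj h2).1.symm
  have hη' : η k = 1 := by
    have hgen : ∀ x : ZMod 61, x ≠ 0 → ∃ n : Fin 60, 26 ^ (n : ℕ) = x := by decide +kernel
    obtain ⟨n, hn⟩ := hgen _ (Units.ne_zero (C.ψ k))
    have h1 : C.ψ ((F 1 ^ (n : ℕ))⁻¹ * k) = 1 := by
      rw [map_mul, map_inv, inv_mul_eq_one, map_pow]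
      exact Units.ext (by rw [Units.val_pow_eq_pow_val, hψ1, hn])
    have h2 := hη _ h1
    rwa [map_mul, map_inv, map_pow, hη1, one_pow, inv_one, one_mul] at h2
  have h1 : f k = (star k)⁻¹ := eq_inv_of_mul_eq_one_left hη'
  rw [← h1, hf, inv_mul_cancel_right]

end IsWeyl

variable (C)

/-- The point with given coordinates, where `none` stands for `o`. -/
def point (x : Option (F3721 × ZMod 61)) : Ω := x.elim o fun p => C.pt p.1 p.2

lemma point_injective : Function.Injective C.point := by
  rintro (_ | ⟨a, c⟩) (_ | ⟨a', c'⟩) h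
  · rfl
  · exact absurd h.symm (C.pt_ne _ _)
  · exact absurd h (C.pt_ne _ _)
  · obtain ⟨h1, h2⟩ := C.pt_inj h
    exact congrArg some (Prod.ext h1 h2)

lemma point_surjective : Function.Surjective C.point := fun ω => by
  obtain rfl | ⟨a, c, rfl⟩ := C.eq_or_exists_pt ω
  exacts [⟨none, rfl⟩, ⟨some (a, c), rfl⟩]

lemma exists_weylMap (hθ : C.θ = 1) : ∃ σ : G, ∀ x, σ • C.point x = C.point (weylMap x) := by
  obtain ⟨σ, ν, e, h⟩ := C.exists_weyl
  have he := h.eq_zero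
  subst he
  have hκ := h.conj_κ hθ
  obtain ⟨rfl, F, hF, hσF⟩ := h.eq_twentythree hθ
  refine ⟨σ, ?_⟩
  rintro (_ | ⟨a, c⟩)
  · exact h.smul_o.trans C.pt_zero_zero.symm
  rw [weylMap]
  split_ifs with ha hc
  · subst ha hc
    exact (congrArg _ C.pt_zero_zero).trans h.smul_z
  · subst ha
    exact h.smul_pt_zero c hc
  · set k := Units.mk0 a ha with hk
    have hn : (C.ψ k : ZMod 61) = normF a := ψ_eq hθ k
    have hn' : (C.ψ (star k) : ZMod 61) = normF a := (ψ_eq hθ (star k)).trans (normF_star a)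
    have h0 : normF a ≠ 0 := by rw [← hn]; exact Units.ne_zero _
    change σ • C.pt a c = C.pt _ _
    have h1 : C.pt a c = C.κ k • C.pt 1 (c / normF a) := by
      rw [κ_pt, hn, mul_one, mul_div_cancel₀ _ h0]
      rfl
    rw [h1, smul_smul, hκ, mul_smul, hσF, κ_pt, hF, map_inv, Units.val_inv_eq_inv_val,
      Units.val_inv_eq_inv_val, hn']
    rfl

end Coord

/-- Two faithful actions in which the elements of either group act as elements of the other do,
with respect to parametrizations by the same set, come from isomorphic groups. -/
lemma nonempty_mulEquiv_of_actions {G H Ω Ω' X : Type*} [Group G] [Group H] [MulAction G Ω]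
    [MulAction H Ω'] {f : X → Ω} {f' : X → Ω'} (hf : Function.Surjective f)
    (hf' : Function.Surjective f') (hG : ∀ g : G, (∀ ω : Ω, g • ω = ω) → g = 1)
    (hH : ∀ h : H, (∀ ω : Ω', h • ω = ω) → h = 1)
    (h₁ : ∀ g : G, ∃ h : H, ∀ x y, g • f x = f y → h • f' x = f' y)
    (h₂ : ∀ h : H, ∃ g : G, ∀ x y, h • f' x = f' y → g • f x = f y) : Nonempty (G ≃* H) := by
  have hG' : ∀ g g' : G, (∀ x, g • f x = g' • f x) → g = g' := fun g g' h =>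
    (inv_mul_eq_one.1 (hG _ fun ω => by
      obtain ⟨x, rfl⟩ := hf ω
      rw [mul_smul, h, inv_smul_smul])).symm
  have hH' : ∀ g g' : H, (∀ x, g • f' x = g' • f' x) → g = g' := fun g g' h =>
    (inv_mul_eq_one.1 (hH _ fun ω => by
      obtain ⟨x, rfl⟩ := hf' ω
      rw [mul_smul, h, inv_smul_smul])).symm
  choose F hF using h₁
  choose F' hF' using h₂
  refine ⟨{ toFun := F, invFun := F', left_inv := fun g => ?_, right_inv := fun h => ?_,
            map_mul' := fun a b => ?_ }⟩
  · refine hG' _ _ fun x => ?_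
    obtain ⟨y, hy⟩ := hf (g • f x)
    rw [← hy]
    exact hF' _ _ _ (hF _ _ _ hy.symm)
  · refine hH' _ _ fun x => ?_
    obtain ⟨y, hy⟩ := hf' (h • f' x)
    rw [← hy]
    exact hF _ _ _ (hF' _ _ _ hy.symm)
  · refine hH' _ _ fun x => ?_
    obtain ⟨y, hy⟩ := hf (b • f x)
    obtain ⟨w, hw⟩ := hf (a • f y)
    rw [mul_smul, hF b x y hy.symm, hF a y w hw.symm]
    exact hF _ _ _ (by rw [mul_smul, ← hy, hw])

namespace Coord

lemma exists_smul_point {G H Ω Ω' : Type*} [Group G] [Group H] [MulAction G Ω] [MulAction H Ω']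
    {o z : Ω} {o' z' : Ω'} (C : Coord G Ω o z) (C' : Coord H Ω' o' z') (hθ : C.θ = 1)
    (hθ' : C'.θ = 1) (g : G) :
    ∃ h : H, ∀ x y, g • C.point x = C.point y → h • C'.point x = C'.point y := by
  let Q : G → Prop := fun g => ∃ h : H, ∀ x y, g • C.point x = C.point y → h • C'.point x = C'.point y
  have hmul : ∀ a b, Q a → Q b → Q (a * b) := by
    rintro a b ⟨a', ha⟩ ⟨b', hb⟩
    refine ⟨a' * b', fun x y h => ?_⟩
    obtain ⟨w, hw⟩ := C.point_surjective (b • C.point x)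
    rw [mul_smul, hb x w hw.symm, ha w y (by rw [hw, ← mul_smul, h])]
  have hof : ∀ (m : Option (F3721 × ZMod 61) → Option (F3721 × ZMod 61)) a (a' : H),
      (∀ x, a • C.point x = C.point (m x)) → (∀ x, a' • C'.point x = C'.point (m x)) → Q a :=
    fun m a a' h h' => ⟨a', fun x y hxy => by
      rw [h' x, C.point_injective ((h x).symm.trans hxy)]⟩
  have hd : ∀ b, Q (C.d b) := fun b =>
    hof (Option.map fun p => (b + p.1, (b.re * p.1.im - b.im * p.1.re) + p.2)) _ (C'.d b)
      (by
        rintro (_ | ⟨a, c⟩)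
        · exact C.d_o b
        · exact (C.d_pt b a c).trans (by rw [hθ, one_mul]; rfl))
      (by
        rintro (_ | ⟨a, c⟩)
        · exact C'.d_o b
        · exact (C'.d_pt b a c).trans (by rw [hθ', one_mul]; rfl))
  have hu : ∀ b, Q (C.u b) := fun b =>
    hof (Option.map fun p => (p.1, b + p.2)) _ (C'.u b)
      (by
        rintro (_ | ⟨a, c⟩)
        exacts [C.u_o b, C.u_pt b a c])
      (by
        rintro (_ | ⟨a, c⟩)
        exacts [C'.u_o b, C'.u_pt b a c])
  have hκ : ∀ k, Q (C.κ k) := fun k =>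
    hof (Option.map fun p => (k * p.1, normF k * p.2)) _ (C'.κ k)
      (by
        rintro (_ | ⟨a, c⟩)
        · exact C.κ_o k
        · exact (C.κ_pt k a c).trans (by rw [ψ_eq hθ]; rfl))
      (by
        rintro (_ | ⟨a, c⟩)
        · exact C'.κ_o k
        · exact (C'.κ_pt k a c).trans (by rw [ψ_eq hθ']; rfl))
  obtain ⟨σ, hσ⟩ := C.exists_weylMap hθ
  obtain ⟨σ', hσ'⟩ := C'.exists_weylMap hθ'
  have hstab : ∀ g : G, g • o = o → Q g := fun g hg => by
    obtain ⟨a, c, h⟩ := C.exists_smul_z (g • z) fun h => C.z_ne (smul_left_cancel g (h.trans hg.symm))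
    obtain ⟨k, hk⟩ := C.exists_κ ((C.d a * C.u c)⁻¹ * g)
      (by rw [mul_smul, hg, inv_smul_eq_iff, mul_smul, C.u_o, C.d_o])
      (by rw [mul_smul, ← h, inv_smul_smul])
    rw [eq_inv_mul_iff_mul_eq] at hk
    rw [← hk]
    exact hmul _ _ (hmul _ _ (hd a) (hu c)) (hκ k)
  change Q g
  by_cases hg : g • o = o
  · exact hstab g hg
  obtain ⟨a, c, h⟩ := C.exists_smul_z _ hg
  have hσo : σ • o = z := (hσ none).trans C.pt_zero_zero
  have h1 := hmul _ _ (hmul _ _ (hmul _ _ (hd a) (hu c)) (hof _ _ _ hσ hσ'))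
    (hstab ((C.d a * C.u c * σ)⁻¹ * g) (by
      rw [mul_smul, inv_smul_eq_iff, ← h, mul_smul _ σ, hσo]))
  rwa [mul_inv_cancel_left] at h1

lemma nonempty_mulEquiv {G H Ω Ω' : Type*} [Group G] [Group H] [MulAction G Ω] [MulAction H Ω']
    {o z : Ω} {o' z' : Ω'} (C : Coord G Ω o z) (C' : Coord H Ω' o' z') : Nonempty (G ≃* H) := by
  obtain ⟨D, hD⟩ := C.exists_θ_eq_one
  obtain ⟨D', hD'⟩ := C'.exists_θ_eq_one
  exact nonempty_mulEquiv_of_actions D.point_surjective D'.point_surjective D.faithful D'.faithful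
    (D.exists_smul_point D' hD hD') (D'.exists_smul_point D hD' hD)

end Coord

lemma U361Data.nonempty_mulEquiv {G H : Type*} [Group G] [Group H] [Finite G] [Finite H]
    (hG : U361Data G) (hH : U361Data H) : Nonempty (G ≃* H) := by
  obtain ⟨P, U, R, l, hC⟩ := hG.exists_config
  obtain ⟨P', U', R', l', hC'⟩ := hH.exists_config
  obtain ⟨C⟩ := hC.nonempty_coord
  obtain ⟨C'⟩ := hC'.nonempty_coord
  exact C.nonempty_mulEquiv C'

/-- Any two finite groups of order `2^4 * 3 * 5 * 7 * 31^2 * 61^3 * 523` whose prime graphs have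
vertex degrees deg 2 = 4, deg 3 = 3, deg 5 = 3, deg 7 = 1, deg 31 = 4, deg 61 = 2, deg 523 = 1 are isomorphic (the
order and degree pattern of the simple unitary group `U_3(61)`). -/
theorem od_characterization_U_3_61
    (G H : Type*) [Group G] [Finite G] [Group H] [Finite H]
    (hG : Nat.card G = 2^4 * 3 * 5 * 7 * 31^2 * 61^3 * 523)
    (hH : Nat.card H = 2^4 * 3 * 5 * 7 * 31^2 * 61^3 * 523)
    (hG2 : gkDegree G 2 = 4)
    (hG3 : gkDegree G 3 = 3)
    (hG5 : gkDegree G 5 = 3)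
    (hG7 : gkDegree G 7 = 1)
    (hG31 : gkDegree G 31 = 4)
    (hG61 : gkDegree G 61 = 2)
    (hG523 : gkDegree G 523 = 1)
    (hH2 : gkDegree H 2 = 4)
    (hH3 : gkDegree H 3 = 3)
    (hH5 : gkDegree H 5 = 3)
    (hH7 : gkDegree H 7 = 1)
    (hH31 : gkDegree H 31 = 4)
    (hH61 : gkDegree H 61 = 2)
    (hH523 : gkDegree H 523 = 1) :
    Nonempty (G ≃* H) := by
  exact (U361Data.of_gkDegree hG hG2 hG3 hG5 hG7 hG31 hG61 hG523).nonempty_mulEquiv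
    (.of_gkDegree hH hH2 hH3 hH5 hH7 hH31 hH61 hH523)
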